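/- arXiv:2009.11650 — 2 statements merged into one kernel-verified Lean document; each statement's English description precedes it below -/
import Mathlib

section
/- Let d ≥ 2 and let Ω be homogeneous of degree zero and integrable on S^{d−1} with ∫_{S^{d−1}} |Ω(θ)| log²(e + |Ω(θ)|) dθ < ∞. Set E₀ = {θ ∈ S^{d−1} : |Ω(θ)| ≤ 1}, E_i = {θ : 2^{i−1} < |Ω(θ)| ≤ 2^i} for integers i ≥ 1, and Ω_i = Ω·χ_{E_i}. Let b ∈ BMO(ℝ^d) with ‖b‖_{BMO} ≤ 1 and let N₀ ∈ ℕ. Then Σ_{i=0}^∞ Σ_{s=100}^{N₀ i} Σ_{j∈ℤ} Σ_{Q∈S_{j−s}} ‖(b − ⟨b⟩_Q) T_j^i h_Q‖_{L¹(ℝ^d)} ≤ C_{d,N₀} (1 + ∫_{S^{d−1}} |Ω(θ)| log²(e + |Ω(θ)|) dθ) Σ_{Q∈S} ‖h_Q‖_{L¹(ℝ^d)}. -/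
open MeasureTheory Metric Set Filter
open scoped ENNReal NNReal Real Topology Pointwise FourierTransform RealInnerProductSpace

noncomputable section

/-- Euclidean space `ℝ^d`. -/
abbrev Rd (d : ℕ) := EuclideanSpace ℝ (Fin d)

/-- Surface measure on the unit sphere `S^{d-1}`, realized as the `(d-1)`-dimensional
Hausdorff measure restricted to the sphere. -/
def sphereMeasure (d : ℕ) : Measure (Rd d) := (μH[(d : ℝ) - 1]).restrict (sphere (0 : Rd d) 1)

/-- `Φ(t) = t log(e + t)`. -/
def Phi (t : ℝ) : ℝ := t * Real.log (Real.exp 1 + t)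

/-- `Q` is an (axis-parallel, closed) cube with side length `l`. -/
def IsCubeSide {d : ℕ} (Q : Set (Rd d)) (l : ℝ) : Prop :=
  ∃ c : Rd d, Q = {x | ∀ i, x i ∈ Icc (c i) (c i + l)}

/-- `Q` is a (nondegenerate) cube. -/
def IsCube {d : ℕ} (Q : Set (Rd d)) : Prop := ∃ l : ℝ, 0 < l ∧ IsCubeSide Q l

/-- `Q` is a standard dyadic cube `2^k([0,1]^d + m)`. -/
def IsDyadicCube {d : ℕ} (Q : Set (Rd d)) : Prop :=
  ∃ (k : ℤ) (m : Fin d → ℤ),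
    Q = {x | ∀ i, x i ∈ Icc ((2:ℝ)^k * m i) ((2:ℝ)^k * (m i + 1))}

/-- mean value `⟨b⟩_Q` of `b` on `Q`. -/
def cavg {d : ℕ} (b : Rd d → ℝ) (Q : Set (Rd d)) : ℝ := ⨍ x in Q, b x

/-- `b` is in `BMO(ℝ^d)` with `‖b‖_{BMO} ≤ M`. -/
def BMOBound {d : ℕ} (b : Rd d → ℝ) (M : ℝ) : Prop :=
  MeasureTheory.LocallyIntegrable b volume ∧
    ∀ Q : Set (Rd d), IsCube Q → (⨍ x in Q, |b x - cavg b Q|) ≤ M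

/-- `Ω` is homogeneous of degree zero. -/
def Homog0 {d : ℕ} (Ω : Rd d → ℝ) : Prop := ∀ r : ℝ, 0 < r → ∀ x : Rd d, Ω (r • x) = Ω x

/-- The Luxemburg norm `‖f‖_{L^p(log L)^α, Q}`
(`∞`, i.e. `⊤`, if no admissible constant exists). -/
def LuxNorm {d : ℕ} (p α : ℝ) (Q : Set (Rd d)) (f : Rd d → ℝ) : ℝ≥0∞ :=
  sInf {c : ℝ≥0∞ | ∃ t : ℝ, 0 < t ∧ c = ENNReal.ofReal t ∧
    ∫⁻ x in Q,
      ENNReal.ofReal ((|f x| / t) ^ p * (Real.log (Real.exp 1 + |f x| / t)) ^ α) ≤ volume Q}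

/-- convolution `K * g`. -/
def convK {d : ℕ} (K g : Rd d → ℝ) (x : Rd d) : ℝ := ∫ y, K (x - y) * g y

/-- Truncated kernel `K_j(x) = Ω(x/|x|)|x|^{-d} φ_j(x)`, where `φ_j(x) = φ(2^{-j}x)`. -/
def Kj {d : ℕ} (Ωi φ : Rd d → ℝ) (j : ℤ) (x : Rd d) : ℝ :=
  Ωi (‖x‖⁻¹ • x) / ‖x‖ ^ d * φ ((2:ℝ) ^ (-j) • x)

/-- Hypotheses on the radial cut-off function `φ`: smooth, nonnegative, radial,
supported in `{1/2 ≤ |x| ≤ 2}`, with `Σ_j φ(2^{-j}x) = 1` for `x ≠ 0`. -/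
def PhiCutoff {d : ℕ} (φ : Rd d → ℝ) : Prop :=
  ContDiff ℝ (⊤ : ℕ∞) φ ∧ (∀ x, 0 ≤ φ x) ∧ (∃ g : ℝ → ℝ, ∀ x, φ x = g ‖x‖) ∧
    Function.support φ ⊆ {x : Rd d | 1/2 ≤ ‖x‖ ∧ ‖x‖ ≤ 2} ∧
    ∀ x : Rd d, x ≠ 0 → HasSum (fun j : ℤ => φ ((2:ℝ) ^ (-j) • x)) 1

/-- The dyadic pieces `Ω_i = Ω·χ_{E_i}` of `Ω`:
`E_0 = {|Ω| ≤ 1}`, `E_i = {2^{i-1} < |Ω| ≤ 2^i}` for `i ≥ 1`. -/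
def OmI {d : ℕ} (Ω : Rd d → ℝ) (i : ℕ) (x : Rd d) : ℝ :=
  if i = 0 then (if |Ω x| ≤ 1 then Ω x else 0)
  else if (2:ℝ) ^ ((i:ℤ) - 1) < |Ω x| ∧ |Ω x| ≤ (2:ℝ) ^ (i:ℤ) then Ω x else 0

section JohnNirenberg

variable {E : Type*} [NormedAddCommGroup E] [NormedSpace ℝ E] [FiniteDimensional ℝ E]
  [MeasurableSpace E] [BorelSpace E] {μ : Measure E} [μ.IsAddHaarMeasure]

/-- The mean oscillation of `b` about the constants `M x r` is at most `A` on every closed ball. -/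
def OscBound (μ : Measure E) (b : E → ℝ) (M : E → ℝ → ℝ) (A : ℝ) : Prop :=
  ∀ x r, 0 < r →
    ∫⁻ y in closedBall x r, ‖b y - M x r‖ₑ ∂μ ≤ ENNReal.ofReal A * μ (closedBall x r)

lemma abs_sub_le_of_lintegral_le {α : Type*} [MeasurableSpace α] {ν : Measure α} {s : Set α}
    (h0 : ν s ≠ 0) (ht : ν s ≠ ∞) {b : α → ℝ} (hb : AEStronglyMeasurable b (ν.restrict s))
    {c c' p q : ℝ} (hp : 0 ≤ p) (hq : 0 ≤ q)
    (h1 : ∫⁻ y in s, ‖b y - c‖ₑ ∂ν ≤ ENNReal.ofReal p * ν s)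
    (h2 : ∫⁻ y in s, ‖b y - c'‖ₑ ∂ν ≤ ENNReal.ofReal q * ν s) : |c - c'| ≤ p + q := by
  have key : ENNReal.ofReal |c - c'| * ν s ≤ ENNReal.ofReal (p + q) * ν s := by
    calc ENNReal.ofReal |c - c'| * ν s = ∫⁻ _ in s, ‖c - c'‖ₑ ∂ν := by
          rw [setLIntegral_const, ← Real.enorm_eq_ofReal_abs]
      _ ≤ ∫⁻ y in s, (‖b y - c‖ₑ + ‖b y - c'‖ₑ) ∂ν := by
          refine lintegral_mono fun y => ?_
          have : c - c' = (b y - c') - (b y - c) := by ring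
          rw [this, add_comm]
          exact enorm_sub_le
      _ = (∫⁻ y in s, ‖b y - c‖ₑ ∂ν) + ∫⁻ y in s, ‖b y - c'‖ₑ ∂ν :=
          lintegral_add_left' (hb.sub aestronglyMeasurable_const).enorm _
      _ ≤ _ := by
          rw [ENNReal.ofReal_add hp hq, add_mul]
          exact add_le_add h1 h2
  rw [ENNReal.mul_le_mul_iff_left h0 ht] at key
  exact (ENNReal.ofReal_le_ofReal_iff (by positivity)).1 key

lemma measure_closedBall_scale (x x' : E) {t r : ℝ} (ht : 0 ≤ t) (hr : 0 ≤ r) :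
    μ (closedBall x' (t * r)) =
      ENNReal.ofReal (t ^ Module.finrank ℝ E) * μ (closedBall x r) := by
  rw [Measure.addHaar_closedBall_mul μ x' ht hr, ← Measure.addHaar_closedBall_center μ x r]

variable {b : E → ℝ} {M : E → ℝ → ℝ} {A : ℝ}

lemma OscBound.abs_center_sub_le (hM : OscBound μ b M A) (hb : AEStronglyMeasurable b μ) (hA : 0 ≤ A)
    {x x' : E} {t r : ℝ} (ht : 0 < t) (hr : 0 < r)
    (hsub : closedBall x r ⊆ closedBall x' (t * r)) :
    |M x r - M x' (t * r)| ≤ A + A * t ^ Module.finrank ℝ E := by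
  refine abs_sub_le_of_lintegral_le (measure_closedBall_pos μ x hr).ne'
    measure_closedBall_lt_top.ne hb.restrict hA (by positivity) (hM x r hr) ?_
  calc ∫⁻ y in closedBall x r, ‖b y - M x' (t * r)‖ₑ ∂μ
      ≤ ∫⁻ y in closedBall x' (t * r), ‖b y - M x' (t * r)‖ₑ ∂μ := lintegral_mono_set hsub
    _ ≤ ENNReal.ofReal A * μ (closedBall x' (t * r)) := hM _ _ (by positivity)
    _ = _ := by
      rw [measure_closedBall_scale x x' ht.le hr.le, ENNReal.ofReal_mul hA, mul_assoc]

lemma OscBound.abs_center_sub_two_pow_le (hM : OscBound μ b M A) (hb : AEStronglyMeasurable b μ)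
    (hA : 0 ≤ A) (x : E) {r : ℝ} (hr : 0 < r) (k : ℕ) :
    |M x r - M x (2 ^ k * r)| ≤ k * (A + A * 2 ^ Module.finrank ℝ E) := by
  induction k with
  | zero => simp
  | succ k ih =>
    have hs : 0 < 2 ^ k * r := by positivity
    have h2 := hM.abs_center_sub_le hb hA (x := x) (x' := x) two_pos hs
      (closedBall_subset_closedBall (by linarith))
    rw [← mul_assoc, ← pow_succ'] at h2
    have := abs_sub_le (M x r) (M x (2 ^ k * r)) (M x (2 ^ (k + 1) * r))
    push_cast
    linarith

/-- The step of the good-`λ` iteration: a stopping time argument covers the set where `b` is far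
from `M x R` by balls of small total measure on whose enlargements the constant `M` is close to
`M x R`. -/
lemma OscBound.exists_cover (hM : OscBound μ b M A) (hb : LocallyIntegrable b μ) (hA : 0 < A)
    {L C₀ Λ : ℝ} (hC₀ : C₀ = 2 ^ Module.finrank ℝ E * (A + (A + A * 2 ^ Module.finrank ℝ E)))
    (hΛ : Λ = 2 * 5 ^ Module.finrank ℝ E * C₀) (hL : L = A + Λ) (x₀ : E) {R : ℝ} (hR : 0 < R) :
    ∃ (u : Set E) (r : E → ℝ), u.Countable ∧ (∀ a ∈ u, 0 < r a) ∧
      (∀ a ∈ u, |M a (5 * r a) - M x₀ R| ≤ L) ∧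
      (∀ᵐ x ∂μ, x ∈ closedBall x₀ R → L < |b x - M x₀ R| →
        ∃ a ∈ u, x ∈ closedBall a (5 * r a)) ∧
      ∑' a : u, μ (closedBall (a : E) (5 * r a)) ≤ 2⁻¹ * μ (closedBall x₀ R) := by
  set n := Module.finrank ℝ E with hn
  set m := M x₀ R with hm
  have hbm : AEStronglyMeasurable b μ := hb.aestronglyMeasurable
  have hC₀pos : 0 < C₀ := by rw [hC₀]; positivity
  have hΛpos : 0 < Λ := by rw [hΛ]; positivity
  have hC₀Λ : C₀ ≤ Λ := by
    have : (1:ℝ) ≤ 5 ^ n := one_le_pow₀ (by norm_num)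
    rw [hΛ]; nlinarith
  have hfi : LocallyIntegrable (fun x => b x - m) μ := hb.sub (locallyIntegrable_const m)
  have hf : LocallyIntegrable (fun x => ‖b x - m‖) μ := fun x => (hfi x).norm
  have hbig : ∫⁻ y in closedBall x₀ (2 * R), ‖b y - m‖ₑ ∂μ ≤
      ENNReal.ofReal C₀ * μ (closedBall x₀ R) := by
    have hd := hM.abs_center_sub_le hbm hA.le (x := x₀) (x' := x₀) two_pos hR
      (closedBall_subset_closedBall (by linarith))
    calc ∫⁻ y in closedBall x₀ (2 * R), ‖b y - m‖ₑ ∂μ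
        ≤ ∫⁻ y in closedBall x₀ (2 * R), (‖b y - M x₀ (2 * R)‖ₑ + ‖m - M x₀ (2 * R)‖ₑ) ∂μ := by
          refine lintegral_mono fun y => ?_
          have : b y - m = (b y - M x₀ (2 * R)) - (m - M x₀ (2 * R)) := by ring
          rw [this]
          exact enorm_sub_le
      _ = (∫⁻ y in closedBall x₀ (2 * R), ‖b y - M x₀ (2 * R)‖ₑ ∂μ) +
            ‖m - M x₀ (2 * R)‖ₑ * μ (closedBall x₀ (2 * R)) := by
          rw [lintegral_add_right _ measurable_const, setLIntegral_const]
      _ ≤ ENNReal.ofReal A * μ (closedBall x₀ (2 * R)) +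
            ENNReal.ofReal (A + A * 2 ^ n) * μ (closedBall x₀ (2 * R)) := by
          gcongr
          · exact hM _ _ (by positivity)
          · rw [Real.enorm_eq_ofReal_abs]
            exact ENNReal.ofReal_le_ofReal hd
      _ = _ := by
          rw [← add_mul, ← ENNReal.ofReal_add hA.le (by positivity),
            measure_closedBall_scale x₀ x₀ two_pos.le hR.le, ← mul_assoc,
            ← ENNReal.ofReal_mul (by positivity), hC₀, mul_comm (A + _)]
  have hgood : ∀ᵐ x ∂μ, x ∈ closedBall x₀ R → L < |b x - m| →
      ∃ r : ℝ, 0 < r ∧ 5 * r ≤ R ∧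
        ENNReal.ofReal Λ * μ (closedBall x r) < ∫⁻ y in closedBall x r, ‖b y - m‖ₑ ∂μ ∧
        ∫⁻ y in closedBall x (5 * r), ‖b y - m‖ₑ ∂μ ≤
          ENNReal.ofReal Λ * μ (closedBall x (5 * r)) := by
    filter_upwards [IsUnifLocDoublingMeasure.ae_tendsto_average μ hf 1] with x hx hxB hxL
    have hpos : ∀ k : ℕ, 0 < R / 5 ^ k := fun k => by positivity
    have hlim : Tendsto (fun k : ℕ => R / 5 ^ k) atTop (𝓝[>] 0) := by
      refine tendsto_nhdsWithin_iff.2 ⟨?_, Eventually.of_forall fun k => hpos k⟩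
      have := (tendsto_pow_atTop_nhds_zero_of_lt_one (r := (5:ℝ)⁻¹) (by norm_num)
        (by norm_num)).const_mul R
      simpa [div_eq_mul_inv] using this
    have hlim2 := hx (fun _ : ℕ => x) _ hlim
      (Eventually.of_forall fun k => mem_closedBall_self (by have := hpos k; linarith))
    have hex : ∃ k : ℕ, ENNReal.ofReal Λ * μ (closedBall x (R / 5 ^ k)) <
        ∫⁻ y in closedBall x (R / 5 ^ k), ‖b y - m‖ₑ ∂μ := by
      by_contra! hcon
      refine absurd (le_of_tendsto' hlim2 fun k => ?_ : ‖b x - m‖ ≤ Λ) ?_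
      · have hint : IntegrableOn (fun y => b y - m) (closedBall x (R / 5 ^ k)) μ :=
          hfi.integrableOn_isCompact (isCompact_closedBall _ _)
        rw [setAverage_eq, smul_eq_mul, inv_mul_le_iff₀ (by
          exact ENNReal.toReal_pos (measure_closedBall_pos μ x (hpos k)).ne'
            measure_closedBall_lt_top.ne)]
        rw [← ENNReal.ofReal_le_ofReal_iff (by positivity),
          ofReal_integral_norm_eq_lintegral_enorm hint,
          ENNReal.ofReal_mul (by positivity), ofReal_measureReal measure_closedBall_lt_top.ne,
          mul_comm]
        exact hcon k
      · rw [Real.norm_eq_abs]; linarith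
    classical
    have hk := Nat.find_spec hex
    have hk' := fun {j} => Nat.find_min hex (m := j)
    set k := Nat.find hex
    rcases hk0 : k with _ | j
    · exfalso
      rw [hk0, pow_zero, div_one] at hk
      refine absurd hk (not_lt.2 ?_)
      calc ∫⁻ y in closedBall x R, ‖b y - m‖ₑ ∂μ
          ≤ ∫⁻ y in closedBall x₀ (2 * R), ‖b y - m‖ₑ ∂μ := by
            refine lintegral_mono_set (closedBall_subset_closedBall' ?_)
            have := mem_closedBall.1 hxB
            linarith
        _ ≤ ENNReal.ofReal C₀ * μ (closedBall x₀ R) := hbig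
        _ ≤ ENNReal.ofReal Λ * μ (closedBall x R) := by
            rw [Measure.addHaar_closedBall_center μ x₀, Measure.addHaar_closedBall_center μ x]
            gcongr
    · have h5 : 5 * (R / 5 ^ k) = R / 5 ^ j := by
        rw [hk0, pow_succ]; field_simp
      refine ⟨R / 5 ^ k, hpos k, ?_, hk, ?_⟩
      · rw [h5]
        exact div_le_self hR.le (one_le_pow₀ (by norm_num))
      · rw [h5]
        exact not_lt.1 (hk' (by omega))
  classical
  set T : Set E := {x | x ∈ closedBall x₀ R ∧ ∃ r : ℝ, 0 < r ∧ 5 * r ≤ R ∧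
        ENNReal.ofReal Λ * μ (closedBall x r) < ∫⁻ y in closedBall x r, ‖b y - m‖ₑ ∂μ ∧
        ∫⁻ y in closedBall x (5 * r), ‖b y - m‖ₑ ∂μ ≤
          ENNReal.ofReal Λ * μ (closedBall x (5 * r))} with hT
  choose! r hr0 hr5 hrΛ hr5Λ using fun (x : E) (hx : x ∈ T) => hx.2
  obtain ⟨u, huT, hud, hcov⟩ := Vitali.exists_disjoint_subfamily_covering_enlargement_closedBall
    T id r R (fun a ha => by have := hr5 a ha; have := hr0 a ha; linarith) 5 (by norm_num)
  simp only [id] at hud hcov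
  have huc : u.Countable := hud.countable_of_nonempty_interior fun a ha =>
    ⟨a, ball_subset_interior_closedBall (mem_ball_self (hr0 a (huT ha)))⟩
  refine ⟨u, r, huc, fun a ha => hr0 a (huT ha), fun a ha => ?_, ?_, ?_⟩
  · have h5 : 0 < 5 * r a := by have := hr0 a (huT ha); positivity
    rw [hL]
    exact abs_sub_le_of_lintegral_le (measure_closedBall_pos μ a h5).ne'
      measure_closedBall_lt_top.ne hbm.restrict hA.le hΛpos.le (hM a _ h5) (hr5Λ a (huT ha))
  · filter_upwards [hgood] with x hx hxB hxL
    have hxT : x ∈ T := ⟨hxB, hx hxB hxL⟩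
    obtain ⟨a, ha, hsub⟩ := hcov x hxT
    exact ⟨a, ha, hsub (mem_closedBall_self (hr0 x hxT).le)⟩
  · have hΛ0 : ENNReal.ofReal Λ ≠ 0 := by simpa using hΛpos
    have h5n : (0:ℝ) < 5 ^ n := by positivity
    have hsum : ENNReal.ofReal Λ * ∑' a : u, μ (closedBall (a : E) (r a)) ≤
        ENNReal.ofReal C₀ * μ (closedBall x₀ R) := by
      calc ENNReal.ofReal Λ * ∑' a : u, μ (closedBall (a : E) (r a))
          = ∑' a : u, ENNReal.ofReal Λ * μ (closedBall (a : E) (r a)) := ENNReal.tsum_mul_left.symm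
        _ ≤ ∑' a : u, ∫⁻ y in closedBall (a : E) (r a), ‖b y - m‖ₑ ∂μ :=
            ENNReal.tsum_le_tsum fun a => (hrΛ a (huT a.2)).le
        _ = ∫⁻ y in ⋃ a ∈ u, closedBall a (r a), ‖b y - m‖ₑ ∂μ :=
            (lintegral_biUnion huc (fun a _ => measurableSet_closedBall) hud _).symm
        _ ≤ ∫⁻ y in closedBall x₀ (2 * R), ‖b y - m‖ₑ ∂μ := by
            refine lintegral_mono_set (iUnion₂_subset fun a ha => ?_)
            refine closedBall_subset_closedBall' ?_
            have h1 := mem_closedBall.1 (huT ha).1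
            have h2 := hr5 a (huT ha)
            have h3 := hr0 a (huT ha)
            linarith
        _ ≤ _ := hbig
    have hΛeq : ENNReal.ofReal Λ = ENNReal.ofReal (5 ^ n) * 2 * ENNReal.ofReal C₀ := by
      rw [hΛ, ENNReal.ofReal_mul (by positivity), ENNReal.ofReal_mul (by positivity),
        ENNReal.ofReal_ofNat]
      ring
    have hC0 : ENNReal.ofReal C₀ ≠ 0 := by simpa using hC₀pos
    have h3 : ∑' a : u, μ (closedBall (a : E) (5 * r a)) =
        ENNReal.ofReal (5 ^ n) * ∑' a : u, μ (closedBall (a : E) (r a)) := by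
      rw [← ENNReal.tsum_mul_left]
      exact tsum_congr fun a => measure_closedBall_scale _ _ (by norm_num) (hr0 a (huT a.2)).le
    rw [h3, ← ENNReal.mul_le_mul_iff_right (a := 2 * ENNReal.ofReal C₀) (by simp [hC₀pos])
      (by finiteness)]
    calc _ = ENNReal.ofReal Λ * ∑' a : u, μ (closedBall (a : E) (r a)) := by rw [hΛeq]; ring
      _ ≤ _ := hsum
      _ = (2 * 2⁻¹) * (ENNReal.ofReal C₀ * μ (closedBall x₀ R)) := by
        rw [ENNReal.mul_inv_cancel two_ne_zero ENNReal.ofNat_ne_top, one_mul]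
      _ = _ := by ring

/-- The **John–Nirenberg inequality** on balls. -/
theorem OscBound.exists_measure_le (A : ℝ) (hA : 0 < A) :
    ∃ L : ℝ, 0 < L ∧ ∀ (b : E → ℝ) (M : E → ℝ → ℝ), LocallyIntegrable b μ → OscBound μ b M A →
      ∀ (k : ℕ) (x : E) (r : ℝ), 0 < r →
        μ {y | y ∈ closedBall x r ∧ k * L < |b y - M x r|} ≤ 2⁻¹ ^ k * μ (closedBall x r) := by
  set C₀ : ℝ := 2 ^ Module.finrank ℝ E * (A + (A + A * 2 ^ Module.finrank ℝ E)) with hC₀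
  set Λ : ℝ := 2 * 5 ^ Module.finrank ℝ E * C₀ with hΛ
  refine ⟨A + Λ, by positivity, fun b M hb hM k => ?_⟩
  induction k with
  | zero =>
    intro x r _
    rw [pow_zero, one_mul]
    exact measure_mono fun y hy => hy.1
  | succ k ih =>
    intro x R hR
    obtain ⟨u, r, huc, hr, hclose, hcov, hsum⟩ := hM.exists_cover hb hA hC₀ hΛ rfl x hR
    set L := A + Λ with hL
    have hLpos : 0 < L := by positivity
    have hsub : {y | y ∈ closedBall x R ∧ ((k + 1 : ℕ) : ℝ) * L < |b y - M x R|} ≤ᵐ[μ]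
        ⋃ a ∈ u, {y | y ∈ closedBall a (5 * r a) ∧ k * L < |b y - M a (5 * r a)|} := by
      filter_upwards [hcov] with y hy hyE
      obtain ⟨hyB, hyL⟩ := hyE
      push_cast at hyL
      have hkL : 0 ≤ k * L := by positivity
      obtain ⟨a, ha, hya⟩ := hy hyB (by linarith)
      refine mem_iUnion₂.2 ⟨a, ha, hya, ?_⟩
      have h1 := hclose a ha
      have h2 := abs_sub_le (b y) (M a (5 * r a)) (M x R)
      linarith
    calc _ ≤ _ := measure_mono_ae hsub
      _ ≤ ∑' a : u, μ {y | y ∈ closedBall (a : E) (5 * r a) ∧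
            k * L < |b y - M a (5 * r a)|} := measure_biUnion_le μ huc _
      _ ≤ ∑' a : u, 2⁻¹ ^ k * μ (closedBall (a : E) (5 * r a)) :=
          ENNReal.tsum_le_tsum fun a => ih _ _ (by have := hr a a.2; positivity)
      _ ≤ 2⁻¹ ^ k * (2⁻¹ * μ (closedBall x R)) := by
          rw [ENNReal.tsum_mul_left]
          gcongr
      _ = _ := by rw [pow_succ, mul_assoc]

lemma succ_mul_two_pow_le {n i : ℕ} (h : 8 * i ≤ n) :
    ((n : ℝ) + 1) * 2 ^ i ≤ 4 * (1 / 2) ^ i * (3 / 2) ^ n := by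
  have h1 : (n : ℝ) + 1 ≤ 4 * (5 / 4) ^ n := by
    have := one_add_mul_le_pow (a := (1 / 4 : ℝ)) (by norm_num) n
    norm_num at this ⊢
    linarith
  have h2 : (4 : ℝ) ^ i ≤ (6 / 5) ^ n :=
    calc (4 : ℝ) ^ i ≤ ((6 / 5) ^ 8) ^ i := by gcongr; norm_num
      _ = (6 / 5) ^ (8 * i) := by rw [pow_mul]
      _ ≤ (6 / 5) ^ n := pow_le_pow_right₀ (by norm_num) h
  have h3 : (2 : ℝ) ^ i = (1 / 2) ^ i * 4 ^ i := by rw [← mul_pow]; norm_num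
  calc ((n : ℝ) + 1) * 2 ^ i ≤ (4 * (5 / 4) ^ n) * ((1 / 2) ^ i * (6 / 5) ^ n) := by
        rw [h3]; gcongr
    _ = 4 * (1 / 2) ^ i * ((5 / 4) ^ n * (6 / 5) ^ n) := by ring
    _ = _ := by rw [← mul_pow]; norm_num

lemma ofReal_mul_le_of_le_two_pow {f L : ℝ} (hL : 0 < L) {i : ℕ} {v : ℝ≥0∞}
    (hv : v ≤ 2 ^ i) :
    ENNReal.ofReal f * v ≤ ENNReal.ofReal L * (8 * i * v + 4 * 2⁻¹ ^ i *
      ∑' n : ℕ, if n * L < f then ENNReal.ofReal (3 / 2) ^ n else 0) := by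
  rcases le_or_gt f (8 * i * L) with h | h
  · calc ENNReal.ofReal f * v ≤ ENNReal.ofReal (L * (8 * i)) * v := by
          gcongr; linarith
      _ = ENNReal.ofReal L * (8 * i * v) := by
          rw [ENNReal.ofReal_mul hL.le, ENNReal.ofReal_mul (by norm_num), ENNReal.ofReal_natCast,
            ENNReal.ofReal_ofNat]
          ring
      _ ≤ _ := by gcongr; exact le_self_add
  · have hfL : ((8 * i : ℕ) : ℝ) < f / L := by
      rw [lt_div_iff₀ hL]; push_cast; exact h
    have hceil : 8 * i < ⌈f / L⌉₊ := Nat.lt_ceil.2 hfL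
    obtain ⟨n, hn⟩ : ∃ n, ⌈f / L⌉₊ = n + 1 := ⟨⌈f / L⌉₊ - 1, by omega⟩
    have hn1 : n * L < f := by
      rw [← lt_div_iff₀ hL, ← Nat.lt_ceil]; omega
    have hn2 : f ≤ (n + 1) * L := by
      rw [← div_le_iff₀ hL]
      exact_mod_cast hn ▸ Nat.le_ceil (f / L)
    have hterm : ENNReal.ofReal (3 / 2) ^ n ≤
        ∑' n : ℕ, if n * L < f then ENNReal.ofReal (3 / 2) ^ n else 0 :=
      le_trans (by simp [hn1]) (ENNReal.le_tsum n)
    calc ENNReal.ofReal f * v ≤ ENNReal.ofReal ((n + 1) * L) * 2 ^ i := by gcongr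
      _ = ENNReal.ofReal (L * (((n : ℝ) + 1) * 2 ^ i)) := by
          rw [← ENNReal.ofReal_ofNat 2, ← ENNReal.ofReal_pow (by norm_num),
            ← ENNReal.ofReal_mul (by positivity)]
          ring_nf
      _ ≤ ENNReal.ofReal (L * (4 * (1 / 2) ^ i * (3 / 2) ^ n)) := by
          gcongr ENNReal.ofReal (L * ?_)
          exact succ_mul_two_pow_le (by omega)
      _ = ENNReal.ofReal L * (4 * 2⁻¹ ^ i * ENNReal.ofReal (3 / 2) ^ n) := by
          rw [ENNReal.ofReal_mul hL.le, ENNReal.ofReal_mul (by positivity),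
            ENNReal.ofReal_mul (by norm_num), ENNReal.ofReal_pow (by norm_num),
            ENNReal.ofReal_pow (by norm_num), one_div, ENNReal.ofReal_inv_of_pos two_pos,
            ENNReal.ofReal_ofNat, ENNReal.ofReal_ofNat]
      _ ≤ _ := by
          refine le_trans ?_ (mul_le_mul_right le_add_self _)
          gcongr

/-- Exponential integrability of `b` paired with a weight bounded by `2 ^ i`. -/
theorem OscBound.exists_lintegral_mul_le (A : ℝ) (hA : 0 < A) :
    ∃ L : ℝ, 0 < L ∧ ∀ (b : E → ℝ) (M : E → ℝ → ℝ), LocallyIntegrable b μ → OscBound μ b M A →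
      ∀ (i : ℕ) (w : E → ℝ≥0∞), Measurable w → (∀ y, w y ≤ 2 ^ i) → ∀ (x : E) (r : ℝ), 0 < r →
        ∫⁻ y in closedBall x r, ‖b y - M x r‖ₑ * w y ∂μ ≤ ENNReal.ofReal L *
          (8 * i * (∫⁻ y in closedBall x r, w y ∂μ) + 16 * 2⁻¹ ^ i * μ (closedBall x r)) := by
  obtain ⟨L, hL, hJN⟩ := OscBound.exists_measure_le (μ := μ) A hA
  refine ⟨L, hL, fun b M hb hM i w hw hwi x r hr => ?_⟩
  set m := M x r with hm
  set g : E → ℝ≥0∞ := fun y =>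
    ∑' n : ℕ, if n * L < |b y - m| then ENNReal.ofReal (3 / 2) ^ n else 0 with hg
  have hbm : AEMeasurable (fun y => |b y - m|) (μ.restrict (closedBall x r)) :=
    ((hb.aestronglyMeasurable.aemeasurable.sub_const m).abs).restrict
  have hset : ∀ n : ℕ, NullMeasurableSet {y | n * L < |b y - m|} (μ.restrict (closedBall x r)) :=
    fun n => nullMeasurableSet_lt aemeasurable_const hbm
  have hgint : ∫⁻ y in closedBall x r, g y ∂μ ≤ 4 * μ (closedBall x r) := by
    have hind : ∀ n : ℕ, (fun y => if n * L < |b y - m| then ENNReal.ofReal (3 / 2) ^ n else 0) =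
        {y | n * L < |b y - m|}.indicator fun _ => ENNReal.ofReal (3 / 2) ^ n := fun n => rfl
    have hae : ∀ n : ℕ, AEMeasurable
        (fun y => if n * L < |b y - m| then ENNReal.ofReal (3 / 2) ^ n else 0)
        (μ.restrict (closedBall x r)) := fun n => by
      rw [hind]
      exact aemeasurable_const.indicator₀ (hset n)
    rw [hg, lintegral_tsum hae]
    calc ∑' n : ℕ, ∫⁻ y in closedBall x r,
          (if n * L < |b y - m| then ENNReal.ofReal (3 / 2) ^ n else 0) ∂μ
        ≤ ∑' n : ℕ, ENNReal.ofReal (3 / 4) ^ n * μ (closedBall x r) := by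
          refine ENNReal.tsum_le_tsum fun n => ?_
          rw [hind, lintegral_indicator_const₀ (hset n),
            Measure.restrict_apply' measurableSet_closedBall]
          calc ENNReal.ofReal (3 / 2) ^ n * μ ({y | n * L < |b y - m|} ∩ closedBall x r)
              ≤ ENNReal.ofReal (3 / 2) ^ n * (2⁻¹ ^ n * μ (closedBall x r)) := by
                gcongr
                refine le_trans (measure_mono ?_) (hJN b M hb hM n x r hr)
                exact fun y hy => ⟨hy.2, hy.1⟩
            _ = _ := by
                rw [← mul_assoc, ← mul_pow, ← ENNReal.ofReal_ofNat 2,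
                  ← ENNReal.ofReal_inv_of_pos two_pos, ← ENNReal.ofReal_mul (by norm_num)]
                norm_num
      _ = 4 * μ (closedBall x r) := by
          rw [ENNReal.tsum_mul_right, ENNReal.tsum_geometric, ← ENNReal.ofReal_one,
            ← ENNReal.ofReal_sub _ (by norm_num), ← ENNReal.ofReal_inv_of_pos (by norm_num)]
          norm_num
  calc ∫⁻ y in closedBall x r, ‖b y - m‖ₑ * w y ∂μ
      ≤ ∫⁻ y in closedBall x r, ENNReal.ofReal L * (8 * i * w y + 4 * 2⁻¹ ^ i * g y) ∂μ := by
        refine lintegral_mono fun y => ?_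
        rw [Real.enorm_eq_ofReal_abs]
        exact ofReal_mul_le_of_le_two_pow hL (hwi y)
    _ = ENNReal.ofReal L * (8 * i * (∫⁻ y in closedBall x r, w y ∂μ) +
          4 * 2⁻¹ ^ i * ∫⁻ y in closedBall x r, g y ∂μ) := by
        rw [lintegral_const_mul' _ _ ENNReal.ofReal_ne_top, lintegral_add_left (by fun_prop),
          lintegral_const_mul _ hw, lintegral_const_mul' _ _ (by finiteness)]
    _ ≤ ENNReal.ofReal L * (8 * i * (∫⁻ y in closedBall x r, w y ∂μ) +
          4 * 2⁻¹ ^ i * (4 * μ (closedBall x r))) := by gcongr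
    _ = _ := by ring

end JohnNirenberg

section Cone

variable {d : ℕ}

lemma measurable_inv_norm_smul : Measurable fun z : Rd d => ‖z‖⁻¹ • z := by fun_prop

lemma norm_inv_norm_smul {z : Rd d} (hz : z ≠ 0) : ‖‖z‖⁻¹ • z‖ = 1 := by
  rw [norm_smul, norm_inv, norm_norm, inv_mul_cancel₀ (norm_ne_zero_iff.2 hz)]

/-- A truncated cone over a set of directions of diameter at most `δ` lies in a tube around a
segment. -/
lemma volume_cone_le_of_ediam_le (hd : 1 ≤ d) {R δ : ℝ} (hR : 0 < R) (hδ : 0 < δ) (hδ1 : δ ≤ 1)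
    {t : Set (Rd d)} (ht : ediam t ≤ ENNReal.ofReal δ) :
    volume {z : Rd d | z ∈ closedBall 0 R ∧ z ≠ 0 ∧ ‖z‖⁻¹ • z ∈ t} ≤
      ENNReal.ofReal (2 ^ (d + 1) * volume.real (ball (0 : Rd d) 1) * R ^ d * δ ^ (d - 1)) := by
  rcases Set.eq_empty_or_nonempty {z : Rd d | z ∈ closedBall 0 R ∧ z ≠ 0 ∧ ‖z‖⁻¹ • z ∈ t}
    with he | ⟨z₀, hz₀R, hz₀, hz₀t⟩
  · rw [he, measure_empty]
    exact zero_le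
  set θ₀ := ‖z₀‖⁻¹ • z₀ with hθ₀
  have hθ₀n : ‖θ₀‖ = 1 := norm_inv_norm_smul hz₀
  have hδR : 0 < δ * R := by positivity
  have hcover : {z : Rd d | z ∈ closedBall 0 R ∧ z ≠ 0 ∧ ‖z‖⁻¹ • z ∈ t} ⊆
      ⋃ k ∈ Finset.range (⌊δ⁻¹⌋₊ + 1), closedBall ((k * (δ * R)) • θ₀) (2 * (δ * R)) := by
    rintro z ⟨hzR, hz, hzt⟩
    have hzR' : ‖z‖ ≤ R := by simpa using hzR
    refine mem_iUnion₂.2 ⟨⌊‖z‖ / (δ * R)⌋₊, ?_, ?_⟩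
    · rw [Finset.mem_range, Nat.lt_add_one_iff]
      refine Nat.floor_le_floor ?_
      rw [div_le_iff₀ hδR, inv_mul_cancel_left₀ hδ.ne']
      exact hzR'
    · have hdist : dist (‖z‖⁻¹ • z) θ₀ ≤ δ := by
        rw [← ENNReal.ofReal_le_ofReal_iff hδ.le, ← edist_dist]
        exact (edist_le_ediam_of_mem hzt hz₀t).trans ht
      have hz' : z = ‖z‖ • (‖z‖⁻¹ • z) := by
        rw [smul_smul, mul_inv_cancel₀ (norm_ne_zero_iff.2 hz), one_smul]
      have hfl := Nat.floor_le (a := ‖z‖ / (δ * R)) (by positivity)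
      have hfl' := (Nat.lt_floor_add_one (‖z‖ / (δ * R))).le
      rw [le_div_iff₀ hδR] at hfl
      rw [div_le_iff₀ hδR] at hfl'
      set k : ℝ := (⌊‖z‖ / (δ * R)⌋₊ : ℝ)
      rw [mem_closedBall, dist_eq_norm]
      calc ‖z - (k * (δ * R)) • θ₀‖
          = ‖‖z‖ • (‖z‖⁻¹ • z - θ₀) + (‖z‖ - k * (δ * R)) • θ₀‖ := by
            congr 1
            rw [smul_sub, ← hz', sub_smul]
            abel
        _ ≤ ‖z‖ * δ + (δ * R) := by
            refine (norm_add_le _ _).trans (add_le_add ?_ ?_)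
            · rw [norm_smul, norm_norm, ← dist_eq_norm]
              gcongr
            · rw [norm_smul, hθ₀n, mul_one, Real.norm_eq_abs, abs_le]
              constructor <;> linarith
        _ ≤ 2 * (δ * R) := by nlinarith
  calc _ ≤ _ := measure_mono hcover
    _ ≤ ∑ k ∈ Finset.range (⌊δ⁻¹⌋₊ + 1),
          volume (closedBall ((k * (δ * R)) • θ₀) (2 * (δ * R))) := measure_biUnion_finset_le _ _
    _ = ENNReal.ofReal ((⌊δ⁻¹⌋₊ + 1) * ((2 * (δ * R)) ^ d * volume.real (ball (0 : Rd d) 1))) := by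
        have : ∀ k ∈ Finset.range (⌊δ⁻¹⌋₊ + 1),
            volume (closedBall ((k * (δ * R)) • θ₀) (2 * (δ * R))) =
              ENNReal.ofReal ((2 * (δ * R)) ^ d * volume.real (ball (0 : Rd d) 1)) := fun k _ => by
          rw [Measure.addHaar_closedBall _ _ (by positivity), finrank_euclideanSpace_fin,
            ENNReal.ofReal_mul (by positivity), ofReal_measureReal measure_ball_lt_top.ne]
        rw [Finset.sum_congr rfl this, Finset.sum_const, Finset.card_range, nsmul_eq_mul,
          ENNReal.ofReal_mul (p := (⌊δ⁻¹⌋₊ : ℝ) + 1) (by positivity),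
          ← Nat.cast_add_one, ENNReal.ofReal_natCast]
    _ ≤ ENNReal.ofReal ((2 * δ⁻¹) * ((2 * (δ * R)) ^ d * volume.real (ball (0 : Rd d) 1))) := by
        gcongr
        have := Nat.floor_le (inv_nonneg.2 hδ.le)
        have := (one_le_inv₀ hδ).2 hδ1
        linarith
    _ = _ := by
        obtain ⟨e, rfl⟩ : ∃ e, d = e + 1 := ⟨d - 1, by omega⟩
        congr 1
        rw [Nat.add_sub_cancel]
        field_simp
        ring

lemma volume_cone_le (hd : 2 ≤ d) {R : ℝ} (hR : 0 < R) {t : Set (Rd d)} (ht : ediam t ≤ 2⁻¹) :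
    volume {z : Rd d | z ∈ closedBall 0 R ∧ z ≠ 0 ∧ ‖z‖⁻¹ • z ∈ t} ≤
      ENNReal.ofReal (2 ^ (d + 1) * volume.real (ball (0 : Rd d) 1) * R ^ d) *
        ediam t ^ ((d : ℝ) - 1) := by
  have htop : ediam t ≠ ∞ := ne_top_of_le_ne_top (by simp) ht
  set δ₀ := (ediam t).toReal with hδ₀
  have hlt : δ₀ < 1 := by
    refine (ENNReal.toReal_lt_of_lt_ofReal (lt_of_le_of_lt ht ?_))
    rw [ENNReal.ofReal_one]
    exact ENNReal.inv_lt_one.2 ENNReal.one_lt_two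
  have hlim : Tendsto (fun δ : ℝ => ENNReal.ofReal
      (2 ^ (d + 1) * volume.real (ball (0 : Rd d) 1) * R ^ d * δ ^ (d - 1))) (𝓝[>] δ₀)
      (𝓝 (ENNReal.ofReal
        (2 ^ (d + 1) * volume.real (ball (0 : Rd d) 1) * R ^ d * δ₀ ^ (d - 1)))) := by
    have : Continuous fun δ : ℝ => ENNReal.ofReal
      (2 ^ (d + 1) * volume.real (ball (0 : Rd d) 1) * R ^ d * δ ^ (d - 1)) :=
      ENNReal.continuous_ofReal.comp (by fun_prop)
    exact (this.tendsto δ₀).mono_left nhdsWithin_le_nhds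
  have hpow : ediam t ^ ((d : ℝ) - 1) = ENNReal.ofReal (δ₀ ^ (d - 1)) := by
    rw [ENNReal.ofReal_pow ENNReal.toReal_nonneg, ENNReal.ofReal_toReal htop,
      ← ENNReal.rpow_natCast, Nat.cast_sub (by omega), Nat.cast_one]
  rw [hpow, ← ENNReal.ofReal_mul (by positivity)]
  refine ge_of_tendsto hlim ?_
  filter_upwards [Ioo_mem_nhdsGT hlt] with δ hδ
  have hδpos : 0 < δ := ENNReal.toReal_nonneg.trans_lt hδ.1
  refine volume_cone_le_of_ediam_le (by omega) hR hδpos hδ.2.le ?_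
  rw [← ENNReal.ofReal_toReal htop]
  exact ENNReal.ofReal_le_ofReal hδ.1.le

/-- Integrals over a ball of a function of the direction are controlled by the integral over the
sphere. -/
theorem exists_lintegral_closedBall_le_sphereMeasure (hd : 2 ≤ d) :
    ∃ c : ℝ, 0 < c ∧ ∀ R : ℝ, 0 < R → ∀ f : Rd d → ℝ≥0∞, Measurable f →
      ∫⁻ z in closedBall (0 : Rd d) R, f (‖z‖⁻¹ • z) ≤
        ENNReal.ofReal (c * R ^ d) * ∫⁻ θ, f θ ∂sphereMeasure d := by
  have hv : 0 < volume.real (ball (0 : Rd d) 1) :=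
    ENNReal.toReal_pos (measure_ball_pos _ _ one_pos).ne' measure_ball_lt_top.ne
  refine ⟨2 ^ (d + 1) * volume.real (ball (0 : Rd d) 1), by positivity, fun R hR f hf => ?_⟩
  set c := ENNReal.ofReal (2 ^ (d + 1) * volume.real (ball (0 : Rd d) 1) * R ^ d) with hc
  have hc0 : c ≠ 0 := by
    rw [hc, Ne, ENNReal.ofReal_eq_zero, not_le]; positivity
  have hct : c ≠ ∞ := ENNReal.ofReal_ne_top
  set ν : Measure (Rd d) :=
    Measure.map (fun z => ‖z‖⁻¹ • z) (volume.restrict (closedBall (0 : Rd d) R \ {0})) with hν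
  have hle : c⁻¹ • ν ≤ μH[(d : ℝ) - 1] := by
    refine Measure.le_hausdorffMeasure _ _ 2⁻¹ (by simp) fun s hs => ?_
    calc (c⁻¹ • ν) s ≤ c⁻¹ * ν (closure s) := by
          rw [Measure.smul_apply, smul_eq_mul]
          gcongr
          exact subset_closure
      _ ≤ c⁻¹ * (c * ediam (closure s) ^ ((d : ℝ) - 1)) := by
          gcongr
          rw [hν, Measure.map_apply measurable_inv_norm_smul isClosed_closure.measurableSet,
            Measure.restrict_apply (measurable_inv_norm_smul isClosed_closure.measurableSet)]
          refine le_trans (measure_mono ?_)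
            (volume_cone_le hd hR (t := closure s) (by rwa [ediam_closure]))
          exact fun z hz => ⟨hz.2.1, hz.2.2, hz.1⟩
      _ = ediam s ^ ((d : ℝ) - 1) := by
          rw [← mul_assoc, ENNReal.inv_mul_cancel hc0 hct, one_mul, ediam_closure]
  have hνle : ν ≤ c • μH[(d : ℝ) - 1] := by
    intro s
    have := hle s
    rw [Measure.smul_apply, smul_eq_mul] at this ⊢
    calc ν s = c * (c⁻¹ * ν s) := by rw [← mul_assoc, ENNReal.mul_inv_cancel hc0 hct, one_mul]
      _ ≤ _ := by gcongr
  calc ∫⁻ z in closedBall (0 : Rd d) R, f (‖z‖⁻¹ • z)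
      = ∫⁻ z in closedBall (0 : Rd d) R \ {0}, f (‖z‖⁻¹ • z) := by
        have : Nontrivial (Rd d) := by
          have : Nonempty (Fin d) := ⟨⟨0, by omega⟩⟩
          infer_instance
        refine setLIntegral_congr ?_
        exact (sdiff_null_ae_eq_self (measure_singleton _)).symm
    _ = ∫⁻ z in closedBall (0 : Rd d) R \ {0}, (sphere 0 1).indicator f (‖z‖⁻¹ • z) := by
        refine setLIntegral_congr_fun (measurableSet_closedBall.diff (measurableSet_singleton _))
          fun z hz => ?_
        have : ‖z‖⁻¹ • z ∈ sphere (0 : Rd d) 1 := by simpa using norm_inv_norm_smul hz.2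
        simp only [indicator_of_mem this]
    _ = ∫⁻ θ, (sphere 0 1).indicator f θ ∂ν := by
        rw [hν, lintegral_map (hf.indicator isClosed_sphere.measurableSet)
          measurable_inv_norm_smul]
    _ ≤ ∫⁻ θ, (sphere 0 1).indicator f θ ∂(c • μH[(d : ℝ) - 1]) := lintegral_mono' hνle le_rfl
    _ = c * ∫⁻ θ, f θ ∂sphereMeasure d := by
        rw [lintegral_smul_measure, lintegral_indicator isClosed_sphere.measurableSet,
          smul_eq_mul, sphereMeasure]

end Cone

section Cubes

variable {d : ℕ}

/-- The closed cube with centre `x` and side length `2 * r`. -/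
def centeredCube (x : Rd d) (r : ℝ) : Set (Rd d) := {y | ∀ i, y i ∈ Icc (x i - r) (x i + r)}

lemma isCubeSide_centeredCube (x : Rd d) (r : ℝ) : IsCubeSide (centeredCube x r) (2 * r) := by
  refine ⟨WithLp.toLp 2 fun i => x i - r, ?_⟩
  have : ∀ i, x i - r + 2 * r = x i + r := fun i => by ring
  simp only [this, centeredCube]

lemma IsCubeSide.exists_eq_centeredCube {Q : Set (Rd d)} {l : ℝ} (hQ : IsCubeSide Q l) :
    ∃ x, Q = centeredCube x (l / 2) := by
  obtain ⟨c, rfl⟩ := hQ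
  refine ⟨WithLp.toLp 2 fun i => c i + l / 2, ?_⟩
  have h1 : ∀ i, c i + l / 2 - l / 2 = c i := fun i => by ring
  have h2 : ∀ i, c i + l / 2 + l / 2 = c i + l := fun i => by ring
  simp only [centeredCube, h1, h2]

lemma IsCubeSide.unique (hd : 1 ≤ d) {Q : Set (Rd d)} {l l' : ℝ} (hl : 0 ≤ l) (hl' : 0 ≤ l')
    (h : IsCubeSide Q l) (h' : IsCubeSide Q l') : l = l' := by
  obtain ⟨c, rfl⟩ := h
  obtain ⟨c', hc'⟩ := h'
  have m1 : ∀ i, c i ∈ Icc (c' i) (c' i + l') := by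
    have : c ∈ {x : Rd d | ∀ i, x i ∈ Icc (c i) (c i + l)} := fun i => ⟨le_rfl, by linarith⟩
    rwa [hc'] at this
  have m2 : ∀ i, c' i ∈ Icc (c i) (c i + l) := by
    have : c' ∈ {x : Rd d | ∀ i, x i ∈ Icc (c' i) (c' i + l')} := fun i => ⟨le_rfl, by linarith⟩
    rwa [← hc'] at this
  have m3 : ∀ i, c i + l ∈ Icc (c' i) (c' i + l') := by
    have : (WithLp.toLp 2 fun i => c i + l) ∈ {x : Rd d | ∀ i, x i ∈ Icc (c i) (c i + l)} :=
      fun i => ⟨by simpa using hl, le_rfl⟩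
    rwa [hc'] at this
  have m4 : ∀ i, c' i + l' ∈ Icc (c i) (c i + l) := by
    have : (WithLp.toLp 2 fun i => c' i + l') ∈ {x : Rd d | ∀ i, x i ∈ Icc (c' i) (c' i + l')} :=
      fun i => ⟨by simpa using hl', le_rfl⟩
    rwa [← hc'] at this
  let i : Fin d := ⟨0, hd⟩
  have h1 := m1 i
  have h2 := m2 i
  have h3 := m3 i
  have h4 := m4 i
  simp only [mem_Icc] at h1 h2 h3 h4
  linarith

lemma closedBall_subset_centeredCube (x : Rd d) (r : ℝ) : closedBall x r ⊆ centeredCube x r := by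
  intro y hy i
  have h1 : |y i - x i| ≤ ‖y - x‖ := PiLp.norm_apply_le (y - x) i
  have h2 := h1.trans (mem_closedBall_iff_norm.1 hy)
  rw [abs_le] at h2
  constructor <;> linarith

lemma centeredCube_subset_closedBall (hd : 1 ≤ d) (x : Rd d) {r : ℝ} (hr : 0 ≤ r) :
    centeredCube x r ⊆ closedBall x (d * r) := by
  intro y hy
  rw [mem_closedBall, EuclideanSpace.dist_eq, Real.sqrt_le_iff]
  have hd' : (1 : ℝ) ≤ d := by exact_mod_cast hd
  refine ⟨by positivity, ?_⟩
  calc ∑ i, dist (y i) (x i) ^ 2 ≤ ∑ _i : Fin d, r ^ 2 := by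
        refine Finset.sum_le_sum fun i _ => ?_
        have := hy i
        gcongr
        rw [Real.dist_eq, abs_le]
        constructor <;> linarith [this.1, this.2]
    _ = d * r ^ 2 := by simp
    _ ≤ (d * r) ^ 2 := by
        rw [mul_pow]
        gcongr
        nlinarith

lemma BMOBound.lintegral_le {b : Rd d → ℝ} (hb : BMOBound b 1) (hd : 1 ≤ d) (x : Rd d) {r : ℝ}
    (hr : 0 < r) :
    ∫⁻ y in centeredCube x r, ‖b y - cavg b (centeredCube x r)‖ₑ ≤ volume (centeredCube x r) := by
  have hsub := centeredCube_subset_closedBall hd x hr.le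
  have htop : volume (centeredCube x r) ≠ ∞ :=
    ((measure_mono hsub).trans_lt measure_closedBall_lt_top).ne
  have hpos : volume (centeredCube x r) ≠ 0 :=
    ((measure_closedBall_pos volume x hr).trans_le
      (measure_mono (closedBall_subset_centeredCube x r))).ne'
  have hint : IntegrableOn (fun y => b y - cavg b (centeredCube x r)) (centeredCube x r) :=
    ((hb.1.integrableOn_isCompact (isCompact_closedBall x (d * r))).mono_set hsub).sub
      (integrableOn_const htop)
  have h := hb.2 _ ⟨2 * r, by positivity, isCubeSide_centeredCube x r⟩
  have hposR : 0 < volume.real (centeredCube x r) := ENNReal.toReal_pos hpos htop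
  rw [setAverage_eq, smul_eq_mul, inv_mul_le_iff₀ hposR, mul_one] at h
  rw [← ofReal_integral_norm_eq_lintegral_enorm hint, ← ofReal_measureReal htop]
  exact ENNReal.ofReal_le_ofReal h

lemma BMOBound.oscBound {b : Rd d → ℝ} (hb : BMOBound b 1) (hd : 1 ≤ d) :
    OscBound volume b (fun x r => cavg b (centeredCube x r)) (d ^ d) := by
  intro x r hr
  calc ∫⁻ y in closedBall x r, ‖b y - cavg b (centeredCube x r)‖ₑ
      ≤ ∫⁻ y in centeredCube x r, ‖b y - cavg b (centeredCube x r)‖ₑ :=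
        lintegral_mono_set (closedBall_subset_centeredCube x r)
    _ ≤ volume (centeredCube x r) := hb.lintegral_le hd x hr
    _ ≤ volume (closedBall x (d * r)) := measure_mono (centeredCube_subset_closedBall hd x hr.le)
    _ = _ := by
        rw [measure_closedBall_scale x x (by positivity) hr.le, finrank_euclideanSpace_fin]

end Cubes

section Kernel

variable {d : ℕ}

lemma PhiCutoff.le_one {φ : Rd d → ℝ} (hφ : PhiCutoff φ) (x : Rd d) : φ x ≤ 1 := by
  obtain ⟨-, h0, -, hs, hsum⟩ := hφ
  rcases eq_or_ne x 0 with rfl | hx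
  · have : φ 0 = 0 := by
      by_contra h
      have := (hs h).1
      norm_num at this
    rw [this]
    exact zero_le_one
  · simpa using le_hasSum (hsum x hx) 0 fun j _ => h0 _

lemma PhiCutoff.enorm_Kj_le {φ : Rd d → ℝ} (hφ : PhiCutoff φ) (Ω : Rd d → ℝ) (j : ℤ) (z : Rd d) :
    ‖Kj Ω φ j z‖ₑ ≤ ENNReal.ofReal ((2 / 2 ^ j) ^ d) *
      (closedBall 0 (2 * 2 ^ j)).indicator (fun z => ‖Ω (‖z‖⁻¹ • z)‖ₑ) z := by
  have hr : (0 : ℝ) < 2 ^ j := by positivity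
  by_cases h : φ ((2 : ℝ) ^ (-j) • z) = 0
  · rw [Kj, h, mul_zero, enorm_zero]
    exact zero_le
  · have hz : 1 / 2 ≤ ‖(2 : ℝ) ^ (-j) • z‖ ∧ ‖(2 : ℝ) ^ (-j) • z‖ ≤ 2 := hφ.2.2.2.1 h
    rw [norm_smul, zpow_neg, norm_inv, Real.norm_of_nonneg hr.le, inv_mul_eq_div,
      le_div_iff₀ hr, div_le_iff₀ hr] at hz
    have hz0 : 0 < ‖z‖ := lt_of_lt_of_le (by positivity) hz.1
    rw [indicator_of_mem (by simpa using hz.2), Real.enorm_eq_ofReal_abs,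
      Real.enorm_eq_ofReal_abs, ← ENNReal.ofReal_mul (by positivity)]
    refine ENNReal.ofReal_le_ofReal ?_
    rw [Kj, abs_mul, abs_div, abs_of_nonneg (hφ.2.1 _), abs_of_pos (pow_pos hz0 d)]
    calc |Ω (‖z‖⁻¹ • z)| / ‖z‖ ^ d * φ ((2 : ℝ) ^ (-j) • z)
        ≤ |Ω (‖z‖⁻¹ • z)| / ‖z‖ ^ d * 1 := by gcongr; exact hφ.le_one _
      _ ≤ |Ω (‖z‖⁻¹ • z)| / (2 ^ j / 2) ^ d := by
          rw [mul_one]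
          gcongr
          linarith [hz.1]
      _ = _ := by rw [div_eq_mul_inv, ← inv_pow, inv_div, mul_comm]

lemma measurable_OmI {Ω : Rd d → ℝ} (hΩ : Measurable Ω) (i : ℕ) : Measurable (OmI Ω i) := by
  have ha : Measurable fun x => |Ω x| := hΩ.abs
  unfold OmI
  split_ifs with h
  · exact Measurable.ite (measurableSet_le ha measurable_const) hΩ measurable_const
  · exact Measurable.ite ((measurableSet_lt measurable_const ha).inter
      (measurableSet_le ha measurable_const)) hΩ measurable_const

lemma enorm_OmI_le (Ω : Rd d → ℝ) (i : ℕ) (x : Rd d) : ‖OmI Ω i x‖ₑ ≤ 2 ^ i := by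
  have : |OmI Ω i x| ≤ 2 ^ i := by
    unfold OmI
    split_ifs with h1 h2 h3
    · simpa [h1] using h2
    · simp
    · exact_mod_cast h3.2
    · simp
  rw [Real.enorm_eq_ofReal_abs, ← ENNReal.ofReal_ofNat 2, ← ENNReal.ofReal_pow (by norm_num)]
  exact ENNReal.ofReal_le_ofReal this

lemma measurable_Kj {Ω φ : Rd d → ℝ} (hΩ : Measurable Ω) (hφ : Measurable φ) (j : ℤ) :
    Measurable (Kj Ω φ j) :=
  ((hΩ.comp measurable_inv_norm_smul).div (measurable_norm.pow_const d)).mul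
    (hφ.comp (measurable_const_smul _))

lemma OmI_eq_of_ne_zero {Ω : Rd d → ℝ} {i : ℕ} (hi : i ≠ 0) {x : Rd d} (h : OmI Ω i x ≠ 0) :
    OmI Ω i x = Ω x ∧ (2 : ℝ) ^ i < 2 * |Ω x| ∧ |Ω x| ≤ 2 ^ i := by
  unfold OmI at h ⊢
  rw [if_neg hi] at h ⊢
  split_ifs at h ⊢ with h1
  · refine ⟨rfl, ?_, by exact_mod_cast h1.2⟩
    have := h1.1
    rw [zpow_sub_one₀ two_ne_zero, zpow_natCast] at this
    linarith
  · exact absurd rfl h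

lemma natCast_le_three_mul_log {i : ℕ} {t : ℝ} (h : (2 : ℝ) ^ i < 2 * t) :
    (i : ℝ) ≤ 3 * Real.log (Real.exp 1 + t) := by
  have ht : 0 < t := by
    have : (0 : ℝ) < 2 ^ i := by positivity
    linarith
  have he := Real.exp_pos 1
  have h1 : 1 ≤ Real.log (Real.exp 1 + t) := by
    rw [Real.le_log_iff_exp_le (by positivity)]
    linarith
  have h2 : (i : ℝ) * Real.log 2 ≤ Real.log 2 + Real.log (Real.exp 1 + t) := by
    rw [← Real.log_pow, ← Real.log_mul two_ne_zero (by positivity)]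
    exact Real.log_le_log (by positivity) (by linarith)
  have h3 := Real.log_two_gt_d9
  have h4 := Real.log_two_lt_d9
  nlinarith [Nat.cast_nonneg (α := ℝ) i]

lemma tsum_sq_mul_enorm_OmI_le (Ω : Rd d → ℝ) (x : Rd d) :
    ∑' i : ℕ, (i : ℝ≥0∞) ^ 2 * ‖OmI Ω i x‖ₑ ≤
      ENNReal.ofReal (9 * (|Ω x| * Real.log (Real.exp 1 + |Ω x|) ^ 2)) := by
  by_cases hall : ∀ i : ℕ, (i : ℝ≥0∞) ^ 2 * ‖OmI Ω i x‖ₑ = 0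
  · simp [hall]
  push Not at hall
  obtain ⟨i, hi⟩ := hall
  have aux : ∀ {k : ℕ}, (k : ℝ≥0∞) ^ 2 * ‖OmI Ω k x‖ₑ ≠ 0 →
      OmI Ω k x = Ω x ∧ (2 : ℝ) ^ k < 2 * |Ω x| ∧ |Ω x| ≤ 2 ^ k := fun {k} hk => by
    refine OmI_eq_of_ne_zero ?_ fun h => hk (by simp [h])
    rintro rfl
    simp at hk
  obtain ⟨h1, h2, h3⟩ := aux hi
  have huniq : ∀ k, k ≠ i → (k : ℝ≥0∞) ^ 2 * ‖OmI Ω k x‖ₑ = 0 := by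
    intro k hk
    by_contra hne
    obtain ⟨-, h2', h3'⟩ := aux hne
    rcases lt_or_gt_of_ne hk with h | h
    · have : (2 : ℝ) ^ (k + 1) ≤ 2 ^ i := pow_le_pow_right₀ (by norm_num) h
      rw [pow_succ] at this
      linarith
    · have : (2 : ℝ) ^ (i + 1) ≤ 2 ^ k := pow_le_pow_right₀ (by norm_num) h
      rw [pow_succ] at this
      linarith
  rw [tsum_eq_single i huniq, h1, Real.enorm_eq_ofReal_abs, ← ENNReal.ofReal_natCast,
    ← ENNReal.ofReal_pow (by positivity), ← ENNReal.ofReal_mul (by positivity)]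
  refine ENNReal.ofReal_le_ofReal ?_
  calc (i : ℝ) ^ 2 * |Ω x| ≤ (3 * Real.log (Real.exp 1 + |Ω x|)) ^ 2 * |Ω x| := by
        gcongr
        exact natCast_le_three_mul_log h2
    _ = _ := by ring

end Kernel

section MainEstimate

variable {d : ℕ}

/-- The weighted kernel estimate for a single cube, integrated in the output variable. -/
lemma exists_lintegral_enorm_mul_Kj_le (hd : 2 ≤ d) {φ : Rd d → ℝ} (hφ : PhiCutoff φ) :
    ∃ C : ℝ, 0 < C ∧ ∀ Ω : Rd d → ℝ, Measurable Ω → ∀ b : Rd d → ℝ, BMOBound b 1 →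
      ∀ (i s : ℕ) (j : ℤ) (Q : Set (Rd d)), IsCubeSide Q ((2 : ℝ) ^ (j - (s : ℤ))) → ∀ y ∈ Q,
        ∫⁻ x, ‖b x - cavg b Q‖ₑ * ‖Kj (OmI Ω i) φ j (x - y)‖ₑ ≤ ENNReal.ofReal C *
          ((s + i + 1) * (∫⁻ θ, ‖OmI Ω i θ‖ₑ ∂sphereMeasure d) + 2⁻¹ ^ i) := by
  have hd1 : 1 ≤ d := by omega
  have hA : (0 : ℝ) < (d : ℝ) ^ d := by positivity
  obtain ⟨L, hL, hLb⟩ := OscBound.exists_lintegral_mul_le (μ := (volume : Measure (Rd d))) _ hA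
  obtain ⟨c, hc, hsph⟩ := exists_lintegral_closedBall_le_sphereMeasure hd
  set v := volume.real (ball (0 : Rd d) 1) with hv
  set D : ℝ := (d : ℝ) ^ d + (d : ℝ) ^ d * 2 ^ d with hD
  set k₀ : ℕ := d + 4 with hk₀
  refine ⟨8 * L * (4 ^ d * c) + k₀ * D * (4 ^ d * c) + 16 * L * ((2 ^ k₀) ^ d * v),
    by positivity, fun Ω hΩ b hb i s j Q hQ y hy => ?_⟩
  obtain ⟨x₀, rfl⟩ := hQ.exists_eq_centeredCube
  set ρ : ℝ := (2 : ℝ) ^ (j - (s : ℤ)) / 2 with hρ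
  set t : ℝ := (2 : ℝ) ^ j with ht
  have htpos : 0 < t := by positivity
  have hρpos : 0 < ρ := by positivity
  have hρt : 2 ^ s * ρ = t / 2 := by
    rw [hρ, ht, zpow_sub₀ two_ne_zero, zpow_natCast]
    field_simp
  have hρle : ρ ≤ t / 2 := by
    rw [← hρt]
    exact le_mul_of_one_le_left hρpos.le (one_le_pow₀ (by norm_num))
  set R : ℝ := 2 ^ (s + k₀) * ρ with hR
  have hRt : R = 2 ^ k₀ * (t / 2) := by rw [hR, pow_add, ← hρt]; ring
  have hRpos : 0 < R := by positivity
  set W := ∫⁻ θ, ‖OmI Ω i θ‖ₑ ∂sphereMeasure d with hW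
  set M : Rd d → ℝ → ℝ := fun x r => cavg b (centeredCube x r) with hM
  have hosc : OscBound volume b M ((d : ℝ) ^ d) := hb.oscBound hd1
  set B := closedBall x₀ R with hB
  have hyB : closedBall y (2 * t) ⊆ B := by
    refine closedBall_subset_closedBall' ?_
    have h1 : dist y x₀ ≤ d * ρ :=
      mem_closedBall.1 (centeredCube_subset_closedBall hd1 x₀ hρpos.le hy)
    have h2 : (d : ℝ) + 4 ≤ 2 ^ k₀ := by exact_mod_cast (Nat.lt_two_pow_self (n := d + 4)).le
    calc 2 * t + dist y x₀ ≤ 2 * t + d * (t / 2) := by gcongr; exact h1.trans (by gcongr)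
      _ = (d + 4) * (t / 2) := by ring
      _ ≤ R := by rw [hRt]; gcongr
  set U : Rd d → ℝ≥0∞ :=
    (closedBall 0 (2 * t)).indicator (fun z => ‖OmI Ω i (‖z‖⁻¹ • z)‖ₑ) with hU
  have hUm : Measurable U :=
    ((measurable_OmI hΩ i).comp measurable_inv_norm_smul).enorm.indicator measurableSet_closedBall
  have hUle : ∀ z, U z ≤ 2 ^ i := fun z =>
    (indicator_le_self _ _ z).trans (enorm_OmI_le Ω i _)
  have hUtm : Measurable fun x => U (x - y) := hUm.comp (measurable_id.sub_const y)
  have hUint : ∫⁻ x in B, U (x - y) ≤ ENNReal.ofReal (c * (2 * t) ^ d) * W := by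
    calc ∫⁻ x in B, U (x - y) ≤ ∫⁻ x, U (x - y) := setLIntegral_le_lintegral _ _
      _ = ∫⁻ z, U z := lintegral_sub_right_eq_self U y
      _ = ∫⁻ z in closedBall 0 (2 * t), ‖OmI Ω i (‖z‖⁻¹ • z)‖ₑ :=
          lintegral_indicator measurableSet_closedBall _
      _ ≤ _ := hsph _ (by positivity) _ (measurable_OmI hΩ i).enorm
  have hmd : ‖M x₀ R - M x₀ ρ‖ₑ ≤ ENNReal.ofReal ((s + k₀) * D) := by
    rw [Real.enorm_eq_ofReal_abs, abs_sub_comm]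
    refine ENNReal.ofReal_le_ofReal ?_
    have := hosc.abs_center_sub_two_pow_le hb.1.aestronglyMeasurable hA.le x₀ hρpos (s + k₀)
    rw [finrank_euclideanSpace_fin, Nat.cast_add] at this
    exact this
  have hB1 : ∫⁻ x in B, ‖b x - M x₀ R‖ₑ * U (x - y) ≤ ENNReal.ofReal L *
      (8 * i * (ENNReal.ofReal (c * (2 * t) ^ d) * W) + 16 * 2⁻¹ ^ i * volume B) := by
    refine (hLb b M hb.1 hosc i _ hUtm (fun x => hUle _) x₀ R hRpos).trans ?_
    gcongr
  set κ := ENNReal.ofReal ((2 / t) ^ d) with hκ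
  have hκS : κ * ENNReal.ofReal (c * (2 * t) ^ d) = ENNReal.ofReal (4 ^ d * c) := by
    rw [hκ, ← ENNReal.ofReal_mul (by positivity)]
    congr 1
    rw [mul_left_comm, ← mul_pow, mul_comm c]
    congr 2
    field_simp
    norm_num
  have hκB : κ * volume B = ENNReal.ofReal ((2 ^ k₀) ^ d * v) := by
    rw [hκ, hB, Measure.addHaar_closedBall _ _ hRpos.le, finrank_euclideanSpace_fin,
      ← ofReal_measureReal (measure_ball_lt_top (μ := (volume : Measure (Rd d)))).ne,
      ← ENNReal.ofReal_mul (by positivity), ← ENNReal.ofReal_mul (by positivity), ← mul_assoc,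
      ← mul_pow, hRt]
    congr 3
    field_simp
  have hsk : ENNReal.ofReal ((s + k₀) * D) ≤ ENNReal.ofReal (k₀ * D) * (s + i + 1) := by
    have h1 : ((s : ℝ≥0∞) + i + 1) = ENNReal.ofReal (s + i + 1) := by
      rw [ENNReal.ofReal_add (by positivity) one_pos.le, ENNReal.ofReal_add (by positivity)
        (by positivity)]
      simp
    rw [h1, ← ENNReal.ofReal_mul (by positivity)]
    refine ENNReal.ofReal_le_ofReal ?_
    have hk1 : (1 : ℝ) ≤ k₀ := by rw [hk₀]; push_cast; linarith [Nat.cast_nonneg (α := ℝ) d]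
    have h2 : (s : ℝ) + k₀ ≤ k₀ * (s + i + 1) := by
      nlinarith [Nat.cast_nonneg (α := ℝ) s, Nat.cast_nonneg (α := ℝ) i]
    calc (s + k₀) * D ≤ (k₀ * (s + i + 1)) * D := by gcongr
      _ = _ := by ring
  calc ∫⁻ x, ‖b x - M x₀ ρ‖ₑ * ‖Kj (OmI Ω i) φ j (x - y)‖ₑ
      ≤ ∫⁻ x, B.indicator (fun x => κ * (‖b x - M x₀ R‖ₑ * U (x - y) +
          ‖M x₀ R - M x₀ ρ‖ₑ * U (x - y))) x := by
        refine lintegral_mono fun x => ?_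
        have hK := hφ.enorm_Kj_le (OmI Ω i) j (x - y)
        by_cases hx : x ∈ B
        · rw [indicator_of_mem hx]
          have h3 : b x - M x₀ ρ = (b x - M x₀ R) + (M x₀ R - M x₀ ρ) := by ring
          calc ‖b x - M x₀ ρ‖ₑ * ‖Kj (OmI Ω i) φ j (x - y)‖ₑ
              ≤ (‖b x - M x₀ R‖ₑ + ‖M x₀ R - M x₀ ρ‖ₑ) * (κ * U (x - y)) := by
                gcongr
                · rw [h3]
                  exact enorm_add_le _ _
            _ = _ := by ring
        · have hxy : x - y ∉ closedBall (0 : Rd d) (2 * t) := fun h =>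
            hx (hyB (by rwa [mem_closedBall_iff_norm, ← mem_closedBall_zero_iff]))
          rw [indicator_of_notMem hxy, mul_zero] at hK
          rw [nonpos_iff_eq_zero.1 hK, mul_zero]
          exact zero_le
    _ = κ * ((∫⁻ x in B, ‖b x - M x₀ R‖ₑ * U (x - y)) +
          ‖M x₀ R - M x₀ ρ‖ₑ * ∫⁻ x in B, U (x - y)) := by
        rw [lintegral_indicator measurableSet_closedBall,
          lintegral_const_mul' _ _ ENNReal.ofReal_ne_top,
          lintegral_add_right _ (hUtm.const_mul _), lintegral_const_mul _ hUtm]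
    _ ≤ κ * (ENNReal.ofReal L *
          (8 * i * (ENNReal.ofReal (c * (2 * t) ^ d) * W) + 16 * 2⁻¹ ^ i * volume B) +
          (ENNReal.ofReal (k₀ * D) * (s + i + 1)) *
            (ENNReal.ofReal (c * (2 * t) ^ d) * W)) := by
        gcongr
        exact hmd.trans hsk
    _ = 8 * ENNReal.ofReal L * (κ * ENNReal.ofReal (c * (2 * t) ^ d)) * (i * W) +
          ENNReal.ofReal (k₀ * D) * (κ * ENNReal.ofReal (c * (2 * t) ^ d)) * ((s + i + 1) * W) +
          16 * ENNReal.ofReal L * (κ * volume B) * 2⁻¹ ^ i := by ring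
    _ = ENNReal.ofReal (8 * L * (4 ^ d * c)) * (i * W) +
          ENNReal.ofReal (k₀ * D * (4 ^ d * c)) * ((s + i + 1) * W) +
          ENNReal.ofReal (16 * L * ((2 ^ k₀) ^ d * v)) * 2⁻¹ ^ i := by
        rw [hκS, hκB, ENNReal.ofReal_mul (p := 8 * L) (by positivity),
          ENNReal.ofReal_mul (p := k₀ * D) (by positivity),
          ENNReal.ofReal_mul (p := 16 * L) (by positivity),
          ENNReal.ofReal_mul (p := 8) (by positivity),
          ENNReal.ofReal_mul (p := 16) (by positivity), ENNReal.ofReal_ofNat,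
          ENNReal.ofReal_ofNat]
    _ ≤ ENNReal.ofReal (8 * L * (4 ^ d * c)) * ((s + i + 1) * W + 2⁻¹ ^ i) +
          ENNReal.ofReal (k₀ * D * (4 ^ d * c)) * ((s + i + 1) * W + 2⁻¹ ^ i) +
          ENNReal.ofReal (16 * L * ((2 ^ k₀) ^ d * v)) * ((s + i + 1) * W + 2⁻¹ ^ i) := by
        have hi : (i : ℝ≥0∞) ≤ s + i + 1 := le_add_self.trans le_self_add
        gcongr
        · exact (mul_le_mul_left hi W).trans le_self_add
        · exact le_self_add
        · exact le_add_self
    _ = _ := by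
        rw [← add_mul, ← add_mul, ENNReal.ofReal_add (by positivity) (by positivity),
          ENNReal.ofReal_add (by positivity) (by positivity)]

/-- Young's inequality for `convK` with an additional weight in the output variable. -/
lemma lintegral_mul_convK_le {a K g : Rd d → ℝ} (ha : AEMeasurable a) (hK : Measurable K)
    (hg : AEMeasurable g) {Q : Set (Rd d)} (hgQ : Function.support g ⊆ Q) {c : ℝ≥0∞}
    (hc : ∀ y ∈ Q, ∫⁻ x, ‖a x‖ₑ * ‖K (x - y)‖ₑ ≤ c) :
    ∫⁻ x, ‖a x‖ₑ * ‖convK K g x‖ₑ ≤ c * ∫⁻ y, ‖g y‖ₑ := by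
  have hsub : Measurable fun p : Rd d × Rd d => p.1 - p.2 := measurable_fst.sub measurable_snd
  have hmeas : AEMeasurable (Function.uncurry fun x y => ‖a x‖ₑ * (‖K (x - y)‖ₑ * ‖g y‖ₑ))
      ((volume : Measure (Rd d)).prod volume) :=
    (ha.comp_quasiMeasurePreserving Measure.quasiMeasurePreserving_fst).enorm.mul
      ((hK.comp hsub).enorm.aemeasurable.mul
        (hg.comp_quasiMeasurePreserving Measure.quasiMeasurePreserving_snd).enorm)
  calc ∫⁻ x, ‖a x‖ₑ * ‖convK K g x‖ₑ
      ≤ ∫⁻ x, ∫⁻ y, ‖a x‖ₑ * (‖K (x - y)‖ₑ * ‖g y‖ₑ) := by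
        refine lintegral_mono fun x => ?_
        rw [lintegral_const_mul' _ _ enorm_ne_top]
        gcongr
        refine (enorm_integral_le_lintegral_enorm _).trans_eq ?_
        simp only [enorm_mul]
    _ = ∫⁻ y, ∫⁻ x, ‖a x‖ₑ * (‖K (x - y)‖ₑ * ‖g y‖ₑ) := lintegral_lintegral_swap hmeas
    _ ≤ ∫⁻ y, c * ‖g y‖ₑ := by
        refine lintegral_mono fun y => ?_
        simp only [← mul_assoc]
        rw [lintegral_mul_const' _ _ enorm_ne_top]
        by_cases hy : y ∈ Q
        · gcongr
          exact hc y hy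
        · have : g y = 0 := by
            by_contra h
            exact hy (hgQ h)
          simp [this]
    _ = c * ∫⁻ y, ‖g y‖ₑ := lintegral_const_mul'' _ hg.enorm

/-- Summing over the cubes of a family, sorted by side length, counts each cube once. -/
lemma tsum_isCubeSide_le (hd : 1 ≤ d) (S : Set (Set (Rd d))) (s : ℕ) (F : Set (Rd d) → ℝ≥0∞) :
    ∑' (j : ℤ), ∑' (Q : {Q : Set (Rd d) // Q ∈ S ∧ IsCubeSide Q ((2 : ℝ) ^ (j - (s : ℤ)))}),
      F Q.1 ≤ ∑' Q : S, F Q.1 := by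
  rw [← ENNReal.tsum_sigma' fun
    p : (j : ℤ) × {Q : Set (Rd d) // Q ∈ S ∧ IsCubeSide Q ((2 : ℝ) ^ (j - (s : ℤ)))} => F p.2.1]
  refine ENNReal.tsum_comp_le_tsum_of_injective (f := fun
    p : (j : ℤ) × {Q : Set (Rd d) // Q ∈ S ∧ IsCubeSide Q ((2 : ℝ) ^ (j - (s : ℤ)))} =>
      (⟨p.2.1, p.2.2.1⟩ : S)) ?_ fun Q : S => F Q.1
  rintro ⟨j, Q, hQ⟩ ⟨j', Q', hQ'⟩ h
  obtain rfl : Q = Q' := congrArg Subtype.val h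
  have hside := IsCubeSide.unique hd (by positivity) (by positivity) hQ.2 hQ'.2
  have := zpow_right_injective₀ two_pos (by norm_num) hside
  obtain rfl : j = j' := by simpa using this
  rfl

lemma tsum_natCast_mul_two_inv_pow : ∑' i : ℕ, (i : ℝ≥0∞) * 2⁻¹ ^ i = 2 := by
  have h := hasSum_coe_mul_geometric_of_norm_lt_one (𝕜 := ℝ) (r := 2⁻¹) (by norm_num)
  have h2 := ENNReal.ofReal_tsum_of_nonneg (fun i => by positivity) h.summable
  rw [h.tsum_eq] at h2
  norm_num at h2
  refine Eq.trans (tsum_congr fun i => ?_) h2.symm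
  rw [one_div, ENNReal.ofReal_inv_of_pos two_pos, ENNReal.ofReal_ofNat]

lemma tsum_sq_mul_lintegral_OmI_le {Ω : Rd d → ℝ} (hΩ : Measurable Ω)
    (hint : Integrable (fun θ => |Ω θ| * (Real.log (Real.exp 1 + |Ω θ|)) ^ 2) (sphereMeasure d)) :
    ∑' i : ℕ, (i : ℝ≥0∞) ^ 2 * ∫⁻ θ, ‖OmI Ω i θ‖ₑ ∂sphereMeasure d ≤
      ENNReal.ofReal
        (9 * ∫ θ, |Ω θ| * (Real.log (Real.exp 1 + |Ω θ|)) ^ 2 ∂sphereMeasure d) := by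
  have hm : ∀ i : ℕ, Measurable fun θ => ‖OmI Ω i θ‖ₑ := fun i => (measurable_OmI hΩ i).enorm
  simp only [← lintegral_const_mul _ (hm _)]
  rw [← lintegral_tsum fun i => ((hm i).const_mul _).aemeasurable, ← integral_const_mul,
    ofReal_integral_eq_lintegral_ofReal (hint.const_mul 9)
      (Eventually.of_forall fun θ => by positivity)]
  exact lintegral_mono fun θ => tsum_sq_mul_enorm_OmI_le Ω θ

/-- Summation of the single-scale bounds over the levels `i` and the offsets `s`. -/
lemma tsum_sum_Icc_le (N₀ : ℕ) (W : ℕ → ℝ≥0∞) :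
    ∑' i : ℕ, ∑ s ∈ Finset.Icc 100 (N₀ * i), (((s : ℝ≥0∞) + i + 1) * W i + 2⁻¹ ^ i) ≤
      N₀ * (N₀ + 2) * ∑' i : ℕ, (i : ℝ≥0∞) ^ 2 * W i + N₀ * 2 := by
  have hterms : ∑' i : ℕ,
      (N₀ * (N₀ + 2) * ((i : ℝ≥0∞) ^ 2 * W i) + N₀ * ((i : ℝ≥0∞) * 2⁻¹ ^ i)) =
      N₀ * (N₀ + 2) * ∑' i : ℕ, (i : ℝ≥0∞) ^ 2 * W i + N₀ * 2 := by
    rw [ENNReal.tsum_add, ENNReal.tsum_mul_left, ENNReal.tsum_mul_left,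
      tsum_natCast_mul_two_inv_pow]
  rw [← hterms]
  refine ENNReal.tsum_le_tsum fun i => ?_
  have hN : N₀ * i * (N₀ * i + i + 1) ≤ N₀ * (N₀ + 2) * i ^ 2 := by
    rcases Nat.eq_zero_or_pos i with rfl | hi
    · simp
    · calc N₀ * i * (N₀ * i + i + 1) ≤ N₀ * i * (N₀ * i + i + i) := by gcongr; exact hi
        _ = _ := by ring
  calc ∑ s ∈ Finset.Icc 100 (N₀ * i), (((s : ℝ≥0∞) + i + 1) * W i + 2⁻¹ ^ i)
      ≤ ∑ s ∈ Finset.Icc 100 (N₀ * i), (((N₀ * i + i + 1 : ℕ) : ℝ≥0∞) * W i + 2⁻¹ ^ i) := by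
        refine Finset.sum_le_sum fun s hs => ?_
        gcongr
        exact_mod_cast Nat.add_le_add_right (Nat.add_le_add_right (Finset.mem_Icc.1 hs).2 i) 1
    _ = ((Finset.Icc 100 (N₀ * i)).card : ℝ≥0∞) *
          (((N₀ * i + i + 1 : ℕ) : ℝ≥0∞) * W i + 2⁻¹ ^ i) := by
        rw [Finset.sum_const, nsmul_eq_mul]
    _ ≤ ((N₀ * i : ℕ) : ℝ≥0∞) * (((N₀ * i + i + 1 : ℕ) : ℝ≥0∞) * W i + 2⁻¹ ^ i) := by
        gcongr
        rw [Nat.card_Icc]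
        omega
    _ = ((N₀ * i * (N₀ * i + i + 1) : ℕ) : ℝ≥0∞) * W i + ((N₀ * i : ℕ) : ℝ≥0∞) * 2⁻¹ ^ i := by
        push_cast
        ring
    _ ≤ ((N₀ * (N₀ + 2) * i ^ 2 : ℕ) : ℝ≥0∞) * W i + ((N₀ * i : ℕ) : ℝ≥0∞) * 2⁻¹ ^ i := by
        exact add_le_add (mul_le_mul' (Nat.cast_le.2 hN) le_rfl) le_rfl
    _ = _ := by
        push_cast
        ring

end MainEstimate

/-- estimate for `U₁`.
`Σ_{i≥0} Σ_{100≤s≤N₀i} Σ_j Σ_{Q∈S_{j-s}} ‖(b-⟨b⟩_Q)T_j^i h_Q‖_{L¹}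
  ≤ C_{d,N₀}(1 + ‖Ω‖_{L(log L)²(S^{d-1})}) Σ_{Q∈S}‖h_Q‖_{L¹}`. -/
theorem statement6 (d : ℕ) (hd : 2 ≤ d) (N₀ : ℕ) (φ : Rd d → ℝ) (hφ : PhiCutoff φ) :
    ∃ C : ℝ, 0 < C ∧
      ∀ (Ω : Rd d → ℝ), Measurable Ω → Homog0 Ω →
        Integrable Ω (sphereMeasure d) →
        Integrable (fun θ => |Ω θ| * (Real.log (Real.exp 1 + |Ω θ|)) ^ 2) (sphereMeasure d) →
      ∀ (b : Rd d → ℝ), BMOBound b 1 →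
      ∀ (S : Set (Set (Rd d))), (∀ Q ∈ S, IsDyadicCube Q) →
        (S.Pairwise fun Q Q' => interior Q ∩ interior Q' = ∅) →
      ∀ (h : Set (Rd d) → Rd d → ℝ),
        (∀ Q ∈ S, Integrable (h Q) volume ∧ Function.support (h Q) ⊆ Q ∧
          (∫⁻ x, ENNReal.ofReal |h Q x|) ≤ volume Q) →
        (∑' (i : ℕ), ∑ s ∈ Finset.Icc 100 (N₀ * i), ∑' (j : ℤ),
            ∑' (Q : {Q : Set (Rd d) // Q ∈ S ∧ IsCubeSide Q ((2:ℝ) ^ (j - (s:ℤ)))}),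
              ∫⁻ x, ENNReal.ofReal (|b x - cavg b Q.1| * |convK (Kj (OmI Ω i) φ j) (h Q.1) x|)) ≤
          ENNReal.ofReal
              (C * (1 + ∫ θ, |Ω θ| * (Real.log (Real.exp 1 + |Ω θ|)) ^ 2 ∂(sphereMeasure d))) *
            ∑' (Q : S), ∫⁻ x, ENNReal.ofReal |h Q.1 x| := by
  have hd1 : 1 ≤ d := by omega
  obtain ⟨C, hC, hker⟩ := exists_lintegral_enorm_mul_Kj_le hd hφ
  refine ⟨C * (9 * (N₀ * (N₀ + 2)) + N₀ * 2 + 1), by positivity, ?_⟩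
  intro Ω hΩ _ _ hlog b hb S _ _ h hh
  set I := ∫ θ, |Ω θ| * (Real.log (Real.exp 1 + |Ω θ|)) ^ 2 ∂(sphereMeasure d) with hI
  have hI0 : 0 ≤ I := integral_nonneg fun θ => by positivity
  set W : ℕ → ℝ≥0∞ := fun i => ∫⁻ θ, ‖OmI Ω i θ‖ₑ ∂sphereMeasure d with hW
  set H := ∑' (Q : S), ∫⁻ x, ENNReal.ofReal |h Q.1 x| with hH
  have hpiece : ∀ (i s : ℕ) (j : ℤ)
      (Q : {Q : Set (Rd d) // Q ∈ S ∧ IsCubeSide Q ((2:ℝ) ^ (j - (s:ℤ)))}),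
      ∫⁻ x, ENNReal.ofReal (|b x - cavg b Q.1| * |convK (Kj (OmI Ω i) φ j) (h Q.1) x|) ≤
        ENNReal.ofReal C * (((s : ℝ≥0∞) + i + 1) * W i + 2⁻¹ ^ i) *
          ∫⁻ x, ENNReal.ofReal |h Q.1 x| := by
    intro i s j Q
    simp only [ENNReal.ofReal_mul (abs_nonneg _), ← Real.enorm_eq_ofReal_abs]
    exact lintegral_mul_convK_le (hb.1.aestronglyMeasurable.aemeasurable.sub_const _)
      (measurable_Kj (measurable_OmI hΩ i) hφ.1.continuous.measurable j)
      (hh Q.1 Q.2.1).1.aestronglyMeasurable.aemeasurable (hh Q.1 Q.2.1).2.1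
      (hker Ω hΩ b hb i s j Q.1 Q.2.2)
  calc _ ≤ ∑' (i : ℕ), ∑ s ∈ Finset.Icc 100 (N₀ * i),
          ENNReal.ofReal C * (((s : ℝ≥0∞) + i + 1) * W i + 2⁻¹ ^ i) * H := by
        refine ENNReal.tsum_le_tsum fun i => Finset.sum_le_sum fun s _ => ?_
        refine (ENNReal.tsum_le_tsum fun j => ENNReal.tsum_le_tsum (hpiece i s j)).trans ?_
        simp only [ENNReal.tsum_mul_left]
        gcongr
        exact tsum_isCubeSide_le hd1 S s fun Q => ∫⁻ x, ENNReal.ofReal |h Q x|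
    _ = ENNReal.ofReal C * (∑' (i : ℕ), ∑ s ∈ Finset.Icc 100 (N₀ * i),
          (((s : ℝ≥0∞) + i + 1) * W i + 2⁻¹ ^ i)) * H := by
        simp only [← Finset.sum_mul, ← Finset.mul_sum, ENNReal.tsum_mul_left,
          ENNReal.tsum_mul_right]
    _ ≤ ENNReal.ofReal C * (N₀ * (N₀ + 2) * ENNReal.ofReal (9 * I) + N₀ * 2) * H := by
        gcongr
        refine (tsum_sum_Icc_le N₀ W).trans ?_
        gcongr
        exact tsum_sq_mul_lintegral_OmI_le hΩ hlog
    _ = ENNReal.ofReal (C * (N₀ * (N₀ + 2) * (9 * I) + N₀ * 2)) * H := by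
        rw [ENNReal.ofReal_mul hC.le, ENNReal.ofReal_add (by positivity) (by positivity),
          ENNReal.ofReal_mul (p := N₀ * (N₀ + 2)) (by positivity),
          ENNReal.ofReal_mul (p := (N₀ : ℝ)) (by positivity),
          ENNReal.ofReal_mul (p := (N₀ : ℝ)) (by positivity),
          ENNReal.ofReal_add (by positivity) (by positivity), ENNReal.ofReal_natCast,
          ENNReal.ofReal_ofNat]
    _ ≤ _ := by
        gcongr ENNReal.ofReal ?_ * H
        rw [mul_assoc C]
        refine mul_le_mul_of_nonneg_left ?_ hC.le
        have h1 : 0 ≤ (N₀ : ℝ) * (N₀ + 2) := by positivity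
        have h2 : 0 ≤ (N₀ : ℝ) * I := by positivity
        nlinarith
end
end

section
/- Let Ω be homogeneous of degree zero with ‖Ω‖_{L^∞(S^{d−1})} ≤ 1 and let b ∈ BMO(ℝ^d) with ‖b‖_{BMO} ≤ 1. Then for every integer s ≥ 100 and every ν ∈ Λ_s, ‖Σ_{j∈ℤ} Σ_{Q∈S_{j−s}} (b − ⟨b⟩_Q) T_{jν}^s h_Q‖²_{L²(ℝ^d)} ≤ C_{d,γ} 2^{−sγ(2d−5/2)} Σ_{Q∈S} ‖h_Q‖_{L¹(ℝ^d)}. -/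
open MeasureTheory Metric Set Filter
open scoped ENNReal NNReal Real Topology Pointwise FourierTransform RealInnerProductSpace

noncomputable section

/-- The angular cut-offs `Γ_ν^s` built from `ζ` and the net `{e_ν}`; here `a = sγ`. -/
def Gam {d : ℕ} {ι : Type} [Fintype ι] (ζ : Rd d → ℝ) (e : ι → Rd d) (a : ℝ)
    (ν : ι) (ξ : Rd d) : ℝ :=
  ζ ((2:ℝ) ^ a • (‖ξ‖⁻¹ • ξ - e ν)) / ∑ ν' : ι, ζ ((2:ℝ) ^ a • (‖ξ‖⁻¹ • ξ - e ν'))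

/-- Symbol of the multiplier operator `G_ν^s`: `ψ(2^{sγ}⟨ξ/|ξ|, e_ν⟩)`; here `a = sγ`. -/
def GSymb {d : ℕ} (ψ : ℝ → ℝ) (a : ℝ) (e : Rd d) (ξ : Rd d) : ℝ :=
  ψ ((2:ℝ) ^ a * ⟪‖ξ‖⁻¹ • ξ, e⟫)

/-- Kernel `K_{jν}^s(x) = Ω(x/|x|)|x|^{-d} φ_j(x) Γ_ν^s(x/|x|)`; here `a = sγ`. -/
def Kjnu {d : ℕ} {ι : Type} [Fintype ι] (Ω φ ζ : Rd d → ℝ) (e : ι → Rd d) (a : ℝ)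
    (j : ℤ) (ν : ι) (x : Rd d) : ℝ :=
  Ω (‖x‖⁻¹ • x) / ‖x‖ ^ d * φ ((2:ℝ) ^ (-j) • x) * Gam ζ e a ν (‖x‖⁻¹ • x)

/-- Hypotheses on `ζ`: smooth, nonnegative, radial, supported in `B(0,1)`, `≡1` on `B(0,1/2)`. -/
def ZetaCutoff {d : ℕ} (ζ : Rd d → ℝ) : Prop :=
  ContDiff ℝ (⊤ : ℕ∞) ζ ∧ (∀ x, 0 ≤ ζ x) ∧ (∃ g : ℝ → ℝ, ∀ x, ζ x = g ‖x‖) ∧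
    Function.support ζ ⊆ ball (0 : Rd d) 1 ∧ ∀ x ∈ ball (0 : Rd d) (1/2), ζ x = 1

/-- Hypotheses on `ψ`: smooth, `0 ≤ ψ ≤ 1`, supported in `[-4,4]`, `≡1` on `[-2,2]`. -/
def PsiCutoff (ψ : ℝ → ℝ) : Prop :=
  ContDiff ℝ (⊤ : ℕ∞) ψ ∧ (∀ t, 0 ≤ ψ t ∧ ψ t ≤ 1) ∧
    Function.support ψ ⊆ Icc (-4:ℝ) 4 ∧ ∀ t ∈ Icc (-2:ℝ) 2, ψ t = 1

/-- `{e_ν}_{ν∈Λ_s}` is a `2^{-sγ-4}`-separated net of unit vectors covering the sphere. -/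
def SphereNet {d : ℕ} {ι : Type} (e : ι → Rd d) (s : ℕ) (γ : ℝ) : Prop :=
  (∀ ν, ‖e ν‖ = 1) ∧
    (∀ ν ν', ν ≠ ν' → (2:ℝ) ^ (-(s:ℝ) * γ - 4) < ‖e ν - e ν'‖) ∧
    ∀ θ : Rd d, ‖θ‖ = 1 → ∃ ν, ‖θ - e ν‖ ≤ (2:ℝ) ^ (-(s:ℝ) * γ - 4)

/-- `G ν` is the Fourier multiplier operator with symbol `ψ(2^{sγ}⟨ξ/|ξ|, e_ν⟩)`;
here `a = sγ`. -/
def IsGNu {d : ℕ} {ι : Type} (G : ι → (Rd d → ℂ) → (Rd d → ℂ)) (ψ : ℝ → ℝ) (a : ℝ)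
    (e : ι → Rd d) : Prop :=
  ∀ (ν : ι) (g : Rd d → ℂ), Integrable g volume →
    ∀ ξ, 𝓕 (G ν g) ξ = (GSymb ψ a (e ν) ξ : ℂ) * 𝓕 g ξ

/-- `S` is a collection of dyadic cubes with pairwise disjoint interiors and, for every
`Q ∈ S`, `h Q` is integrable, supported in `Q`, with `‖h Q‖_{L¹} ≤ |Q|`. -/
def GoodFamily {d : ℕ} (S : Set (Set (Rd d))) (h : Set (Rd d) → Rd d → ℝ) : Prop :=
  (∀ Q ∈ S, IsDyadicCube Q) ∧
    (S.Pairwise fun Q Q' => interior Q ∩ interior Q' = ∅) ∧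
    ∀ Q ∈ S, Integrable (h Q) volume ∧ Function.support (h Q) ⊆ Q ∧
      (∫⁻ x, ENNReal.ofReal |h Q x|) ≤ volume Q

section Tree

variable {X κ : Type*} [Fintype κ]

/-- Average of `g` over the `n`-th generation of descendants of `q`, for the tree in which
the children of `q` are `ch q k`. -/
def treeAvg (ch : X → κ → X) (g : X → ℝ) : ℕ → X → ℝ
  | 0, q => g q
  | n + 1, q => (∑ k, treeAvg ch g n (ch q k)) / Fintype.card κ

/-- Fraction of the descendants of `q` up to generation `n` that are below a node
where `A` holds. -/
def treeHit (ch : X → κ → X) (A : X → Prop) [DecidablePred A] : ℕ → X → ℝ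
  | 0, q => if A q then 1 else 0
  | n + 1, q => if A q then 1 else (∑ k, treeHit ch A n (ch q k)) / Fintype.card κ

variable [Nonempty κ] {ch : X → κ → X} {u : X → ℝ}

lemma card_mul_div_card (a : ℝ) : (∑ _k : κ, a) / (Fintype.card κ : ℝ) = a := by
  have : (Fintype.card κ : ℝ) ≠ 0 := by exact_mod_cast Fintype.card_ne_zero
  simp [this]

lemma abs_sub_le_treeAvg (hu : ∀ q, u q = (∑ k, u (ch q k)) / Fintype.card κ) (t : ℝ) :
    ∀ (n : ℕ) (q : X), |u q - t| ≤ treeAvg ch (fun p => |u p - t|) n q := by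
  intro n
  induction n with
  | zero => intro q; exact le_rfl
  | succ n ih =>
    intro q
    have h0 : (0 : ℝ) < Fintype.card κ := by exact_mod_cast Fintype.card_pos
    have h1 : u q - t = (∑ k, (u (ch q k) - t)) / Fintype.card κ := by
      rw [Finset.sum_sub_distrib, sub_div, card_mul_div_card, ← hu q]
    rw [h1, abs_div, abs_of_pos h0, treeAvg]
    gcongr
    exact (Finset.abs_sum_le_sum_abs _ _).trans (Finset.sum_le_sum fun k _ => ih _)

lemma treeAvg_sq_eq (hu : ∀ q, u q = (∑ k, u (ch q k)) / Fintype.card κ) (t r : ℝ) :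
    ∀ (n : ℕ) (q : X), treeAvg ch (fun p => (u p - t) ^ 2) n q =
      treeAvg ch (fun p => (u p - r) ^ 2) n q + 2 * (u q - r) * (r - t) + (r - t) ^ 2 := by
  intro n
  induction n with
  | zero => intro q; simp only [treeAvg]; ring
  | succ n ih =>
    intro q
    have h1 : u q - r = (∑ k, (u (ch q k) - r)) / Fintype.card κ := by
      rw [Finset.sum_sub_distrib, sub_div, card_mul_div_card, ← hu q]
    simp only [treeAvg, ih, Finset.sum_add_distrib, add_div, card_mul_div_card]
    rw [h1, ← Finset.sum_mul, ← Finset.mul_sum]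
    ring

lemma mul_treeHit_le (hu : ∀ q, u q = (∑ k, u (ch q k)) / Fintype.card κ) (t : ℝ) :
    ∀ (n : ℕ) (q : X), 2 * treeHit ch (fun p => 2 < |u p - t|) n q ≤
      treeAvg ch (fun p => |u p - t|) n q := by
  intro n
  induction n with
  | zero =>
    intro q
    simp only [treeHit, treeAvg]
    split_ifs with h
    · linarith
    · simp
  | succ n ih =>
    intro q
    have h2 := abs_sub_le_treeAvg hu t (n + 1) q
    simp only [treeHit]
    split_ifs with h
    · linarith
    · rw [treeAvg, ← mul_div_assoc, Finset.mul_sum]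
      gcongr
      exact ih _

lemma treeAvg_sq_le_treeHit (hu : ∀ q, u q = (∑ k, u (ch q k)) / Fintype.card κ) {D G t : ℝ}
    (hjump : ∀ q k, |u (ch q k) - u q| ≤ D) :
    ∀ (n : ℕ), (∀ m ≤ n, ∀ q, treeAvg ch (fun p => (u p - u q) ^ 2) m q ≤ G) →
    ∀ (q : X), |u q - t| ≤ 2 + D → treeAvg ch (fun p => (u p - t) ^ 2) n q ≤
      4 + treeHit ch (fun p => 2 < |u p - t|) n q * (G + (2 + D) ^ 2) := by
  intro n
  have hit : ∀ m q, treeAvg ch (fun p => (u p - u q) ^ 2) m q ≤ G → |u q - t| ≤ 2 + D →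
      treeAvg ch (fun p => (u p - t) ^ 2) m q ≤ 4 + 1 * (G + (2 + D) ^ 2) := by
    intro m q h1 h2
    rw [treeAvg_sq_eq hu t (u q) m q]
    have : (u q - t) ^ 2 ≤ (2 + D) ^ 2 := sq_le_sq' (abs_le.1 h2).1 (abs_le.1 h2).2
    linarith
  induction n with
  | zero =>
    intro hm q hq
    by_cases h : 2 < |u q - t|
    · simpa only [treeHit, if_pos h] using hit 0 q (hm 0 le_rfl q) hq
    · simp only [treeHit, if_neg h, treeAvg, zero_mul, add_zero]
      push Not at h
      nlinarith [abs_le.1 h]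
  | succ n ih =>
    intro hm q hq
    by_cases h : 2 < |u q - t|
    · simpa only [treeHit, if_pos h] using hit (n + 1) q (hm _ le_rfl q) hq
    · simp only [treeHit, if_neg h, treeAvg]
      push Not at h
      have h3 : ∀ k, |u (ch q k) - t| ≤ 2 + D := fun k => by
        have := abs_sub_le (u (ch q k)) (u q) t
        linarith [hjump q k]
      have h4 := Finset.sum_le_sum fun k (_ : k ∈ Finset.univ) =>
        ih (fun m hm' => hm m (hm'.trans n.le_succ)) (ch q k) (h3 k)
      rw [Finset.sum_add_distrib, ← Finset.sum_mul] at h4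
      calc _ ≤ _ := div_le_div_of_nonneg_right h4 (Nat.cast_nonneg _)
        _ = _ := by rw [add_div, card_mul_div_card]; ring

/-- John-Nirenberg inequality on a tree: a uniform bound on the mean oscillation gives a
uniform bound on the quadratic oscillation. -/
lemma treeAvg_sq_le (hu : ∀ q, u q = (∑ k, u (ch q k)) / Fintype.card κ)
    (hW : ∀ n q, treeAvg ch (fun p => |u p - u q|) n q ≤ 1) (n : ℕ) (q : X) :
    treeAvg ch (fun p => (u p - u q) ^ 2) n q ≤ 8 + (2 + (Fintype.card κ : ℝ)) ^ 2 := by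
  obtain ⟨D, hDdef⟩ : ∃ D : ℝ, D = Fintype.card κ := ⟨_, rfl⟩
  rw [← hDdef]
  have h0 : (0 : ℝ) < D := by rw [hDdef]; exact_mod_cast Fintype.card_pos
  have hjump : ∀ q k, |u (ch q k) - u q| ≤ D := fun q k => by
    have h1 := hW 1 q
    simp only [treeAvg] at h1
    rw [← hDdef, div_le_one h0] at h1
    exact (Finset.single_le_sum (f := fun k => |u (ch q k) - u q|)
      (fun _ _ => abs_nonneg _) (Finset.mem_univ k)).trans h1
  have step : ∀ G, 0 ≤ G → (∀ m ≤ n, ∀ q, treeAvg ch (fun p => (u p - u q) ^ 2) m q ≤ G) →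
      ∀ m ≤ n, ∀ q, treeAvg ch (fun p => (u p - u q) ^ 2) m q ≤
        G / 2 + (4 + (2 + D) ^ 2 / 2) := by
    intro G hG h m hm q
    have h1 := treeAvg_sq_le_treeHit hu (t := u q) hjump m
      (fun m' hm' => h m' (hm'.trans hm)) q (by simp; linarith)
    have h2 := (mul_treeHit_le hu (u q) m q).trans (hW m q)
    have h3 : 0 ≤ G + (2 + D) ^ 2 := by positivity
    nlinarith
  have base : ∀ m q, treeAvg ch (fun p => (u p - u q) ^ 2) m q ≤ m * D ^ 2 := by
    intro m
    induction m with
    | zero => intro q; simp [treeAvg]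
    | succ m ih =>
      intro q
      simp only [treeAvg]
      rw [← hDdef, div_le_iff₀ h0]
      have h5 : ∀ k, treeAvg ch (fun p => (u p - u q) ^ 2) m (ch q k) ≤ (m + 1) * D ^ 2 := by
        intro k
        rw [treeAvg_sq_eq hu (u q) (u (ch q k)) m (ch q k)]
        have h6 := ih (ch q k)
        have h7 : (u (ch q k) - u q) ^ 2 ≤ D ^ 2 :=
          sq_le_sq' (by linarith [abs_le.1 (hjump q k)]) (abs_le.1 (hjump q k)).2
        linarith
      have h8 := Finset.sum_le_sum fun k (_ : k ∈ Finset.univ) => h5 k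
      simp only [Finset.sum_const, Finset.card_univ, nsmul_eq_mul, ← hDdef] at h8
      push_cast
      linarith
  have iter : ∀ i : ℕ, ∀ m ≤ n, ∀ q, treeAvg ch (fun p => (u p - u q) ^ 2) m q ≤
      n * D ^ 2 * (1 / 2) ^ i + (8 + (2 + D) ^ 2) := by
    intro i
    induction i with
    | zero =>
      intro m hm q
      have h9 : (m : ℝ) * D ^ 2 ≤ n * D ^ 2 := by gcongr
      have := base m q
      simp only [pow_zero, mul_one]
      nlinarith [sq_nonneg (2 + D)]
    | succ i ih =>
      intro m hm q
      refine (step _ (by positivity) ih m hm q).trans (le_of_eq ?_)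
      ring
  have hlim : Tendsto (fun i : ℕ => n * D ^ 2 * (1 / 2 : ℝ) ^ i + (8 + (2 + D) ^ 2)) atTop
      (𝓝 (n * D ^ 2 * 0 + (8 + (2 + D) ^ 2))) :=
    ((tendsto_pow_atTop_nhds_zero_of_lt_one (by norm_num) (by norm_num)).const_mul _).add_const _
  rw [mul_zero, zero_add] at hlim
  exact ge_of_tendsto' hlim fun i => iter i n le_rfl q

end Tree

section Cubes

variable {d : ℕ}

/-- The closed cube with corner `c` and side length `l`. -/
def cube (c : Rd d) (l : ℝ) : Set (Rd d) := {x | ∀ i, x i ∈ Icc (c i) (c i + l)}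

/-- The half-open cube with corner `c` and side length `l`. -/
def hcube (c : Rd d) (l : ℝ) : Set (Rd d) := {x | ∀ i, x i ∈ Ico (c i) (c i + l)}

/-- The open cube with corner `c` and side length `l`. -/
def ocube (c : Rd d) (l : ℝ) : Set (Rd d) := {x | ∀ i, x i ∈ Ioo (c i) (c i + l)}

lemma isClosed_cube (c : Rd d) (l : ℝ) : IsClosed (cube c l) := by
  simp only [cube, Set.ofPred_forall]
  exact isClosed_iInter fun i => isClosed_Icc.preimage (by fun_prop)

lemma isOpen_ocube (c : Rd d) (l : ℝ) : IsOpen (ocube c l) := by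
  simp only [ocube, Set.ofPred_forall]
  exact isOpen_iInter_of_finite fun i => isOpen_Ioo.preimage (by fun_prop)

lemma measurableSet_hcube (c : Rd d) (l : ℝ) : MeasurableSet (hcube c l) := by
  simp only [hcube, Set.ofPred_forall]
  exact MeasurableSet.iInter fun i =>
    measurableSet_Ico.preimage (f := fun x : Rd d => x i) (by fun_prop)

lemma volume_cube (c : Rd d) (l : ℝ) : volume (cube c l) = ENNReal.ofReal l ^ d := by
  have h1 : cube c l = (WithLp.ofLp : Rd d → Fin d → ℝ) ⁻¹'
      (Set.univ.pi fun i => Icc (c i) (c i + l)) := by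
    ext x; simp [cube, -Set.pi_univ_Icc]
  rw [h1, (PiLp.volume_preserving_ofLp (Fin d)).measure_preimage
    (MeasurableSet.univ_pi fun i => measurableSet_Icc).nullMeasurableSet]
  simp only [volume_pi_pi, Real.volume_Icc, add_sub_cancel_left,
    Finset.prod_const, Finset.card_univ, Fintype.card_fin]

lemma volume_ocube (c : Rd d) (l : ℝ) : volume (ocube c l) = ENNReal.ofReal l ^ d := by
  have h1 : ocube c l = (WithLp.ofLp : Rd d → Fin d → ℝ) ⁻¹'
      (Set.univ.pi fun i => Ioo (c i) (c i + l)) := by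
    ext x; simp [ocube]
  rw [h1, (PiLp.volume_preserving_ofLp (Fin d)).measure_preimage
    (MeasurableSet.univ_pi fun i => measurableSet_Ioo).nullMeasurableSet]
  simp only [volume_pi_pi, Real.volume_Ioo, add_sub_cancel_left,
    Finset.prod_const, Finset.card_univ, Fintype.card_fin]

lemma ocube_subset_hcube (c : Rd d) (l : ℝ) : ocube c l ⊆ hcube c l :=
  fun _ hx i => Ioo_subset_Ico_self (hx i)

lemma hcube_subset_cube (c : Rd d) (l : ℝ) : hcube c l ⊆ cube c l :=
  fun _ hx i => Ico_subset_Icc_self (hx i)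

lemma ocube_ae_eq_cube (c : Rd d) (l : ℝ) : ocube c l =ᵐ[volume] cube c l :=
  ae_eq_of_subset_of_measure_ge ((ocube_subset_hcube c l).trans (hcube_subset_cube c l))
    (by rw [volume_cube, volume_ocube]) (isOpen_ocube c l).nullMeasurableSet
    (by rw [volume_cube]; finiteness)

lemma hcube_ae_eq_cube (c : Rd d) (l : ℝ) : hcube c l =ᵐ[volume] cube c l :=
  (hcube_subset_cube c l).eventuallyLE.antisymm
    ((ocube_ae_eq_cube c l).symm.le.trans (ocube_subset_hcube c l).eventuallyLE)

lemma volume_hcube (c : Rd d) (l : ℝ) : volume (hcube c l) = ENNReal.ofReal l ^ d := by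
  rw [measure_congr (hcube_ae_eq_cube c l), volume_cube]

lemma cube_subset_closedBall {c x : Rd d} {l : ℝ} (hl : 0 ≤ l) (hx : x ∈ cube c l) :
    cube c l ⊆ closedBall x (d * l) := by
  intro y hy
  rw [mem_closedBall, dist_eq_norm, EuclideanSpace.norm_eq]
  have h1 : ∀ i, ‖(y - x) i‖ ^ 2 ≤ l ^ 2 := fun i => by
    have h2 := hx i
    have h3 := hy i
    rw [Real.norm_eq_abs, sq_abs]
    refine sq_le_sq' ?_ ?_ <;> simp only [PiLp.sub_apply] <;> linarith [h2.1, h2.2, h3.1, h3.2]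
  have h4 : ∑ i, ‖(y - x) i‖ ^ 2 ≤ (d * l) ^ 2 := by
    refine (Finset.sum_le_sum fun i _ => h1 i).trans ?_
    simp only [Finset.sum_const, Finset.card_univ, Fintype.card_fin, nsmul_eq_mul, mul_pow]
    gcongr
    exact_mod_cast Nat.le_self_pow two_ne_zero d
  exact Real.sqrt_le_iff.2 ⟨by positivity, h4⟩

lemma isCompact_cube (c : Rd d) (l : ℝ) : IsCompact (cube c l) := by
  rcases (cube c l).eq_empty_or_nonempty with h | ⟨x, hx⟩
  · rw [h]; exact isCompact_empty
  by_cases hl : 0 ≤ l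
  · exact (isCompact_closedBall x (d * l)).of_isClosed_subset (isClosed_cube c l)
      (cube_subset_closedBall hl hx)
  · rcases d with _ | n
    · exact (Set.toFinite _).isCompact
    · exact absurd (hx 0) (by simp only [mem_Icc]; intro h; linarith [h.1, h.2])

lemma corner_mem_cube (c : Rd d) {l : ℝ} (hl : 0 ≤ l) : c ∈ cube c l :=
  fun i => ⟨le_rfl, by linarith⟩

/-- Corner of a dyadic child of the cube with corner `c` and side length `l`. -/
def childCorner (c : Rd d) (l : ℝ) (ε : Fin d → Fin 2) : Rd d :=
  WithLp.toLp 2 fun i => c i + l / 2 * (ε i : ℝ)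

lemma childCorner_apply (c : Rd d) (l : ℝ) (ε : Fin d → Fin 2) (i : Fin d) :
    childCorner c l ε i = c i + l / 2 * ((ε i : ℕ) : ℝ) := rfl

lemma iUnion_hcube_child (c : Rd d) {l : ℝ} (hl : 0 < l) :
    ⋃ ε, hcube (childCorner c l ε) (l / 2) = hcube c l := by
  ext x
  simp only [mem_iUnion, hcube, mem_ofPred_eq, childCorner_apply, mem_Ico]
  constructor
  · rintro ⟨ε, h⟩ i
    have h0 : (0 : ℝ) ≤ ((ε i : ℕ) : ℝ) := by positivity
    have h1 : ((ε i : ℕ) : ℝ) ≤ 1 := by exact_mod_cast Nat.lt_succ_iff.1 (ε i).2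
    obtain ⟨h2, h3⟩ := h i
    constructor <;> nlinarith
  · intro h
    refine ⟨fun i => if x i < c i + l / 2 then 0 else 1, fun i => ?_⟩
    obtain ⟨h2, h3⟩ := h i
    dsimp only
    split_ifs with h4
    · simp; exact ⟨h2, h4⟩
    · push Not at h4
      simp; exact ⟨h4, by linarith⟩

lemma pairwise_disjoint_hcube_child (c : Rd d) (l : ℝ) :
    Pairwise (Function.onFun Disjoint fun ε => hcube (childCorner c l ε) (l / 2)) := by
  intro ε ε' hne
  rw [Function.onFun, Set.disjoint_left]
  intro x hx hx'
  obtain ⟨i, hi⟩ := Function.ne_iff.1 hne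
  have h1 := hx i
  have h2 := hx' i
  simp only [childCorner_apply, mem_Ico] at h1 h2
  apply hi
  generalize ε i = a at *
  generalize ε' i = b at *
  fin_cases a <;> fin_cases b <;> simp at * <;> linarith

/-- Corner of the cube centred at `x` with half side length `R`. -/
def ballCorner (x : Rd d) (R : ℝ) : Rd d := WithLp.toLp 2 fun i => x i - R

lemma closedBall_subset_cube (x : Rd d) (R : ℝ) :
    closedBall x R ⊆ cube (ballCorner x R) (2 * R) := by
  intro y hy i
  rw [mem_closedBall, dist_eq_norm] at hy
  have h1 := (PiLp.norm_apply_le (y - x) i).trans hy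
  rw [Real.norm_eq_abs, PiLp.sub_apply, abs_le] at h1
  simp only [ballCorner, mem_Icc]
  constructor <;> linarith [h1.1, h1.2]

lemma volume_closedBall_le (x c : Rd d) {l : ℝ} (hl : 0 ≤ l) :
    volume (closedBall x (3 * ((d + 1) * l))) ≤
      (((6 * (d + 1)) ^ d : ℝ≥0) : ℝ≥0∞) * volume (cube c l) := by
  refine (measure_mono (closedBall_subset_cube _ _)).trans (le_of_eq ?_)
  rw [volume_cube, volume_cube, ← ENNReal.ofReal_pow (by positivity),
    ← ENNReal.ofReal_pow (by positivity), ← ENNReal.ofReal_coe_nnreal,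
    ← ENNReal.ofReal_mul (by positivity)]
  congr 1
  push_cast
  rw [← mul_pow]
  ring

end Cubes

section JohnNirenberg

variable {d : ℕ} {b : Rd d → ℝ}

/-- Cubes, parametrized by corner and (positive) side length. -/
abbrev CubeIdx (d : ℕ) := Rd d × Set.Ioi (0 : ℝ)

/-- Dyadic children of a cube. -/
def cubeChild (q : CubeIdx d) (ε : Fin d → Fin 2) : CubeIdx d :=
  (childCorner q.1 q.2 ε, ⟨q.2 / 2, half_pos (mem_Ioi.1 q.2.2)⟩)

/-- Mean value of `b` on a cube. -/
def cubeAvg (b : Rd d → ℝ) (q : CubeIdx d) : ℝ := cavg b (cube q.1 q.2)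

lemma volume_real_cube (c : Rd d) {l : ℝ} (hl : 0 ≤ l) : volume.real (cube c l) = l ^ d := by
  rw [Measure.real, volume_cube, ENNReal.toReal_pow, ENNReal.toReal_ofReal hl]

lemma average_cube (f : Rd d → ℝ) (c : Rd d) {l : ℝ} (hl : 0 ≤ l) :
    ⨍ x in cube c l, f x = (∫ x in cube c l, f x) / l ^ d := by
  rw [setAverage_eq, volume_real_cube c hl, smul_eq_mul, inv_mul_eq_div]

lemma integrableOn_cube {f : Rd d → ℝ} (hf : LocallyIntegrable f volume) (c : Rd d) (l : ℝ) :
    IntegrableOn f (cube c l) volume :=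
  hf.integrableOn_isCompact (isCompact_cube c l)

lemma setAverage_cube_eq_child {f : Rd d → ℝ} (hf : LocallyIntegrable f volume)
    (q : CubeIdx d) :
    ⨍ x in cube q.1 q.2, f x =
      (∑ ε, ⨍ x in cube (cubeChild q ε).1 (cubeChild q ε).2, f x) /
        Fintype.card (Fin d → Fin 2) := by
  obtain ⟨c, l, hl⟩ := q
  have hl : 0 < l := hl
  simp only [cubeChild]
  have h1 : ∀ ε, ⨍ x in cube (childCorner c l ε) (l / 2), f x =
      (∫ x in hcube (childCorner c l ε) (l / 2), f x) / (l / 2) ^ d := fun ε => by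
    rw [average_cube _ _ (by positivity), setIntegral_congr_set (hcube_ae_eq_cube _ _)]
  simp only [h1]
  rw [← Finset.sum_div, ← integral_iUnion_fintype (fun ε => measurableSet_hcube _ _)
    (pairwise_disjoint_hcube_child c l), iUnion_hcube_child c hl,
    setIntegral_congr_set (hcube_ae_eq_cube c l), average_cube _ _ hl.le, div_pow, div_div]
  · congr 1
    simp
  · exact fun ε => (integrableOn_cube hf _ _).mono_set (hcube_subset_cube _ _)

lemma integrable_abs_sub_const (hb : LocallyIntegrable b volume) (t : ℝ) :
    LocallyIntegrable (fun x => |b x - t|) volume :=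
  fun x => ((hb.sub (locallyIntegrable_const t)) x).norm

lemma abs_cavg_sub_le (hb : LocallyIntegrable b volume) (t : ℝ) (c : Rd d) {l : ℝ}
    (hl : 0 < l) : |cavg b (cube c l) - t| ≤ ⨍ x in cube c l, |b x - t| := by
  have h1 : cavg b (cube c l) - t = ⨍ x in cube c l, (b x - t) := by
    rw [cavg, average_cube _ _ hl.le, average_cube _ _ hl.le,
      integral_sub (integrableOn_cube hb c l) (integrableOn_cube (locallyIntegrable_const t) c l),
      setIntegral_const, volume_real_cube c hl.le, smul_eq_mul]
    field_simp
  rw [h1, average_cube _ _ hl.le, average_cube _ _ hl.le, abs_div, abs_of_pos (pow_pos hl d)]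
  gcongr
  exact abs_integral_le_integral_abs

lemma treeAvg_abs_le_average (hb : LocallyIntegrable b volume) (t : ℝ) :
    ∀ (n : ℕ) (q : CubeIdx d), treeAvg cubeChild (fun p => |cubeAvg b p - t|) n q ≤
      ⨍ x in cube q.1 q.2, |b x - t| := by
  intro n
  induction n with
  | zero => exact fun q => abs_cavg_sub_le hb t q.1 q.2.2
  | succ n ih =>
    intro q
    rw [setAverage_cube_eq_child (integrable_abs_sub_const hb t) q, treeAvg]
    gcongr
    exact ih _

lemma treeAvg_cubeAvg_sq_le (hb : BMOBound b 1) (n : ℕ) (q : CubeIdx d) :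
    treeAvg cubeChild (fun p => (cubeAvg b p - cubeAvg b q) ^ 2) n q ≤
      8 + (2 + (2 : ℝ) ^ d) ^ 2 := by
  have := treeAvg_sq_le (ch := cubeChild) (u := cubeAvg b)
    (fun q => setAverage_cube_eq_child hb.1 q)
    (fun n q => (treeAvg_abs_le_average hb.1 _ n q).trans (hb.2 _ ⟨q.2, q.2.2, q.1, rfl⟩)) n q
  simpa using this

/-- Dyadic approximation of `b` on the half-open cube `q`, constant on the
descendants of generation `n`. -/
def treeFun (b : Rd d → ℝ) : ℕ → CubeIdx d → Rd d → ℝ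
  | 0, q => fun _ => cubeAvg b q
  | n + 1, q => fun x => ∑ ε, (hcube (cubeChild q ε).1 (cubeChild q ε).2).indicator
      (treeFun b n (cubeChild q ε)) x

lemma measurable_treeFun : ∀ (n : ℕ) (q : CubeIdx d), Measurable (treeFun b n q) := by
  intro n
  induction n with
  | zero => exact fun q => measurable_const
  | succ n ih =>
    intro q
    exact Finset.measurable_sum _ fun ε _ => (ih _).indicator (measurableSet_hcube _ _)

lemma treeFun_succ_of_mem {n : ℕ} {q : CubeIdx d} {ε : Fin d → Fin 2} {x : Rd d}
    (hx : x ∈ hcube (cubeChild q ε).1 (cubeChild q ε).2) :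
    treeFun b (n + 1) q x = treeFun b n (cubeChild q ε) x := by
  simp only [treeFun]
  rw [Finset.sum_eq_single ε, indicator_of_mem hx]
  · intro ε' _ hne
    exact indicator_of_notMem
      (fun h => Set.disjoint_left.1 (pairwise_disjoint_hcube_child q.1 q.2 hne) h hx) _
  · simp

lemma treeFun_eq_cavg : ∀ (n : ℕ) (q : CubeIdx d) (x : Rd d), x ∈ hcube q.1 q.2 →
    ∃ c, x ∈ hcube c ((q.2 : ℝ) / 2 ^ n) ∧
      treeFun b n q x = cavg b (cube c ((q.2 : ℝ) / 2 ^ n)) := by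
  intro n
  induction n with
  | zero => exact fun q x hx => ⟨q.1, by simpa using hx, by simp [treeFun, cubeAvg]⟩
  | succ n ih =>
    intro q x hx
    rw [← iUnion_hcube_child q.1 q.2.2] at hx
    obtain ⟨ε, hε⟩ := mem_iUnion.1 hx
    obtain ⟨c, h1, h2⟩ := ih (cubeChild q ε) x hε
    have h3 : ((cubeChild q ε).2 : ℝ) / 2 ^ n = (q.2 : ℝ) / 2 ^ (n + 1) := by
      simp only [cubeChild, pow_succ]; field_simp
    rw [h3] at h1 h2
    exact ⟨c, h1, (treeFun_succ_of_mem hε).trans h2⟩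

lemma treeAvg_nonneg {X κ : Type*} [Fintype κ] {ch : X → κ → X} {g : X → ℝ}
    (hg : ∀ q, 0 ≤ g q) : ∀ n q, 0 ≤ treeAvg ch g n q := by
  intro n
  induction n with
  | zero => exact hg
  | succ n ih => exact fun q => div_nonneg (Finset.sum_nonneg fun k _ => ih _) (Nat.cast_nonneg _)

lemma lintegral_treeFun_sq (t : ℝ) : ∀ (n : ℕ) (q : CubeIdx d),
    ∫⁻ x in hcube q.1 q.2, ENNReal.ofReal ((treeFun b n q x - t) ^ 2) =
      ENNReal.ofReal (treeAvg cubeChild (fun p => (cubeAvg b p - t) ^ 2) n q * (q.2 : ℝ) ^ d) := by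
  intro n
  have hnn : ∀ n q, 0 ≤ treeAvg cubeChild (fun p : CubeIdx d => (cubeAvg b p - t) ^ 2) n q :=
    treeAvg_nonneg fun _ => sq_nonneg _
  induction n with
  | zero =>
    intro q
    simp only [treeFun, treeAvg, lintegral_const, Measure.restrict_apply MeasurableSet.univ,
      univ_inter, volume_hcube]
    rw [ENNReal.ofReal_mul (sq_nonneg _), ENNReal.ofReal_pow (le_of_lt q.2.2)]
  | succ n ih =>
    intro q
    rw [← iUnion_hcube_child q.1 q.2.2,
      lintegral_iUnion (fun ε => measurableSet_hcube _ _) (pairwise_disjoint_hcube_child _ _),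
      tsum_fintype]
    have h1 : ∀ ε, ∫⁻ x in hcube (childCorner q.1 q.2 ε) ((q.2 : ℝ) / 2),
        ENNReal.ofReal ((treeFun b (n + 1) q x - t) ^ 2) =
        ENNReal.ofReal (treeAvg cubeChild (fun p => (cubeAvg b p - t) ^ 2) n (cubeChild q ε) *
          ((q.2 : ℝ) / 2) ^ d) := fun ε => by
      refine Eq.trans ?_ (ih (cubeChild q ε))
      refine setLIntegral_congr_fun (measurableSet_hcube _ _) fun x hx => ?_
      simp only [treeFun_succ_of_mem (ε := ε) (q := q) hx]
    have hq : (0 : ℝ) < q.2 := q.2.2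
    rw [Finset.sum_congr rfl fun ε _ => h1 ε, ← ENNReal.ofReal_sum_of_nonneg
      fun ε _ => mul_nonneg (hnn _ _) (by positivity), ← Finset.sum_mul, treeAvg]
    congr 1
    simp only [div_pow, Fintype.card_pi, Fintype.card_fin, Finset.prod_const, Finset.card_univ]
    push_cast
    field_simp

/-- A Vitali family on `ℝ^d` containing all the nondegenerate cubes around a point. -/
def cubeVitali (d : ℕ) : VitaliFamily (volume : Measure (Rd d)) :=
  Vitali.vitaliFamily volume ((6 * (d + 1)) ^ d) fun x => Eventually.frequently <| by
    filter_upwards [self_mem_nhdsWithin] with r hr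
    have hr : 0 < r := hr
    have h1 := volume_closedBall_le x x (l := r / (d + 1)) (by positivity)
    rw [mul_div_cancel₀ _ (by positivity)] at h1
    refine h1.trans (mul_le_mul_right (measure_mono ?_) _)
    refine (cube_subset_closedBall (by positivity) (corner_mem_cube x (by positivity))).trans
      (closedBall_subset_closedBall ?_)
    rw [mul_div_assoc', div_le_iff₀ (by positivity)]
    nlinarith

lemma cube_mem_setsAt {x c : Rd d} {l : ℝ} (hl : 0 < l) (hx : x ∈ cube c l) :
    cube c l ∈ (cubeVitali d).setsAt x := by
  refine ⟨isClosed_cube c l, ?_, (d + 1) * l, ?_, volume_closedBall_le x c hl.le⟩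
  · refine Set.Nonempty.mono (interior_maximal
      ((ocube_subset_hcube c l).trans (hcube_subset_cube c l)) (isOpen_ocube c l))
      ⟨WithLp.toLp 2 fun i => c i + l / 2, fun i => ⟨?_, ?_⟩⟩ <;> simp <;> linarith
  · exact (cube_subset_closedBall hl.le hx).trans (closedBall_subset_closedBall (by nlinarith))

lemma ae_tendsto_treeFun (hb : LocallyIntegrable b volume) (q : CubeIdx d) :
    ∀ᵐ x ∂(volume.restrict (hcube q.1 q.2)),
      Tendsto (fun n => treeFun b n q x) atTop (𝓝 (b x)) := by
  rw [ae_restrict_iff' (measurableSet_hcube _ _)]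
  filter_upwards [(cubeVitali d).ae_tendsto_average hb] with x hx hxq
  choose c hc using fun n => treeFun_eq_cavg (b := b) n q x hxq
  have hq : (0 : ℝ) < q.2 := q.2.2
  have h1 : Tendsto (fun n => cube (c n) ((q.2 : ℝ) / 2 ^ n)) atTop
      ((cubeVitali d).filterAt x) := by
    rw [VitaliFamily.tendsto_filterAt_iff]
    refine ⟨Eventually.of_forall fun n =>
      cube_mem_setsAt (by positivity) (hcube_subset_cube _ _ (hc n).1), fun ε hε => ?_⟩
    have h2 : Tendsto (fun n : ℕ => (d : ℝ) * ((q.2 : ℝ) / 2 ^ n)) atTop (𝓝 0) := by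
      have h3 : Tendsto (fun n : ℕ => (d : ℝ) * q.2 * (1 / 2 : ℝ) ^ n) atTop
          (𝓝 (d * q.2 * 0)) :=
        (tendsto_pow_atTop_nhds_zero_of_lt_one (by norm_num) (by norm_num)).const_mul _
      rw [mul_zero] at h3
      refine h3.congr fun n => ?_
      rw [div_pow, one_pow]; ring
    filter_upwards [h2.eventually_le_const hε] with n hn
    exact (cube_subset_closedBall (by positivity) (hcube_subset_cube _ _ (hc n).1)).trans
      (closedBall_subset_closedBall hn)
  exact (hx.comp h1).congr fun n => (hc n).2.symm

/-- The quadratic mean oscillation of a function of `BMO` is bounded. -/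
lemma lintegral_sq_sub_cavg_le (hb : BMOBound b 1) (c : Rd d) {l : ℝ} (hl : 0 < l) :
    ∫⁻ x in cube c l, ENNReal.ofReal ((b x - cavg b (cube c l)) ^ 2) ≤
      ENNReal.ofReal ((8 + (2 + (2 : ℝ) ^ d) ^ 2) * l ^ d) := by
  set q : CubeIdx d := (c, ⟨l, hl⟩)
  set t := cavg b (cube c l)
  rw [← setLIntegral_congr (hcube_ae_eq_cube c l)]
  calc ∫⁻ x in hcube c l, ENNReal.ofReal ((b x - t) ^ 2)
      = ∫⁻ x in hcube c l,
          liminf (fun n => ENNReal.ofReal ((treeFun b n q x - t) ^ 2)) atTop := by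
        refine lintegral_congr_ae ?_
        filter_upwards [ae_tendsto_treeFun hb.1 q] with x hx
        exact (ENNReal.tendsto_ofReal ((hx.sub_const t).pow 2)).liminf_eq.symm
    _ ≤ liminf (fun n => ∫⁻ x in hcube c l,
          ENNReal.ofReal ((treeFun b n q x - t) ^ 2)) atTop :=
        lintegral_liminf_le fun n =>
          (((measurable_treeFun n q).sub_const t).pow_const 2).ennreal_ofReal
    _ ≤ _ := by
        refine liminf_le_of_le (by isBoundedDefault) fun a ha => ?_
        obtain ⟨n, hn⟩ := ha.exists
        refine hn.trans ((lintegral_treeFun_sq t n q).le.trans (ENNReal.ofReal_le_ofReal ?_))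
        exact mul_le_mul_of_nonneg_right (treeAvg_cubeAvg_sq_le hb n q) (by positivity)

end JohnNirenberg

section Tube

variable {d : ℕ} {b : Rd d → ℝ}

lemma abs_cavg_sub_cavg_le_of_le_two_mul (hb : BMOBound b 1) {c c' : Rd d} {l L : ℝ}
    (hl : 0 < l) (hL : L ≤ 2 * l) (h : ∀ i, c' i ≤ c i ∧ c i + l ≤ c' i + L) (hlL : l ≤ L) :
    |cavg b (cube c l) - cavg b (cube c' L)| ≤ 2 ^ d := by
  have hL0 : 0 < L := hl.trans_le hlL
  have hsub : cube c l ⊆ cube c' L := fun x hx i =>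
    ⟨(h i).1.trans (hx i).1, (hx i).2.trans (h i).2⟩
  have h1 := hb.2 (cube c' L) ⟨L, hL0, c', rfl⟩
  refine (abs_cavg_sub_le hb.1 _ c hl).trans ?_
  rw [average_cube _ _ hL0.le, div_le_one (pow_pos hL0 d)] at h1
  rw [average_cube _ _ hl.le, div_le_iff₀ (pow_pos hl d), ← mul_pow]
  refine (setIntegral_mono_set (integrableOn_cube (integrable_abs_sub_const hb.1 _) _ _)
    (Eventually.of_forall fun _ => abs_nonneg _) hsub.eventuallyLE).trans (h1.trans ?_)
  gcongr

/-- Mean values of a `BMO` function over nested cubes differ at most by the logarithm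
of the ratio of the side lengths. -/
lemma abs_cavg_sub_cavg_le (hb : BMOBound b 1) {c' : Rd d} {L : ℝ} (n : ℕ) :
    ∀ {c : Rd d} {l : ℝ}, 0 < l → l ≤ L → L ≤ 2 ^ n * l →
      (∀ i, c' i ≤ c i ∧ c i + l ≤ c' i + L) →
      |cavg b (cube c l) - cavg b (cube c' L)| ≤ 2 ^ d * (n + 1) := by
  induction n with
  | zero =>
    intro c l hl hlL hL h
    simpa using abs_cavg_sub_cavg_le_of_le_two_mul hb hl (by linarith) h hlL
  | succ n ih =>
    intro c l hl hlL hL h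
    have h2 : (0 : ℝ) < 2 ^ d := by positivity
    by_cases h2l : L ≤ 2 * l
    · refine (abs_cavg_sub_cavg_le_of_le_two_mul hb hl h2l h hlL).trans ?_
      push_cast
      nlinarith
    · push Not at h2l
      let m : Rd d := WithLp.toLp 2 fun i => max (c' i) (c i - l)
      have hm : ∀ i, m i = max (c' i) (c i - l) := fun i => rfl
      have h3 := ih (c := m) (l := 2 * l) (by positivity) h2l.le
        (by rw [pow_succ] at hL; linarith) fun i => by
          rw [hm]
          refine ⟨le_max_left _ _, ?_⟩
          have hi := (h i).2
          rcases max_cases (c' i) (c i - l) with h6 | h6 <;> linarith [h6.1]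
      have h4 := abs_cavg_sub_cavg_le_of_le_two_mul hb (c := c) (c' := m) hl le_rfl
        (fun i => by
          rw [hm]
          refine ⟨max_le (h i).1 (by linarith), ?_⟩
          linarith [le_max_right (c' i) (c i - l)]) (by linarith)
      have h5 := abs_sub_le (cavg b (cube c l)) (cavg b (cube m (2 * l))) (cavg b (cube c' L))
      push_cast
      linarith

/-- The neighbourhood of width `η` of a segment of half length `ρ`, centred at `c` and
with direction `e`. -/
def tube (c e : Rd d) (ρ η : ℝ) : Set (Rd d) := ⋃ t ∈ Icc (-ρ) ρ, ball (c + t • e) η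

lemma mem_tube {c e x : Rd d} {ρ η : ℝ} :
    x ∈ tube c e ρ η ↔ ∃ t : ℝ, |t| ≤ ρ ∧ ‖x - (c + t • e)‖ < η := by
  simp only [tube, mem_iUnion, mem_Icc, mem_ball, dist_eq_norm, abs_le, exists_prop]

lemma measurableSet_tube (c e : Rd d) (ρ η : ℝ) : MeasurableSet (tube c e ρ η) :=
  (isOpen_biUnion fun _ _ => isOpen_ball).measurableSet

lemma tube_subset_biUnion_cube (c : Rd d) {e : Rd d} (he : ‖e‖ = 1) {ρ η : ℝ} (hη : 0 < η) :
    tube c e ρ η ⊆ ⋃ k ∈ Finset.Icc (-⌈ρ / η⌉) ⌈ρ / η⌉,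
      cube (ballCorner (c + ((k : ℝ) * η) • e) (2 * η)) (4 * η) := by
  intro x hx
  obtain ⟨t, ht, hxt⟩ := mem_tube.1 hx
  obtain ⟨ht1, ht2⟩ := abs_le.1 ht
  refine mem_biUnion (x := ⌊t / η⌋) ?_ ?_
  · simp only [Finset.coe_Icc, mem_Icc]
    constructor
    · rw [Int.le_floor]
      push_cast
      have h1 : ρ / η ≤ ⌈ρ / η⌉ := Int.le_ceil _
      have h2 : -(ρ / η) ≤ t / η := by rw [← neg_div]; gcongr
      linarith
    · rw [← Int.cast_le (R := ℝ)]
      exact (Int.floor_le _).trans ((by gcongr : t / η ≤ ρ / η).trans (Int.le_ceil _))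
  · rw [show 4 * η = 2 * (2 * η) by ring]
    apply closedBall_subset_cube
    rw [mem_closedBall, dist_eq_norm]
    have h3 : x - (c + ((⌊t / η⌋ : ℝ) * η) • e) =
        (x - (c + t • e)) + (t - (⌊t / η⌋ : ℝ) * η) • e := by
      rw [sub_smul]; abel
    have h4 : |t - (⌊t / η⌋ : ℝ) * η| ≤ η := by
      have h5 := Int.floor_le (t / η)
      have h6 := Int.lt_floor_add_one (t / η)
      rw [le_div_iff₀ hη] at h5
      rw [div_lt_iff₀ hη] at h6
      rw [abs_le]
      constructor <;> nlinarith
    rw [h3]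
    refine (norm_add_le _ _).trans ?_
    rw [norm_smul, he, mul_one, Real.norm_eq_abs]
    linarith

lemma card_Icc_ceil_le {r : ℝ} (hr : 1 ≤ r) : ((Finset.Icc (-⌈r⌉) ⌈r⌉).card : ℝ) ≤ 5 * r := by
  have h0 : 0 ≤ ⌈r⌉ := Int.ceil_nonneg (by linarith)
  rw [Int.card_Icc]
  have h1 : ((⌈r⌉ + 1 - -⌈r⌉).toNat : ℤ) = 2 * ⌈r⌉ + 1 := by omega
  have h2 : ((⌈r⌉ + 1 - -⌈r⌉).toNat : ℝ) = 2 * ⌈r⌉ + 1 := by exact_mod_cast h1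
  rw [h2]
  linarith [Int.ceil_lt_add_one r]

lemma lintegral_biUnion_finset_le {α κ : Type*} [MeasurableSpace α] {μ : Measure α}
    (t : Finset κ) (A : κ → Set α) (f : α → ℝ≥0∞) :
    ∫⁻ x in ⋃ k ∈ t, A k, f x ∂μ ≤ ∑ k ∈ t, ∫⁻ x in A k, f x ∂μ := by
  rw [← Finset.tsum_subtype, show (⋃ k ∈ t, A k) = ⋃ k : t, A k from biUnion_eq_iUnion _ _]
  exact lintegral_iUnion_le (fun k : t => A k) f

lemma lintegral_cube_one_add_sq_le (hb : BMOBound b 1) (t : ℝ) (c : Rd d) {l : ℝ} (hl : 0 < l) :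
    ∫⁻ x in cube c l, ENNReal.ofReal (1 + (b x - t) ^ 2) ≤
      ENNReal.ofReal ((1 + 2 * (cavg b (cube c l) - t) ^ 2 +
        2 * (8 + (2 + (2 : ℝ) ^ d) ^ 2)) * l ^ d) := by
  set u := cavg b (cube c l)
  have h1 : ∀ x, ENNReal.ofReal (1 + (b x - t) ^ 2) ≤
      ENNReal.ofReal (1 + 2 * (u - t) ^ 2) + ENNReal.ofReal 2 * ENNReal.ofReal ((b x - u) ^ 2) := by
    intro x
    rw [← ENNReal.ofReal_mul (by norm_num), ← ENNReal.ofReal_add (by positivity) (by positivity)]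
    refine ENNReal.ofReal_le_ofReal ?_
    nlinarith [sq_nonneg (b x - u - (u - t))]
  refine (lintegral_mono h1).trans ?_
  rw [lintegral_add_left measurable_const, lintegral_const_mul' _ _ (by finiteness),
    setLIntegral_const, volume_cube, ← ENNReal.ofReal_pow hl.le,
    ← ENNReal.ofReal_mul (by positivity)]
  refine (add_le_add_right (mul_le_mul_right (lintegral_sq_sub_cavg_le hb c hl) _) _).trans ?_
  rw [← ENNReal.ofReal_mul (by norm_num), ← ENNReal.ofReal_add (by positivity) (by positivity)]
  refine ENNReal.ofReal_le_ofReal (le_of_eq ?_)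
  ring

/-- The constant in `lintegral_tube_le`. -/
def tubeConst (d : ℕ) : ℝ := 5 * 4 ^ d * (1 + 288 * 4 ^ d + 2 * (8 + (2 + (2 : ℝ) ^ d) ^ 2))

lemma tubeConst_pos (d : ℕ) : 0 < tubeConst d := by unfold tubeConst; positivity

/-- Quadratic oscillation of a `BMO` function over a tube, relative to its mean over a
small cube placed at the centre of the tube. -/
lemma lintegral_tube_le (hb : BMOBound b 1) (c : Rd d) {e : Rd d} (he : ‖e‖ = 1) {l ρ η : ℝ}
    {n : ℕ} (hn : 1 ≤ n) (hl : 0 < l) (hlη : l ≤ η) (hηρ : η ≤ ρ) (hρ : ρ ≤ 2 ^ n * l) :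
    ∫⁻ x in tube c e ρ η, ENNReal.ofReal (1 + (b x - cavg b (cube c l)) ^ 2) ≤
      ENNReal.ofReal (tubeConst d * n ^ 2 * (ρ / η * η ^ d)) := by
  have hη : 0 < η := hl.trans_le hlη
  have hρ0 : 0 < ρ := hη.trans_le hηρ
  have h1 : (1 : ℝ) ≤ ρ / η := (one_le_div hη).2 hηρ
  have hn1 : (1 : ℝ) ≤ n := by exact_mod_cast hn
  set t := cavg b (cube c l)
  set N := ⌈ρ / η⌉
  set B : ℝ := (1 + 288 * 4 ^ d + 2 * (8 + (2 + (2 : ℝ) ^ d) ^ 2)) * n ^ 2 * (4 * η) ^ d with hB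
  have hρ4 : 16 * ρ ≤ 2 ^ (n + 4) * l := by rw [pow_add]; nlinarith
  have hpow : (0 : ℝ) ≤ 2 ^ (n + 4) := by positivity
  have hQW : |t - cavg b (cube (ballCorner c (8 * ρ)) (16 * ρ))| ≤ 2 ^ d * (n + 5) := by
    refine (abs_cavg_sub_cavg_le hb (n + 4) hl (by linarith) hρ4 fun i => ?_).trans
      (by push_cast; nlinarith [show (0 : ℝ) < 2 ^ d by positivity])
    simp only [ballCorner]
    constructor <;> linarith
  have hk : ∀ k ∈ Finset.Icc (-N) N,
      ∫⁻ x in cube (ballCorner (c + ((k : ℝ) * η) • e) (2 * η)) (4 * η),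
        ENNReal.ofReal (1 + (b x - t) ^ 2) ≤ ENNReal.ofReal B := by
    intro k hk
    obtain ⟨hk1, hk2⟩ := Finset.mem_Icc.1 hk
    set R := ballCorner (c + ((k : ℝ) * η) • e) (2 * η) with hR
    have hkη : |(k : ℝ) * η| ≤ 2 * ρ := by
      have h2 : |(k : ℝ)| ≤ N := by
        rw [← Int.cast_abs]; exact_mod_cast abs_le.2 ⟨hk1, hk2⟩
      have h3 : (N : ℝ) < ρ / η + 1 := Int.ceil_lt_add_one _
      rw [abs_mul, abs_of_pos hη]
      have h4 : |(k : ℝ)| * η ≤ (ρ / η + 1) * η := by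
        gcongr
        linarith
      rw [add_mul, div_mul_cancel₀ _ hη.ne'] at h4
      linarith
    have hRW : |cavg b (cube R (4 * η)) - cavg b (cube (ballCorner c (8 * ρ)) (16 * ρ))| ≤
        2 ^ d * (n + 5) := by
      refine (abs_cavg_sub_cavg_le hb (n + 4) (by positivity) (by linarith) ?_ fun i => ?_).trans
        (by push_cast; nlinarith [show (0 : ℝ) < 2 ^ d by positivity])
      · exact hρ4.trans (mul_le_mul_of_nonneg_left (by linarith) hpow)
      · have h5 : |((k : ℝ) * η) * e i| ≤ 2 * ρ := by
          rw [abs_mul]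
          have h6 : |e i| ≤ 1 := by
            rw [← he, ← Real.norm_eq_abs]; exact PiLp.norm_apply_le e i
          calc _ ≤ |(k : ℝ) * η| * 1 := by gcongr
            _ ≤ _ := by linarith
        obtain ⟨h7, h8⟩ := abs_le.1 h5
        simp only [hR, ballCorner, PiLp.add_apply, PiLp.smul_apply, smul_eq_mul]
        constructor <;> linarith
    refine (lintegral_cube_one_add_sq_le hb t R (by positivity)).trans (ENNReal.ofReal_le_ofReal ?_)
    have h9 : |cavg b (cube R (4 * η)) - t| ≤ 2 ^ d * (12 * n) := by
      rw [abs_sub_comm] at hQW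
      have h10 := abs_sub_le (cavg b (cube R (4 * η)))
        (cavg b (cube (ballCorner c (8 * ρ)) (16 * ρ))) t
      have h11 : (0 : ℝ) < 2 ^ d := by positivity
      nlinarith
    have h12 : (cavg b (cube R (4 * η)) - t) ^ 2 ≤ 4 ^ d * (144 * n ^ 2) := by
      refine (sq_le_sq' (by linarith [(abs_le.1 h9).1]) (abs_le.1 h9).2).trans (le_of_eq ?_)
      rw [mul_pow, ← pow_mul, mul_comm d 2, pow_mul]
      norm_num
      ring
    rw [hB]
    gcongr
    have h13 : (1 : ℝ) ≤ (n : ℝ) ^ 2 := one_le_pow₀ hn1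
    have h14 : (0 : ℝ) ≤ (2 + (2 : ℝ) ^ d) ^ 2 := by positivity
    nlinarith
  refine (lintegral_mono_set (tube_subset_biUnion_cube c he hη)).trans ?_
  refine (lintegral_biUnion_finset_le _ _ _).trans ((Finset.sum_le_sum hk).trans ?_)
  rw [Finset.sum_const, nsmul_eq_mul, ← ENNReal.ofReal_natCast,
    ← ENNReal.ofReal_mul (by positivity)]
  refine ENNReal.ofReal_le_ofReal ?_
  refine (mul_le_mul_of_nonneg_right (card_Icc_ceil_le h1) (by positivity)).trans (le_of_eq ?_)
  rw [hB, tubeConst]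
  ring

end Tube

section Kernel

variable {d : ℕ}

lemma volume_tube_le (c : Rd d) {e : Rd d} (he : ‖e‖ = 1) {ρ η : ℝ} (hη : 0 < η) (hηρ : η ≤ ρ) :
    volume (tube c e ρ η) ≤ ENNReal.ofReal (5 * (ρ / η) * (4 * η) ^ d) := by
  refine (measure_mono (tube_subset_biUnion_cube c he hη)).trans
    ((measure_biUnion_finset_le _ _).trans ?_)
  simp only [volume_cube, Finset.sum_const, nsmul_eq_mul]
  rw [← ENNReal.ofReal_natCast, ← ENNReal.ofReal_pow (by positivity),
    ← ENNReal.ofReal_mul (by positivity)]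
  exact ENNReal.ofReal_le_ofReal (mul_le_mul_of_nonneg_right
    (card_Icc_ceil_le ((one_le_div hη).2 hηρ)) (by positivity))

lemma norm_sub_norm_smul_eq {x e : Rd d} (hx : x ≠ 0) :
    ‖x - ‖x‖ • e‖ = ‖x‖ * ‖‖x‖⁻¹ • x - e‖ := by
  have h0 : ‖x‖ ≠ 0 := norm_ne_zero_iff.2 hx
  rw [← norm_smul_of_nonneg (norm_nonneg x), smul_sub, smul_inv_smul₀ h0]

lemma norm_inv_smul_self {x : Rd d} (hx : x ≠ 0) : ‖‖x‖⁻¹ • x‖ = 1 := by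
  rw [norm_smul, norm_inv, norm_norm, inv_mul_cancel₀ (norm_ne_zero_iff.2 hx)]

lemma measurable_normalize : Measurable fun x : Rd d => ‖x‖⁻¹ • x :=
  measurable_norm.inv.smul measurable_id

lemma volume_normalize_preimage_le (hd : 2 ≤ d) {R : ℝ} (hR : 0 < R) {s : Set (Rd d)} {δ : ℝ}
    (hδ : 0 < δ) (hδ1 : δ ≤ 1) (hs : ediam s ≤ ENNReal.ofReal δ) :
    (volume.restrict (ball (0 : Rd d) R)).map (fun x => ‖x‖⁻¹ • x) s ≤
      ENNReal.ofReal (5 * (8 * R) ^ d * (δ ^ d / δ)) := by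
  have : Nonempty (Fin d) := ⟨⟨0, by omega⟩⟩
  refine (measure_mono subset_closure).trans ?_
  rw [Measure.map_apply measurable_normalize isClosed_closure.measurableSet,
    Measure.restrict_apply (measurable_normalize isClosed_closure.measurableSet)]
  by_cases h : ∃ θ ∈ closure s, ‖θ‖ = 1
  · obtain ⟨θ, hθ, hθ1⟩ := h
    have hsub : (fun x : Rd d => ‖x‖⁻¹ • x) ⁻¹' closure s ∩ ball 0 R ⊆
        tube 0 θ (2 * R) (2 * R * δ) := by
      rintro x ⟨hx1, hx2⟩
      rw [mem_ball_zero_iff] at hx2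
      rw [mem_tube]
      refine ⟨‖x‖, by rw [abs_of_nonneg (norm_nonneg _)]; linarith, ?_⟩
      rw [zero_add]
      by_cases hx0 : x = 0
      · rw [hx0, norm_zero, zero_smul, sub_zero, norm_zero]
        positivity
      · rw [norm_sub_norm_smul_eq hx0]
        have hx3 : ‖x‖⁻¹ • x ∈ closure s := hx1
        have h1 : ‖‖x‖⁻¹ • x - θ‖ ≤ δ := by
          have h2 : edist (‖x‖⁻¹ • x) θ ≤ ENNReal.ofReal δ := by
            refine (edist_le_ediam_of_mem hx3 hθ).trans ?_
            rwa [ediam_closure]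
          rw [edist_dist, dist_eq_norm] at h2
          exact (ENNReal.ofReal_le_ofReal_iff hδ.le).1 h2
        calc _ ≤ ‖x‖ * δ := by gcongr
          _ < _ := by nlinarith
    refine (measure_mono hsub).trans ((volume_tube_le 0 hθ1 (by positivity) ?_).trans
      (ENNReal.ofReal_le_ofReal (le_of_eq ?_)))
    · nlinarith
    · have : 5 * (2 * R / (2 * R * δ)) * (4 * (2 * R * δ)) ^ d =
        5 * (2 * R / (2 * R * δ)) * ((8 * R) ^ d * δ ^ d) := by rw [← mul_pow]; ring
      rw [this]
      field_simp
  · push Not at h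
    refine le_trans (measure_mono (t := {0}) ?_) (by simp)
    rintro x ⟨hx, -⟩
    by_contra hx0
    exact h _ hx (norm_inv_smul_self hx0)

/-- A cone over a set of vanishing surface measure is a Lebesgue null set. -/
lemma ae_normalize_of_ae_sphereMeasure (hd : 2 ≤ d) {p : Rd d → Prop}
    (hp : MeasurableSet {x | p x}) (h : ∀ᵐ θ ∂(sphereMeasure d), p θ) :
    ∀ᵐ x : Rd d, p (‖x‖⁻¹ • x) := by
  have : Nonempty (Fin d) := ⟨⟨0, by omega⟩⟩
  have hd1 : (0 : ℝ) < (d : ℝ) - 1 := by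
    have : (2 : ℝ) ≤ d := by exact_mod_cast hd
    linarith
  set E : Set (Rd d) := {x | ¬ p x} ∩ sphere 0 1
  have hE : MeasurableSet E := hp.compl.inter isClosed_sphere.measurableSet
  have hE0 : μH[(d : ℝ) - 1] E = 0 := by
    have hpc : MeasurableSet {x | ¬ p x} := hp.compl
    rwa [ae_iff, sphereMeasure, Measure.restrict_apply hpc] at h
  have key : ∀ n : ℕ, volume ((fun x : Rd d => ‖x‖⁻¹ • x) ⁻¹' E ∩ ball 0 ((n : ℝ) + 1)) = 0 := by
    intro n
    set R : ℝ := n + 1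
    have hR : 0 < R := by positivity
    set A : ℝ := 5 * (8 * R) ^ d
    have hA : 0 < A := by positivity
    set ν := (volume.restrict (ball (0 : Rd d) R)).map (fun x => ‖x‖⁻¹ • x) with hν
    have hle : (ENNReal.ofReal A)⁻¹ • ν ≤ μH[(d : ℝ) - 1] := by
      refine Measure.le_hausdorffMeasure _ _ 1 one_pos fun s hs => ?_
      rw [Measure.smul_apply, smul_eq_mul, mul_comm, ← div_eq_mul_inv]
      refine ENNReal.div_le_of_le_mul ?_
      have hfin : ediam s ≠ ∞ := ne_top_of_le_ne_top ENNReal.one_ne_top hs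
      rcases eq_or_ne (ediam s) 0 with h0 | h0
      · have hlim : Tendsto (fun δ : ℝ => ENNReal.ofReal (A * δ)) (𝓝[>] 0)
            (𝓝 (ENNReal.ofReal (A * 0))) :=
          ENNReal.tendsto_ofReal ((tendsto_id.mono_left nhdsWithin_le_nhds).const_mul A)
        rw [mul_zero, ENNReal.ofReal_zero] at hlim
        rw [h0, ENNReal.zero_rpow_of_pos hd1, zero_mul]
        refine ge_of_tendsto hlim ?_
        filter_upwards [Ioc_mem_nhdsGT (zero_lt_one' ℝ)] with δ hδ
        refine (volume_normalize_preimage_le hd hR hδ.1 hδ.2 (h0.trans_le zero_le)).trans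
          (ENNReal.ofReal_le_ofReal (mul_le_mul_of_nonneg_left ?_ hA.le))
        rw [div_le_iff₀ hδ.1, ← sq]
        exact pow_le_pow_of_le_one hδ.1.le hδ.2 hd
      · have hpos : 0 < (ediam s).toReal := ENNReal.toReal_pos h0 hfin
        have h1 : (ediam s).toReal ≤ 1 := by
          simpa using ENNReal.toReal_mono ENNReal.one_ne_top hs
        have h2 := volume_normalize_preimage_le hd hR hpos h1 (ENNReal.ofReal_toReal hfin).ge
        refine h2.trans (le_of_eq ?_)
        have h3 : (ediam s).toReal ^ d / (ediam s).toReal =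
            (ediam s).toReal ^ ((d : ℝ) - 1) := by
          rw [Real.rpow_sub_one hpos.ne', Real.rpow_natCast]
        rw [h3, mul_comm,
          ENNReal.ofReal_mul (by positivity), ← ENNReal.ofReal_rpow_of_pos hpos,
          ENNReal.ofReal_toReal hfin]
    have h3 := hle E
    rw [hE0, Measure.smul_apply, smul_eq_mul, nonpos_iff_eq_zero, mul_eq_zero, hν,
      Measure.map_apply measurable_normalize hE,
      Measure.restrict_apply (measurable_normalize hE)] at h3
    exact h3.resolve_left (ENNReal.inv_ne_zero.2 ENNReal.ofReal_ne_top)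
  have hne : ∀ᵐ x : Rd d, x ≠ 0 := by simp [ae_iff]
  filter_upwards [ae_all_iff.2 fun n => measure_eq_zero_iff_ae_notMem.1 (key n), hne]
    with x hx hx0
  by_contra hpx
  obtain ⟨n, hn⟩ := exists_nat_gt ‖x‖
  refine hx n ⟨⟨hpx, ?_⟩, ?_⟩
  · rw [mem_sphere_zero_iff_norm]; exact norm_inv_smul_self hx0
  · rw [mem_ball_zero_iff]; linarith

lemma Gam_nonneg {ι : Type} [Fintype ι] {ζ : Rd d → ℝ} (hζ : ZetaCutoff ζ) (e : ι → Rd d)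
    (a : ℝ) (ν : ι) (ξ : Rd d) : 0 ≤ Gam ζ e a ν ξ :=
  div_nonneg (hζ.2.1 _) (Finset.sum_nonneg fun _ _ => hζ.2.1 _)

lemma Gam_le_one {ι : Type} [Fintype ι] {ζ : Rd d → ℝ} (hζ : ZetaCutoff ζ) (e : ι → Rd d)
    (a : ℝ) (ν : ι) (ξ : Rd d) : Gam ζ e a ν ξ ≤ 1 :=
  div_le_one_of_le₀
    (Finset.single_le_sum (f := fun ν' => ζ ((2:ℝ) ^ a • (‖ξ‖⁻¹ • ξ - e ν')))
      (fun _ _ => hζ.2.1 _) (Finset.mem_univ ν))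
    (Finset.sum_nonneg fun _ _ => hζ.2.1 _)

lemma norm_mem_of_phi_ne_zero {φ : Rd d → ℝ} (hφ : PhiCutoff φ) {j : ℤ} {z : Rd d}
    (h : φ ((2:ℝ) ^ (-j) • z) ≠ 0) : (2:ℝ) ^ j / 2 ≤ ‖z‖ ∧ ‖z‖ ≤ 2 * 2 ^ j := by
  obtain ⟨h1, h2⟩ := hφ.2.2.2.1 h
  have h0 : (0:ℝ) < 2 ^ j := by positivity
  rw [norm_smul, zpow_neg, norm_inv, Real.norm_eq_abs, abs_of_pos h0, inv_mul_eq_div] at h1 h2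
  rw [le_div_iff₀ h0] at h1
  rw [div_le_iff₀ h0] at h2
  constructor <;> linarith

section Kjnu

variable {ι : Type} [Fintype ι] {Ω φ ζ : Rd d → ℝ} {e : ι → Rd d} {a : ℝ} {j : ℤ} {ν : ι}

lemma abs_Kjnu_le (hζ : ZetaCutoff ζ) (hφ : PhiCutoff φ) {z : Rd d}
    (hz : |Ω (‖z‖⁻¹ • z)| ≤ 1) : |Kjnu Ω φ ζ e a j ν z| ≤ (2 / 2 ^ j) ^ d := by
  by_cases h : φ ((2:ℝ) ^ (-j) • z) = 0
  · rw [Kjnu, h, mul_zero, zero_mul, abs_zero]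
    positivity
  · have h1 := (norm_mem_of_phi_ne_zero hφ h).1
    have h0 : (0:ℝ) < 2 ^ j := by positivity
    have hz0 : 0 < ‖z‖ := by linarith
    rw [Kjnu, abs_mul, abs_mul, abs_div, abs_of_nonneg (hφ.2.1 _),
      abs_of_nonneg (Gam_nonneg hζ _ _ _ _), abs_of_nonneg (pow_nonneg (norm_nonneg z) d)]
    calc _ ≤ 1 / ‖z‖ ^ d * 1 * 1 := by
          gcongr
          · exact Gam_nonneg hζ _ _ _ _
          · exact hφ.2.1 _
          · exact hφ.le_one _
          · exact Gam_le_one hζ _ _ _ _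
      _ = (1 / ‖z‖) ^ d := by rw [mul_one, mul_one, div_pow, one_pow]
      _ ≤ _ := by
          gcongr ?_ ^ d
          rw [div_le_div_iff₀ hz0 h0]
          linarith

lemma mem_sector_of_Kjnu_ne_zero (hζ : ZetaCutoff ζ) (hφ : PhiCutoff φ) {z : Rd d}
    (hz : Kjnu Ω φ ζ e a j ν z ≠ 0) :
    ‖z‖ ≤ 2 * 2 ^ j ∧ ‖z - ‖z‖ • e ν‖ < 2 * ((2:ℝ) ^ (-a) * 2 ^ j) := by
  rw [Kjnu] at hz
  have hφz := right_ne_zero_of_mul (left_ne_zero_of_mul hz)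
  obtain ⟨h1, h2⟩ := norm_mem_of_phi_ne_zero hφ hφz
  have h0 : (0:ℝ) < 2 ^ j := by positivity
  have hz0 : 0 < ‖z‖ := by linarith
  have hne : z ≠ 0 := norm_pos_iff.1 hz0
  refine ⟨h2, ?_⟩
  have hΓ := right_ne_zero_of_mul hz
  have hζz : ζ ((2:ℝ) ^ a • (‖z‖⁻¹ • z - e ν)) ≠ 0 := by
    intro h
    apply hΓ
    rw [Gam, norm_inv_smul_self hne, inv_one, one_smul, h, zero_div]
  have h3 := hζ.2.2.2.1 hζz
  have ha : (0:ℝ) < 2 ^ a := by positivity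
  rw [mem_ball_zero_iff, norm_smul_of_nonneg ha.le] at h3
  have h4 : ‖‖z‖⁻¹ • z - e ν‖ < (2:ℝ) ^ (-a) := by
    have h6 := (lt_div_iff₀' ha).2 h3
    rwa [one_div, ← Real.rpow_neg (by norm_num)] at h6
  rw [norm_sub_norm_smul_eq hne]
  have h5 : (0:ℝ) < 2 ^ (-a) := by positivity
  nlinarith

/-- Convolution of the sectorial kernel with a function living on a small cube. -/
lemma enorm_convK_le (hζ : ZetaCutoff ζ) (hφ : PhiCutoff φ)
    (hΩ : ∀ᵐ z : Rd d, |Ω (‖z‖⁻¹ • z)| ≤ 1) {c : Rd d} {l : ℝ} (hl : 0 ≤ l)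
    (hlj : l ≤ (2:ℝ) ^ (-a) * 2 ^ j) {g : Rd d → ℝ} (hg : Function.support g ⊆ cube c l)
    (x : Rd d) :
    ‖convK (Kjnu Ω φ ζ e a j ν) g x‖ₑ ≤
      (tube c (e ν) ((d + 2) * 2 ^ j) ((d + 2) * ((2:ℝ) ^ (-a) * 2 ^ j))).indicator
        (fun _ => ENNReal.ofReal ((2 / 2 ^ j) ^ d) * ∫⁻ y, ENNReal.ofReal |g y|) x := by
  by_cases hx : x ∈ tube c (e ν) ((d + 2) * 2 ^ j) ((d + 2) * ((2:ℝ) ^ (-a) * 2 ^ j))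
  · rw [indicator_of_mem hx]
    refine (enorm_integral_le_lintegral_enorm _).trans ?_
    rw [← lintegral_const_mul' _ _ ENNReal.ofReal_ne_top]
    refine lintegral_mono_ae ?_
    have h1 := (quasiMeasurePreserving_sub_left_of_right_invariant (volume : Measure (Rd d)) x).ae hΩ
    filter_upwards [h1] with y hy
    rw [enorm_mul, Real.enorm_eq_ofReal_abs, Real.enorm_eq_ofReal_abs]
    gcongr
    exact abs_Kjnu_le hζ hφ hy
  · have h2 : convK (Kjnu Ω φ ζ e a j ν) g x = 0 := by
      refine integral_eq_zero_of_ae (Eventually.of_forall fun y => ?_)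
      by_contra hne
      refine hx ?_
      have hK := left_ne_zero_of_mul hne
      have hy := hg (right_ne_zero_of_mul hne)
      obtain ⟨h3, h4⟩ := mem_sector_of_Kjnu_ne_zero hζ hφ hK
      have h5 := cube_subset_closedBall hl (corner_mem_cube c hl) hy
      rw [mem_closedBall, dist_eq_norm] at h5
      have h0 : (0:ℝ) < 2 ^ j := by positivity
      have hd0 : (0:ℝ) ≤ d := Nat.cast_nonneg d
      refine mem_tube.2 ⟨‖x - y‖, ?_, ?_⟩
      · rw [abs_of_nonneg (norm_nonneg _)]
        nlinarith
      · have h6 : x - (c + ‖x - y‖ • e ν) = (y - c) + (x - y - ‖x - y‖ • e ν) := by abel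
        rw [h6]
        refine (norm_add_le _ _).trans_lt ?_
        nlinarith
    rw [h2, enorm_zero]
    exact zero_le

end Kjnu

end Kernel

section AlmostOrthogonality

variable {d : ℕ} {b : Rd d → ℝ}

lemma volume_mul_one_add_abs_le (hb : LocallyIntegrable b volume) (t : ℝ) (c : Rd d) {l : ℝ}
    (hl : 0 < l) :
    volume (cube c l) * ENNReal.ofReal (1 + |cavg b (cube c l) - t|) ≤
      2 * ∫⁻ x in cube c l, ENNReal.ofReal (1 + (b x - t) ^ 2) := by
  have hint := integrableOn_cube (integrable_abs_sub_const hb t) c l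
  have hone := integrableOn_cube (locallyIntegrable_const (μ := volume) (1 : ℝ)) c l
  have h1 : l ^ d * (1 + |cavg b (cube c l) - t|) ≤ ∫ x in cube c l, (1 + |b x - t|) := by
    have h2 := abs_cavg_sub_le hb t c hl
    rw [average_cube _ _ hl.le, le_div_iff₀ (by positivity)] at h2
    rw [integral_add hone hint, setIntegral_const, volume_real_cube c hl.le, smul_eq_mul]
    linarith
  rw [volume_cube, ← ENNReal.ofReal_pow hl.le, ← ENNReal.ofReal_mul (by positivity)]
  refine (ENNReal.ofReal_le_ofReal h1).trans ?_
  rw [ofReal_integral_eq_lintegral_ofReal (f := fun x => 1 + |b x - t|) (hone.add hint)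
    (Eventually.of_forall fun x => add_nonneg zero_le_one (abs_nonneg (b x - t))),
    ← lintegral_const_mul' _ _ ENNReal.ofNat_ne_top]
  refine lintegral_mono fun x => ?_
  have h3 : (2 : ℝ≥0∞) = ENNReal.ofReal 2 := by simp
  rw [h3, ← ENNReal.ofReal_mul zero_le_two]
  refine ENNReal.ofReal_le_ofReal ?_
  have := sq_abs (b x - t)
  nlinarith [sq_nonneg (|b x - t| - 1), sq_nonneg (|b x - t|)]

lemma cube_subset_tube_of_inter {c c' e : Rd d} {ρ ρ' η η' l' : ℝ} (hρ : ρ' ≤ ρ) (hη : η' ≤ η)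
    (hl0 : 0 ≤ l') (hl : d * l' ≤ η) (h : (tube c e ρ η ∩ tube c' e ρ' η').Nonempty) :
    cube c' l' ⊆ tube c e (3 * ρ) (3 * η) := by
  obtain ⟨z, hz, hz'⟩ := h
  obtain ⟨t, ht, hzt⟩ := mem_tube.1 hz
  obtain ⟨t', ht', hzt'⟩ := mem_tube.1 hz'
  intro y hy
  have h1 := cube_subset_closedBall hl0 (corner_mem_cube c' hl0) hy
  rw [mem_closedBall, dist_eq_norm] at h1
  refine mem_tube.2 ⟨t - t', ?_, ?_⟩
  · have := abs_sub t t'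
    linarith [abs_nonneg t]
  · have h2 : y - (c + (t - t') • e) =
        (y - c') + (z - (c + t • e)) - (z - (c' + t' • e)) := by
      rw [sub_smul]; abel
    rw [h2]
    have h3 := norm_sub_le ((y - c') + (z - (c + t • e))) (z - (c' + t' • e))
    have h4 := norm_add_le (y - c') (z - (c + t • e))
    linarith

lemma enorm_mul_enorm_le (u v w : ℝ) :
    ‖u - v‖ₑ * ‖u - w‖ₑ ≤
      ENNReal.ofReal (1 + |w - v|) * ENNReal.ofReal (1 + (u - w) ^ 2) := by
  rw [Real.enorm_eq_ofReal_abs, Real.enorm_eq_ofReal_abs, ← ENNReal.ofReal_mul (abs_nonneg _),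
    ← ENNReal.ofReal_mul (by positivity)]
  refine ENNReal.ofReal_le_ofReal ?_
  have h1 := abs_sub_le u w v
  have h2 := sq_abs (u - w)
  nlinarith [abs_nonneg (u - w), abs_nonneg (w - v), sq_nonneg (|u - w| - 1),
    mul_nonneg (abs_nonneg (w - v)) (sq_nonneg (|u - w| - 1)),
    mul_nonneg (abs_nonneg (u - w)) (sub_nonneg.2 h1), sq_nonneg (|u - w|)]

lemma lintegral_tsum_sq_le {α I : Type*} [MeasurableSpace α] {μ : Measure α} [Countable I]
    (k : I → ℤ) (f : I → α → ℝ≥0∞) (hf : ∀ i, AEMeasurable (f i) μ) :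
    ∫⁻ x, (∑' i, f i x) ^ 2 ∂μ ≤
      2 * ∑' i, ∑' i', if k i' ≤ k i then ∫⁻ x, f i x * f i' x ∂μ else 0 := by
  set g : I → I → ℝ≥0∞ := fun i i' => if k i' ≤ k i then ∫⁻ x, f i x * f i' x ∂μ else 0
  have h1 : ∫⁻ x, (∑' i, f i x) ^ 2 ∂μ = ∑' i, ∑' i', ∫⁻ x, f i x * f i' x ∂μ := by
    simp_rw [sq, ← ENNReal.tsum_mul_right, ← ENNReal.tsum_mul_left]
    rw [lintegral_tsum (f := fun i x => ∑' i', f i x * f i' x)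
      fun i => AEMeasurable.tsum fun i' => (hf i).mul (hf i')]
    exact tsum_congr fun i => lintegral_tsum fun i' => (hf i).mul (hf i')
  have h2 : ∀ i i', ∫⁻ x, f i x * f i' x ∂μ ≤ g i i' + g i' i := by
    intro i i'
    rcases le_total (k i') (k i) with h | h
    · refine le_add_right (le_of_eq ?_)
      simp only [g, if_pos h]
    · refine le_add_left (le_of_eq ?_)
      simp only [g, if_pos h]
      exact lintegral_congr fun x => mul_comm _ _
  rw [h1]
  refine (ENNReal.tsum_le_tsum fun i => ENNReal.tsum_le_tsum fun i' => h2 i i').trans ?_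
  simp_rw [ENNReal.tsum_add]
  rw [ENNReal.tsum_comm (f := fun i i' => g i' i), two_mul]

/-- The part of the square function sum attached to one cube `cube c (2 ^ (j - s))`. -/
def tubePiece (b : Rd d → ℝ) (e : Rd d) (δ : ℝ) (s : ℕ) (j : ℤ) (c : Rd d) (m : ℝ≥0∞) :
    Rd d → ℝ≥0∞ :=
  (tube c e ((d + 2) * 2 ^ j) ((d + 2) * (δ * 2 ^ j))).indicator fun x =>
    ENNReal.ofReal ((2 / 2 ^ j) ^ d) * m * ‖b x - cavg b (cube c (2 ^ (j - (s : ℤ))))‖ₑ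

lemma aemeasurable_tubePiece (hb : LocallyIntegrable b volume) (e : Rd d) (δ : ℝ) (s : ℕ)
    (j : ℤ) (c : Rd d) (m : ℝ≥0∞) : AEMeasurable (tubePiece b e δ s j c m) :=
  ((((hb.aestronglyMeasurable.aemeasurable).sub_const _).enorm).const_mul _).indicator
    (measurableSet_tube _ _ _ _)

lemma zpow_sub_natCast_eq (j : ℤ) (s : ℕ) : (2 : ℝ) ^ (j - (s : ℤ)) = 2 ^ j / 2 ^ s := by
  rw [zpow_sub₀ two_ne_zero, zpow_natCast]

lemma three_mul_add_two_le (d : ℕ) : 3 * ((d : ℝ) + 2) ≤ 2 ^ (d + 4) := by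
  have : ((d : ℕ) : ℝ) ≤ 2 ^ d := by exact_mod_cast (Nat.lt_two_pow_self (n := d)).le
  rw [pow_add]
  nlinarith [one_le_pow₀ (one_le_two (α := ℝ)) (n := d)]

/-- Bound for a single tube: `r` is the dilation factor of the tube. -/
lemma ofReal_mul_lintegral_tube_le (hb : BMOBound b 1) {e : Rd d} (he : ‖e‖ = 1) {δ : ℝ}
    (hδ0 : 0 < δ) (hδ1 : δ ≤ 1) {s : ℕ} (hs : 1 ≤ 2 ^ s * δ) (j : ℤ) (c : Rd d) {r : ℝ}
    (hr : 1 ≤ r) (hr3 : r ≤ 3) :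
    ENNReal.ofReal ((2 / 2 ^ j) ^ d) *
        ∫⁻ x in tube c e (r * ((d + 2) * 2 ^ j)) (r * ((d + 2) * (δ * 2 ^ j))),
          ENNReal.ofReal (1 + (b x - cavg b (cube c (2 ^ (j - (s : ℤ))))) ^ 2) ≤
      ENNReal.ofReal (tubeConst d * (6 * (d + 2)) ^ d * (s + d + 4) ^ 2 * (δ ^ d / δ)) := by
  have h0 : (0 : ℝ) < 2 ^ j := by positivity
  have hs0 : (0 : ℝ) < 2 ^ s := by positivity
  have hd0 : (0 : ℝ) ≤ d := Nat.cast_nonneg d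
  have hδj : 0 < δ * 2 ^ j := by positivity
  have hl : (2 : ℝ) ^ (j - (s : ℤ)) ≤ δ * 2 ^ j := by
    rw [zpow_sub_natCast_eq, div_le_iff₀ hs0]
    nlinarith
  have hK : 1 ≤ r * ((d : ℝ) + 2) := by nlinarith
  have h1 := lintegral_tube_le (n := s + d + 4) hb c he (l := 2 ^ (j - (s : ℤ)))
    (ρ := r * ((d + 2) * 2 ^ j)) (η := r * ((d + 2) * (δ * 2 ^ j))) (by omega) (by positivity)
    (hl.trans (by nlinarith))
    (by
      have : δ * 2 ^ j ≤ 2 ^ j := by nlinarith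
      gcongr)
    (by
      have h2 := three_mul_add_two_le d
      rw [zpow_sub_natCast_eq, add_assoc, pow_add, mul_div_assoc']
      have h3 : (2:ℝ) ^ s * 2 ^ (d + 4) * 2 ^ j / 2 ^ s = 2 ^ (d + 4) * 2 ^ j := by
        field_simp
      rw [h3, ← mul_assoc]
      gcongr
      nlinarith)
  refine (mul_le_mul_right h1 _).trans ?_
  rw [← ENNReal.ofReal_mul (by positivity)]
  refine ENNReal.ofReal_le_ofReal ?_
  have hC := tubeConst_pos d
  have h4 : (2 / 2 ^ j) ^ d * (tubeConst d * ((s + d + 4 : ℕ) : ℝ) ^ 2 *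
      (r * ((d + 2) * 2 ^ j) / (r * ((d + 2) * (δ * 2 ^ j))) *
        (r * ((d + 2) * (δ * 2 ^ j))) ^ d)) =
      tubeConst d * ((2 * r) * (d + 2)) ^ d * (s + d + 4) ^ 2 * (δ ^ d / δ) := by
    have h5 : r * ((d + 2) * 2 ^ j) / (r * ((d + 2) * (δ * 2 ^ j))) = 1 / δ := by
      have : r ≠ 0 := by linarith
      have : (d : ℝ) + 2 ≠ 0 := by positivity
      field_simp
    have h6 : (2 / 2 ^ j) ^ d * (r * ((d + 2) * (δ * 2 ^ j))) ^ d =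
        ((2 * r) * (d + 2)) ^ d * δ ^ d := by
      rw [← mul_pow, ← mul_pow]
      congr 1
      field_simp
    rw [h5]
    push_cast
    calc _ = tubeConst d * ((s : ℝ) + d + 4) ^ 2 * (1 / δ) *
          ((2 / 2 ^ j) ^ d * (r * ((d + 2) * (δ * 2 ^ j))) ^ d) := by ring
      _ = _ := by rw [h6]; ring
  rw [h4]
  gcongr
  linarith

section Family

variable {I : Type*} {e : Rd d} {δ : ℝ} {s : ℕ} {j : I → ℤ} {c : I → Rd d}
  {m : I → ℝ≥0∞}

lemma lintegral_tubePiece_mul_le (hb : BMOBound b 1) (he : ‖e‖ = 1) (hδ0 : 0 < δ) (hδ1 : δ ≤ 1)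
    (hs : 1 ≤ 2 ^ s * δ) (hm : ∀ i, m i ≤ volume (cube (c i) (2 ^ (j i - (s : ℤ)))))
    {i i' : I} (hj : j i' ≤ j i) :
    ∫⁻ x, tubePiece b e δ s (j i) (c i) (m i) x * tubePiece b e δ s (j i') (c i') (m i') x ≤
      ENNReal.ofReal ((2 / 2 ^ j i) ^ d) * m i *
        (ENNReal.ofReal
            (tubeConst d * (6 * (d + 2)) ^ d * (s + d + 4) ^ 2 * (δ ^ d / δ)) *
          (2 * ∫⁻ x in ocube (c i') (2 ^ (j i' - (s : ℤ))) ∩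
              tube (c i) e (3 * ((d + 2) * 2 ^ j i)) (3 * ((d + 2) * (δ * 2 ^ j i))),
            ENNReal.ofReal (1 + (b x - cavg b (cube (c i) (2 ^ (j i - (s : ℤ))))) ^ 2))) := by
  set T := tube (c i) e ((d + 2) * 2 ^ j i) ((d + 2) * (δ * 2 ^ j i)) with hT
  set T' := tube (c i') e ((d + 2) * 2 ^ j i') ((d + 2) * (δ * 2 ^ j i')) with hT'
  set u := cavg b (cube (c i) (2 ^ (j i - (s : ℤ))))
  set u' := cavg b (cube (c i') (2 ^ (j i' - (s : ℤ))))
  set l' : ℝ := 2 ^ (j i' - (s : ℤ)) with hl'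
  have hl0 : 0 < l' := by positivity
  by_cases hne : (T ∩ T').Nonempty
  · have hpow : (2 : ℝ) ^ j i' ≤ 2 ^ j i := zpow_le_zpow_right₀ one_le_two hj
    have hd0 : (0 : ℝ) ≤ d := Nat.cast_nonneg d
    have hsub : ocube (c i') l' ⊆
        tube (c i) e (3 * ((d + 2) * 2 ^ j i)) (3 * ((d + 2) * (δ * 2 ^ j i))) := by
      refine ((ocube_subset_hcube _ _).trans (hcube_subset_cube _ _)).trans
        (cube_subset_tube_of_inter ?_ ?_ hl0.le ?_ hne)
      · gcongr
      · gcongr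
      · have h0 : (0 : ℝ) < 2 ^ j i' := by positivity
        have h1 : l' ≤ δ * 2 ^ j i := by
          rw [hl', zpow_sub_natCast_eq, div_le_iff₀ (by positivity)]
          have : δ * 2 ^ j i' ≤ δ * 2 ^ j i := by gcongr
          have : (0 : ℝ) < 2 ^ s := by positivity
          nlinarith
        nlinarith
    rw [inter_eq_left.2 hsub, setLIntegral_congr (ocube_ae_eq_cube _ _)]
    have h1 := volume_mul_one_add_abs_le hb.1 u (c i') hl0
    have h2 := ofReal_mul_lintegral_tube_le hb he hδ0 hδ1 hs (j i') (c i') le_rfl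
      (by norm_num : (1 : ℝ) ≤ 3)
    simp only [one_mul] at h2
    rw [← hT'] at h2
    calc _ ≤ ∫⁻ x in T', ENNReal.ofReal ((2 / 2 ^ j i) ^ d) * m i *
            (ENNReal.ofReal ((2 / 2 ^ j i') ^ d) * m i' * ENNReal.ofReal (1 + |u' - u|) *
              ENNReal.ofReal (1 + (b x - u') ^ 2)) := by
          rw [← lintegral_indicator (measurableSet_tube _ _ _ _)]
          refine lintegral_mono fun x => ?_
          by_cases hx' : x ∈ T'
          · rw [indicator_of_mem hx', tubePiece, tubePiece, indicator_of_mem (s := T') hx']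
            refine (mul_le_mul_left (indicator_le_self _ _ _) _).trans ?_
            calc _ = ENNReal.ofReal ((2 / 2 ^ j i) ^ d) * m i *
                  (ENNReal.ofReal ((2 / 2 ^ j i') ^ d) * m i') * (‖b x - u‖ₑ * ‖b x - u'‖ₑ) := by
                  ring
              _ ≤ _ := by
                  refine (mul_le_mul_right (enorm_mul_enorm_le (b x) u u') _).trans
                    (le_of_eq ?_)
                  ring
          · rw [tubePiece, tubePiece, indicator_of_notMem (s := T') hx', mul_zero]
            exact zero_le
      _ ≤ ENNReal.ofReal ((2 / 2 ^ j i) ^ d) * m i *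
          ((m i' * ENNReal.ofReal (1 + |u' - u|)) * (ENNReal.ofReal ((2 / 2 ^ j i') ^ d) *
            ∫⁻ x in T', ENNReal.ofReal (1 + (b x - u') ^ 2))) := by
          have hmi' : m i' ≠ ∞ := ne_top_of_le_ne_top (by rw [volume_cube]; finiteness) (hm i')
          have hmi : m i ≠ ∞ := ne_top_of_le_ne_top (by rw [volume_cube]; finiteness) (hm i)
          rw [lintegral_const_mul' _ _ (by finiteness), lintegral_const_mul' _ _ (by finiteness)]
          refine le_of_eq ?_
          ring
      _ ≤ _ := by
          refine mul_le_mul_right ?_ _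
          rw [mul_comm]
          exact mul_le_mul' h2 ((mul_le_mul_left (hm i') _).trans h1)
  · have h0 : ∀ x, tubePiece b e δ s (j i) (c i) (m i) x *
        tubePiece b e δ s (j i') (c i') (m i') x = 0 := by
      intro x
      by_cases hx : x ∈ T
      · have hx' : x ∉ T' := fun hx' => hne ⟨x, hx, hx'⟩
        rw [tubePiece, tubePiece, indicator_of_notMem (s := T') hx', mul_zero]
      · rw [tubePiece, indicator_of_notMem (s := T) hx, zero_mul]
    simp only [h0, lintegral_zero]
    exact zero_le

lemma lintegral_tsum_tubePiece_sq_le [Countable I] (hb : BMOBound b 1) (he : ‖e‖ = 1)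
    (hδ0 : 0 < δ) (hδ1 : δ ≤ 1) (hs : 1 ≤ 2 ^ s * δ)
    (hm : ∀ i, m i ≤ volume (cube (c i) (2 ^ (j i - (s : ℤ)))))
    (hdisj : Pairwise (Function.onFun Disjoint fun i => ocube (c i) (2 ^ (j i - (s : ℤ))))) :
    ∫⁻ x, (∑' i, tubePiece b e δ s (j i) (c i) (m i) x) ^ 2 ≤
      ENNReal.ofReal
          (4 * (tubeConst d * (6 * (d + 2)) ^ d * (s + d + 4) ^ 2 * (δ ^ d / δ)) ^ 2) *
        ∑' i, m i := by
  set B : ℝ := tubeConst d * (6 * (d + 2)) ^ d * (s + d + 4) ^ 2 * (δ ^ d / δ)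
  have hB : 0 ≤ B := by
    have := tubeConst_pos d
    positivity
  refine (lintegral_tsum_sq_le j _ fun i => aemeasurable_tubePiece hb.1 _ _ _ _ _ _).trans ?_
  have key : ∀ i, (∑' i', if j i' ≤ j i then
      ∫⁻ x, tubePiece b e δ s (j i) (c i) (m i) x * tubePiece b e δ s (j i') (c i') (m i') x
        else 0) ≤ ENNReal.ofReal (2 * B ^ 2) * m i := by
    intro i
    set T := tube (c i) e (3 * ((d + 2) * 2 ^ j i)) (3 * ((d + 2) * (δ * 2 ^ j i)))
    set w : Rd d → ℝ≥0∞ := fun x =>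
      ENNReal.ofReal (1 + (b x - cavg b (cube (c i) (2 ^ (j i - (s : ℤ))))) ^ 2)
    calc _ ≤ ∑' i', ENNReal.ofReal ((2 / 2 ^ j i) ^ d) * m i * (ENNReal.ofReal B *
            (2 * ∫⁻ x in ocube (c i') (2 ^ (j i' - (s : ℤ))) ∩ T, w x)) := by
          refine ENNReal.tsum_le_tsum fun i' => ?_
          split_ifs with h
          · exact lintegral_tubePiece_mul_le hb he hδ0 hδ1 hs hm h
          · exact zero_le
      _ = ENNReal.ofReal ((2 / 2 ^ j i) ^ d) * m i * (ENNReal.ofReal B *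
            (2 * ∫⁻ x in ⋃ i', ocube (c i') (2 ^ (j i' - (s : ℤ))) ∩ T, w x)) := by
          rw [ENNReal.tsum_mul_left, ENNReal.tsum_mul_left, ENNReal.tsum_mul_left,
            lintegral_iUnion]
          · exact fun i' => (isOpen_ocube _ _).measurableSet.inter (measurableSet_tube _ _ _ _)
          · exact fun i₁ i₂ h => (hdisj h).mono inter_subset_left inter_subset_left
      _ ≤ ENNReal.ofReal ((2 / 2 ^ j i) ^ d) * m i * (ENNReal.ofReal B *
            (2 * ∫⁻ x in T, w x)) := by
          gcongr
          exact iUnion_subset fun i' => inter_subset_right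
      _ = 2 * ENNReal.ofReal B * m i * (ENNReal.ofReal ((2 / 2 ^ j i) ^ d) *
            ∫⁻ x in T, w x) := by ring
      _ ≤ 2 * ENNReal.ofReal B * m i * ENNReal.ofReal B :=
          mul_le_mul_right (ofReal_mul_lintegral_tube_le hb he hδ0 hδ1 hs (j i) (c i)
            (by norm_num) le_rfl) _
      _ = _ := by
          rw [ENNReal.ofReal_mul zero_le_two, ENNReal.ofReal_pow hB, ENNReal.ofReal_ofNat]
          ring
  refine (mul_le_mul_right (ENNReal.tsum_le_tsum key) _).trans (le_of_eq ?_)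
  rw [ENNReal.tsum_mul_left, ← mul_assoc]
  congr 1
  rw [show 4 * B ^ 2 = 2 * (2 * B ^ 2) by ring, ENNReal.ofReal_mul zero_le_two (q := 2 * B ^ 2),
    ENNReal.ofReal_ofNat]

end Family

end AlmostOrthogonality

section Assembly

variable {d : ℕ}

lemma IsCubeSide.side_unique (hd : d ≠ 0) {Q : Set (Rd d)} {l l' : ℝ} (hl : 0 ≤ l)
    (hl' : 0 ≤ l') (h : IsCubeSide Q l) (h' : IsCubeSide Q l') : l = l' := by
  obtain ⟨c, hc⟩ := h
  obtain ⟨c', hc'⟩ := h'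
  have h1 : volume (cube c l) = volume (cube c' l') := congrArg volume (hc.symm.trans hc')
  rw [volume_cube, volume_cube, ← ENNReal.ofReal_pow hl, ← ENNReal.ofReal_pow hl',
    ENNReal.ofReal_eq_ofReal_iff (by positivity) (by positivity)] at h1
  exact (pow_left_inj₀ hl hl' hd).1 h1

lemma countable_of_forall_isDyadicCube {S : Set (Set (Rd d))} (hS : ∀ Q ∈ S, IsDyadicCube Q) :
    S.Countable := by
  refine (countable_range fun p : ℤ × (Fin d → ℤ) =>
    {x : Rd d | ∀ i, x i ∈ Icc ((2:ℝ) ^ p.1 * p.2 i) ((2:ℝ) ^ p.1 * (p.2 i + 1))}).mono ?_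
  intro Q hQ
  obtain ⟨k, m, hkm⟩ := hS Q hQ
  exact ⟨(k, m), hkm.symm⟩

lemma pow_four_le_rpow {γ : ℝ} (hγ : 0 < γ) (s : ℕ) :
    (s : ℝ) ^ 4 ≤ 24 * (2 / (γ * Real.log 2)) ^ 4 * (2 : ℝ) ^ ((s : ℝ) * γ / 2) := by
  have hlog : 0 < Real.log 2 := Real.log_pos one_lt_two
  have h1 := Real.pow_div_factorial_le_exp (Real.log 2 * ((s : ℝ) * γ / 2)) (by positivity) 4
  rw [← Real.rpow_def_of_pos two_pos, div_le_iff₀ (by positivity)] at h1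
  have h2 : (s : ℝ) ^ 4 =
      (2 / (γ * Real.log 2)) ^ 4 * (Real.log 2 * ((s : ℝ) * γ / 2)) ^ 4 := by
    rw [← mul_pow]
    congr 1
    field_simp
  have h3 : ((Nat.factorial 4 : ℕ) : ℝ) = 24 := by norm_num [Nat.factorial]
  rw [h3] at h1
  rw [h2]
  calc _ ≤ (2 / (γ * Real.log 2)) ^ 4 * ((2 : ℝ) ^ ((s : ℝ) * γ / 2) * 24) := by gcongr
    _ = _ := by ring

lemma const_le_rpow {γ : ℝ} (hγ : 0 < γ) {s : ℕ} (hs : 1 ≤ s) :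
    4 * (tubeConst d * (6 * (d + 2)) ^ d * (s + d + 4) ^ 2 *
        (((2 : ℝ) ^ (-((s : ℝ) * γ))) ^ d / (2 : ℝ) ^ (-((s : ℝ) * γ)))) ^ 2 ≤
      4 * (tubeConst d * (6 * (d + 2)) ^ d) ^ 2 * (d + 5) ^ 4 *
          (24 * (2 / (γ * Real.log 2)) ^ 4) *
        (2 : ℝ) ^ (-(s : ℝ) * γ * (2 * (d : ℝ) - 5 / 2)) := by
  have hs1 : (1 : ℝ) ≤ s := by exact_mod_cast hs
  have hd0 : (0 : ℝ) ≤ d := Nat.cast_nonneg d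
  have h1 : (2 : ℝ) ^ (-(s : ℝ) * γ * (2 * (d : ℝ) - 5 / 2)) =
      (2 : ℝ) ^ ((s : ℝ) * γ / 2) *
        (((2 : ℝ) ^ (-((s : ℝ) * γ))) ^ d / (2 : ℝ) ^ (-((s : ℝ) * γ))) ^ 2 := by
    rw [← Real.rpow_natCast _ d, ← Real.rpow_mul zero_le_two, ← Real.rpow_sub two_pos,
      ← Real.rpow_natCast _ 2, ← Real.rpow_mul zero_le_two, ← Real.rpow_add two_pos]
    congr 1
    push_cast
    ring
  have h2 : ((s : ℝ) + d + 4) ^ 4 ≤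
      (d + 5) ^ 4 * (24 * (2 / (γ * Real.log 2)) ^ 4 * (2 : ℝ) ^ ((s : ℝ) * γ / 2)) := by
    calc _ ≤ ((d + 5) * (s : ℝ)) ^ 4 := by
          gcongr
          nlinarith
      _ ≤ _ := by
          rw [mul_pow]
          gcongr
          exact pow_four_le_rpow hγ s
  rw [h1]
  set D : ℝ := ((2 : ℝ) ^ (-((s : ℝ) * γ))) ^ d / (2 : ℝ) ^ (-((s : ℝ) * γ))
  calc _ = 4 * (tubeConst d * (6 * (d + 2)) ^ d) ^ 2 * D ^ 2 * ((s : ℝ) + d + 4) ^ 4 := by ring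
    _ ≤ 4 * (tubeConst d * (6 * (d + 2)) ^ d) ^ 2 * D ^ 2 * _ :=
        mul_le_mul_of_nonneg_left h2 (by positivity)
    _ = _ := by ring

lemma eLpNorm_two_sq_eq_lintegral (f : Rd d → ℝ) :
    eLpNorm f 2 volume ^ 2 = ∫⁻ x, ‖f x‖ₑ ^ 2 := by
  have := eLpNorm_nnreal_pow_eq_lintegral (μ := volume) (f := f) (p := 2) two_ne_zero
  simpa using this

/-- Pointwise bound of the commutator sum by the tube pieces. -/
lemma enorm_tsum_le_tsum_tubePiece {ι : Type} [Fintype ι] {Ω φ ζ b : Rd d → ℝ} {e : ι → Rd d}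
    {a : ℝ} {ν : ι} {s : ℕ} (hζ : ZetaCutoff ζ) (hφ : PhiCutoff φ)
    (hΩ : ∀ᵐ z : Rd d, |Ω (‖z‖⁻¹ • z)| ≤ 1) (hs : 1 ≤ 2 ^ s * (2 : ℝ) ^ (-a))
    {S : Set (Set (Rd d))} {h : Set (Rd d) → Rd d → ℝ} (hS : GoodFamily S h)
    {c : (Σ j : ℤ, {Q : Set (Rd d) // Q ∈ S ∧ IsCubeSide Q ((2:ℝ) ^ (j - (s:ℤ)))}) → Rd d}
    (hc : ∀ i, i.2.1 = cube (c i) ((2:ℝ) ^ (i.1 - (s:ℤ)))) (x : Rd d) :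
    ‖∑' (j : ℤ), ∑' (Q : {Q : Set (Rd d) // Q ∈ S ∧ IsCubeSide Q ((2:ℝ) ^ (j - (s:ℤ)))}),
        (b x - cavg b Q.1) * convK (Kjnu Ω φ ζ e a j ν) (h Q.1) x‖ₑ ≤
      ∑' i, tubePiece b (e ν) ((2 : ℝ) ^ (-a)) s i.1 (c i)
        (∫⁻ y, ENNReal.ofReal |h i.2.1 y|) x := by
  refine enorm_tsum_le_tsum_enorm.trans
    ((ENNReal.tsum_le_tsum fun j => enorm_tsum_le_tsum_enorm).trans ?_)
  rw [← ENNReal.tsum_sigma fun j (Q : {Q : Set (Rd d) // Q ∈ S ∧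
    IsCubeSide Q ((2:ℝ) ^ (j - (s:ℤ)))}) =>
      ‖(b x - cavg b Q.1) * convK (Kjnu Ω φ ζ e a j ν) (h Q.1) x‖ₑ]
  refine ENNReal.tsum_le_tsum fun i => ?_
  have hlj : (2:ℝ) ^ (i.1 - (s:ℤ)) ≤ (2 : ℝ) ^ (-a) * 2 ^ i.1 := by
    have h0 : (0 : ℝ) < 2 ^ i.1 := by positivity
    rw [zpow_sub_natCast_eq, div_le_iff₀ (by positivity)]
    nlinarith
  have hg : Function.support (h i.2.1) ⊆ cube (c i) ((2:ℝ) ^ (i.1 - (s:ℤ))) := by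
    rw [← hc i]
    exact (hS.2.2 _ i.2.2.1).2.1
  have h1 := enorm_convK_le (e := e) (ν := ν) hζ hφ hΩ (by positivity) hlj hg x
  rw [enorm_mul, mul_comm, tubePiece, ← hc i]
  refine (mul_le_mul_left h1 _).trans (le_of_eq ?_)
  by_cases hx : x ∈ tube (c i) (e ν) ((d + 2) * 2 ^ i.1) ((d + 2) * ((2:ℝ) ^ (-a) * 2 ^ i.1))
  · rw [indicator_of_mem hx, indicator_of_mem hx]
  · rw [indicator_of_notMem hx, indicator_of_notMem hx, zero_mul]

end Assembly

/-- inequality (3.4). For each fixed `ν ∈ Λ_s`,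
`‖Σ_j Σ_{Q∈S_{j-s}} (b-⟨b⟩_Q)T_{jν}^s h_Q‖²_{L²} ≤ C_{d,γ} 2^{-sγ(2d-5/2)} Σ_{Q∈S}‖h_Q‖_{L¹}`. -/
theorem statement9 (d : ℕ) (hd : 2 ≤ d) (γ : ℝ) (hγ0 : 0 < γ) (hγ1 : γ < 1)
    (ζ φ : Rd d → ℝ) (hζ : ZetaCutoff ζ) (hφ : PhiCutoff φ) :
    ∃ C : ℝ, 0 < C ∧
      ∀ (s : ℕ), 100 ≤ s →
      ∀ (ι : Type) [Fintype ι], ∀ (e : ι → Rd d), SphereNet e s γ →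
      ∀ (Ω : Rd d → ℝ), Measurable Ω → Homog0 Ω →
        (∀ᵐ θ ∂(sphereMeasure d), |Ω θ| ≤ 1) →
      ∀ (b : Rd d → ℝ), BMOBound b 1 →
      ∀ (S : Set (Set (Rd d))) (h : Set (Rd d) → Rd d → ℝ), GoodFamily S h →
      ∀ ν : ι,
        eLpNorm
            (fun x => ∑' (j : ℤ),
              ∑' (Q : {Q : Set (Rd d) // Q ∈ S ∧ IsCubeSide Q ((2:ℝ) ^ (j - (s:ℤ)))}),
                (b x - cavg b Q.1) * convK (Kjnu Ω φ ζ e ((s:ℝ) * γ) j ν) (h Q.1) x)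
            2 volume ^ 2 ≤
          ENNReal.ofReal (C * (2:ℝ) ^ (-(s:ℝ) * γ * (2 * (d:ℝ) - 5/2))) *
            ∑' (Q : S), ∫⁻ x, ENNReal.ofReal |h Q.1 x| := by
  have hlog : 0 < Real.log 2 := Real.log_pos one_lt_two
  have hC := tubeConst_pos d
  refine ⟨4 * (tubeConst d * (6 * (d + 2)) ^ d) ^ 2 * (d + 5) ^ 4 *
    (24 * (2 / (γ * Real.log 2)) ^ 4), by positivity, ?_⟩
  intro s hs ι _ e he Ω hΩm _ hΩ b hb S h hS ν
  have hΩ' := ae_normalize_of_ae_sphereMeasure hd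
    (measurableSet_le hΩm.abs measurable_const) hΩ
  have hsδ : 1 ≤ 2 ^ s * (2 : ℝ) ^ (-((s : ℝ) * γ)) := by
    rw [← Real.rpow_natCast, ← Real.rpow_add two_pos]
    refine Real.one_le_rpow one_le_two ?_
    nlinarith [Nat.cast_nonneg (α := ℝ) s]
  have hδ1 : (2 : ℝ) ^ (-((s : ℝ) * γ)) ≤ 1 :=
    Real.rpow_le_one_of_one_le_of_nonpos one_le_two (neg_nonpos.2 (by positivity))
  choose c hc using fun i : Σ j : ℤ, {Q : Set (Rd d) // Q ∈ S ∧
    IsCubeSide Q ((2:ℝ) ^ (j - (s:ℤ)))} => i.2.2.2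
  have hc' : ∀ i, i.2.1 = cube (c i) ((2:ℝ) ^ (i.1 - (s:ℤ))) := hc
  let p : (Σ j : ℤ, {Q : Set (Rd d) // Q ∈ S ∧ IsCubeSide Q ((2:ℝ) ^ (j - (s:ℤ)))}) → S :=
    fun i => ⟨i.2.1, i.2.2.1⟩
  have hp : Function.Injective p := by
    rintro ⟨j, Q, hQ, hQj⟩ ⟨j', Q', hQ', hQj'⟩ h
    obtain rfl : Q = Q' := congrArg Subtype.val h
    have h1 := hQj.side_unique (by omega) (by positivity) (by positivity) hQj'
    obtain rfl : j = j' := by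
      have := zpow_right_injective₀ two_pos (OfNat.ofNat_ne_one 2) h1
      omega
    rfl
  have : Countable S := (countable_of_forall_isDyadicCube hS.1).to_subtype
  have := hp.countable
  have hdisj : Pairwise (Function.onFun Disjoint fun i =>
      ocube (c i) ((2:ℝ) ^ (i.1 - (s:ℤ)))) := by
    intro i i' hne
    have hint : ∀ i, ocube (c i) ((2:ℝ) ^ (i.1 - (s:ℤ))) ⊆ interior i.2.1 := fun i => by
      rw [hc' i]
      exact interior_maximal ((ocube_subset_hcube _ _).trans (hcube_subset_cube _ _))
        (isOpen_ocube _ _)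
    refine Disjoint.mono (hint i) (hint i') (disjoint_iff_inter_eq_empty.2 ?_)
    exact hS.2.1 i.2.2.1 i'.2.2.1 fun h => hne (hp (Subtype.ext h))
  have hm : ∀ i, ∫⁻ y, ENNReal.ofReal |h (p i).1 y| ≤
      volume (cube (c i) ((2:ℝ) ^ (i.1 - (s:ℤ)))) := fun i => by
    rw [← hc' i]
    exact (hS.2.2 _ i.2.2.1).2.2
  rw [eLpNorm_two_sq_eq_lintegral]
  calc _ ≤ ∫⁻ x, (∑' i, tubePiece b (e ν) ((2 : ℝ) ^ (-((s : ℝ) * γ))) s i.1 (c i)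
          (∫⁻ y, ENNReal.ofReal |h (p i).1 y|) x) ^ 2 :=
        lintegral_mono fun x =>
          pow_le_pow_left' (enorm_tsum_le_tsum_tubePiece hζ hφ hΩ' hsδ hS hc' x) 2
    _ ≤ _ := lintegral_tsum_tubePiece_sq_le hb (he.1 ν) (by positivity) hδ1 hsδ hm hdisj
    _ ≤ _ := mul_le_mul' (ENNReal.ofReal_le_ofReal (const_le_rpow hγ0 (by omega)))
        (ENNReal.tsum_comp_le_tsum_of_injective hp fun Q : S =>
          ∫⁻ y, ENNReal.ofReal |h Q.1 y|)
end
end
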